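/- arXiv:0906.2954 — 2 statements merged into one kernel-verified Lean document; each statement's English description precedes it below -/
import Mathlib

section
/- Coherence for SMI categories: in the free symmetric bimonoidal intermuting category M, if objects A and B are either both pure and diversified, or no letter occurs in either of them, then there is at most one arrow f : A → B in M. -/
namespace SMI

/-- Objects of the free symmetric bimonoidal intermuting category 𝓜 :
propositional formulas over an infinite set of letters (indexed by ℕ),
the constants ⊥ and ⊤, and the connectives ∨ and ∧. -/
inductive Frm : Type
  | pl : ℕ → Frm
  | bot : Frm
  | top : Frm
  | or : Frm → Frm → Frm
  | and : Frm → Frm → Frm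
  deriving DecidableEq

/-- Arrow terms of 𝓜 , generated from the primitive arrow terms
(associativity b, symmetry c, unit isomorphisms δ and σ, intermutation cᵏ,
the w-arrows and κ) by composition, ∨ and ∧.  The suffixes `To`/`From`
record the direction (`→`/`←`) of the corresponding isomorphism. -/
inductive Tm : Frm → Frm → Type
  | id (A : Frm) : Tm A A
  | comp {A B C : Frm} : Tm B C → Tm A B → Tm A C
  | orM {A B C D : Frm} : Tm A B → Tm C D → Tm (A.or C) (B.or D)
  | andM {A B C D : Frm} : Tm A B → Tm C D → Tm (A.and C) (B.and D)
  | bOrTo (A B C : Frm) : Tm (A.or (B.or C)) ((A.or B).or C)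
  | bOrFrom (A B C : Frm) : Tm ((A.or B).or C) (A.or (B.or C))
  | bAndTo (A B C : Frm) : Tm (A.and (B.and C)) ((A.and B).and C)
  | bAndFrom (A B C : Frm) : Tm ((A.and B).and C) (A.and (B.and C))
  | cOr (A B : Frm) : Tm (A.or B) (B.or A)
  | cAnd (A B : Frm) : Tm (A.and B) (B.and A)
  | dOrTo (A : Frm) : Tm (A.or Frm.bot) A
  | dOrFrom (A : Frm) : Tm A (A.or Frm.bot)
  | sOrTo (A : Frm) : Tm (Frm.bot.or A) A
  | sOrFrom (A : Frm) : Tm A (Frm.bot.or A)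
  | dAndTo (A : Frm) : Tm (A.and Frm.top) A
  | dAndFrom (A : Frm) : Tm A (A.and Frm.top)
  | sAndTo (A : Frm) : Tm (Frm.top.and A) A
  | sAndFrom (A : Frm) : Tm A (Frm.top.and A)
  | ck (A B C D : Frm) : Tm ((A.and B).or (C.and D)) ((A.or C).and (B.or D))
  | wAndTo : Tm (Frm.bot.and Frm.bot) Frm.bot
  | wAndFrom : Tm Frm.bot (Frm.bot.and Frm.bot)
  | wOrTo : Tm (Frm.top.or Frm.top) Frm.top
  | wOrFrom : Tm Frm.top (Frm.top.or Frm.top)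
  | kappa : Tm Frm.bot Frm.top

/-- The equality of arrows of the free SMI category 𝓜 : the smallest
congruence (with respect to ∘, ∨, ∧) containing the equations of the two
symmetric monoidal structures, the naturality and isomorphism conditions,
and the thirteen coherence diagrams (1)-(13) of an SMI category. -/
inductive MEq : ∀ {A B : Frm}, Tm A B → Tm A B → Prop
  -- equivalence
  | refl {A B : Frm} (f : Tm A B) : MEq f f
  | symm {A B : Frm} {f g : Tm A B} : MEq f g → MEq g f
  | trans {A B : Frm} {f g h : Tm A B} : MEq f g → MEq g h → MEq f h
  -- congruence
  | comp_congr {A B C : Frm} {g g' : Tm B C} {f f' : Tm A B} :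
      MEq g g' → MEq f f' → MEq (g.comp f) (g'.comp f')
  | or_congr {A B C D : Frm} {f f' : Tm A B} {g g' : Tm C D} :
      MEq f f' → MEq g g' → MEq (f.orM g) (f'.orM g')
  | and_congr {A B C D : Frm} {f f' : Tm A B} {g g' : Tm C D} :
      MEq f f' → MEq g g' → MEq (f.andM g) (f'.andM g')
  -- category
  | id_comp {A B : Frm} (f : Tm A B) : MEq ((Tm.id B).comp f) f
  | comp_id {A B : Frm} (f : Tm A B) : MEq (f.comp (Tm.id A)) f
  | comp_assoc {A B C D : Frm} (h : Tm C D) (g : Tm B C) (f : Tm A B) :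
      MEq ((h.comp g).comp f) (h.comp (g.comp f))
  -- ∨ and ∧ are biendofunctors
  | or_id (A B : Frm) : MEq ((Tm.id A).orM (Tm.id B)) (Tm.id (A.or B))
  | and_id (A B : Frm) : MEq ((Tm.id A).andM (Tm.id B)) (Tm.id (A.and B))
  | or_comp {A B C A' B' C' : Frm} (g : Tm B C) (f : Tm A B) (g' : Tm B' C') (f' : Tm A' B') :
      MEq ((g.comp f).orM (g'.comp f')) ((g.orM g').comp (f.orM f'))
  | and_comp {A B C A' B' C' : Frm} (g : Tm B C) (f : Tm A B) (g' : Tm B' C') (f' : Tm A' B') :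
      MEq ((g.comp f).andM (g'.comp f')) ((g.andM g').comp (f.andM f'))
  -- naturality
  | bOr_nat {A A' B B' C C' : Frm} (f : Tm A A') (g : Tm B B') (h : Tm C C') :
      MEq ((Tm.bOrTo A' B' C').comp (f.orM (g.orM h))) (((f.orM g).orM h).comp (Tm.bOrTo A B C))
  | bAnd_nat {A A' B B' C C' : Frm} (f : Tm A A') (g : Tm B B') (h : Tm C C') :
      MEq ((Tm.bAndTo A' B' C').comp (f.andM (g.andM h))) (((f.andM g).andM h).comp (Tm.bAndTo A B C))
  | cOr_nat {A A' B B' : Frm} (f : Tm A A') (g : Tm B B') :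
      MEq ((Tm.cOr A' B').comp (f.orM g)) ((g.orM f).comp (Tm.cOr A B))
  | cAnd_nat {A A' B B' : Frm} (f : Tm A A') (g : Tm B B') :
      MEq ((Tm.cAnd A' B').comp (f.andM g)) ((g.andM f).comp (Tm.cAnd A B))
  | dOr_nat {A A' : Frm} (f : Tm A A') :
      MEq ((Tm.dOrTo A').comp (f.orM (Tm.id Frm.bot))) (f.comp (Tm.dOrTo A))
  | sOr_nat {A A' : Frm} (f : Tm A A') :
      MEq ((Tm.sOrTo A').comp ((Tm.id Frm.bot).orM f)) (f.comp (Tm.sOrTo A))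
  | dAnd_nat {A A' : Frm} (f : Tm A A') :
      MEq ((Tm.dAndTo A').comp (f.andM (Tm.id Frm.top))) (f.comp (Tm.dAndTo A))
  | sAnd_nat {A A' : Frm} (f : Tm A A') :
      MEq ((Tm.sAndTo A').comp ((Tm.id Frm.top).andM f)) (f.comp (Tm.sAndTo A))
  | ck_nat {A A' B B' C C' D D' : Frm}
      (f : Tm A A') (g : Tm B B') (h : Tm C C') (k : Tm D D') :
      MEq ((Tm.ck A' B' C' D').comp ((f.andM g).orM (h.andM k)))
          (((f.orM h).andM (g.orM k)).comp (Tm.ck A B C D))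
  -- the primitive arrows other than cᵏ and κ are isomorphisms
  | bOr_iso1 (A B C : Frm) : MEq ((Tm.bOrTo A B C).comp (Tm.bOrFrom A B C)) (Tm.id _)
  | bOr_iso2 (A B C : Frm) : MEq ((Tm.bOrFrom A B C).comp (Tm.bOrTo A B C)) (Tm.id _)
  | bAnd_iso1 (A B C : Frm) : MEq ((Tm.bAndTo A B C).comp (Tm.bAndFrom A B C)) (Tm.id _)
  | bAnd_iso2 (A B C : Frm) : MEq ((Tm.bAndFrom A B C).comp (Tm.bAndTo A B C)) (Tm.id _)
  | dOr_iso1 (A : Frm) : MEq ((Tm.dOrTo A).comp (Tm.dOrFrom A)) (Tm.id _)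
  | dOr_iso2 (A : Frm) : MEq ((Tm.dOrFrom A).comp (Tm.dOrTo A)) (Tm.id _)
  | sOr_iso1 (A : Frm) : MEq ((Tm.sOrTo A).comp (Tm.sOrFrom A)) (Tm.id _)
  | sOr_iso2 (A : Frm) : MEq ((Tm.sOrFrom A).comp (Tm.sOrTo A)) (Tm.id _)
  | dAnd_iso1 (A : Frm) : MEq ((Tm.dAndTo A).comp (Tm.dAndFrom A)) (Tm.id _)
  | dAnd_iso2 (A : Frm) : MEq ((Tm.dAndFrom A).comp (Tm.dAndTo A)) (Tm.id _)
  | sAnd_iso1 (A : Frm) : MEq ((Tm.sAndTo A).comp (Tm.sAndFrom A)) (Tm.id _)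
  | sAnd_iso2 (A : Frm) : MEq ((Tm.sAndFrom A).comp (Tm.sAndTo A)) (Tm.id _)
  | wOr_iso1 : MEq (Tm.wOrTo.comp Tm.wOrFrom) (Tm.id _)
  | wOr_iso2 : MEq (Tm.wOrFrom.comp Tm.wOrTo) (Tm.id _)
  | wAnd_iso1 : MEq (Tm.wAndTo.comp Tm.wAndFrom) (Tm.id _)
  | wAnd_iso2 : MEq (Tm.wAndFrom.comp Tm.wAndTo) (Tm.id _)
  | cOr_inv (A B : Frm) : MEq ((Tm.cOr B A).comp (Tm.cOr A B)) (Tm.id _)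
  | cAnd_inv (A B : Frm) : MEq ((Tm.cAnd B A).comp (Tm.cAnd A B)) (Tm.id _)
  -- Mac Lane coherence for the two symmetric monoidal structures
  | pentagonOr (A B C D : Frm) :
      MEq ((Tm.bOrTo (A.or B) C D).comp (Tm.bOrTo A B (C.or D)))
          (((Tm.bOrTo A B C).orM (Tm.id D)).comp
            ((Tm.bOrTo A (B.or C) D).comp ((Tm.id A).orM (Tm.bOrTo B C D))))
  | pentagonAnd (A B C D : Frm) :
      MEq ((Tm.bAndTo (A.and B) C D).comp (Tm.bAndTo A B (C.and D)))
          (((Tm.bAndTo A B C).andM (Tm.id D)).comp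
            ((Tm.bAndTo A (B.and C) D).comp ((Tm.id A).andM (Tm.bAndTo B C D))))
  | triangleOr (A B : Frm) :
      MEq (((Tm.dOrTo A).orM (Tm.id B)).comp (Tm.bOrTo A Frm.bot B))
          ((Tm.id A).orM (Tm.sOrTo B))
  | triangleAnd (A B : Frm) :
      MEq (((Tm.dAndTo A).andM (Tm.id B)).comp (Tm.bAndTo A Frm.top B))
          ((Tm.id A).andM (Tm.sAndTo B))
  | hexagonOr (A B C : Frm) :
      MEq ((Tm.bOrTo C A B).comp ((Tm.cOr (A.or B) C).comp (Tm.bOrTo A B C)))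
          (((Tm.cOr A C).orM (Tm.id B)).comp
            ((Tm.bOrTo A C B).comp ((Tm.id A).orM (Tm.cOr B C))))
  | hexagonAnd (A B C : Frm) :
      MEq ((Tm.bAndTo C A B).comp ((Tm.cAnd (A.and B) C).comp (Tm.bAndTo A B C)))
          (((Tm.cAnd A C).andM (Tm.id B)).comp
            ((Tm.bAndTo A C B).comp ((Tm.id A).andM (Tm.cAnd B C))))
  | sigmaOr_c (A : Frm) : MEq (Tm.sOrTo A) ((Tm.dOrTo A).comp (Tm.cOr Frm.bot A))
  | sigmaAnd_c (A : Frm) : MEq (Tm.sAndTo A) ((Tm.dAndTo A).comp (Tm.cAnd Frm.top A))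
  -- the thirteen SMI diagrams
  | diag1 (A B C D E F : Frm) :
      MEq ((Tm.bAndTo (A.or D) (B.or E) (C.or F)).comp
            (((Tm.id (A.or D)).andM (Tm.ck B C E F)).comp (Tm.ck A (B.and C) D (E.and F))))
          (((Tm.ck A B D E).andM (Tm.id (C.or F))).comp
            ((Tm.ck (A.and B) C (D.and E) F).comp ((Tm.bAndTo A B C).orM (Tm.bAndTo D E F))))
  | diag2 (A B C D E F : Frm) :
      MEq (((Tm.bOrTo A B C).andM (Tm.bOrTo D E F)).comp
            ((Tm.ck A D (B.or C) (E.or F)).comp ((Tm.id (A.and D)).orM (Tm.ck B E C F))))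
          ((Tm.ck (A.or B) (D.or E) C F).comp
            (((Tm.ck A D B E).orM (Tm.id (C.and F))).comp
              (Tm.bOrTo (A.and D) (B.and E) (C.and F))))
  | diag3 (A B C D : Frm) :
      MEq ((Tm.cAnd (A.or C) (B.or D)).comp (Tm.ck A B C D))
          ((Tm.ck B A D C).comp ((Tm.cAnd A B).orM (Tm.cAnd C D)))
  | diag4 (A B C D : Frm) :
      MEq ((Tm.ck B D A C).comp (Tm.cOr (A.and C) (B.and D)))
          (((Tm.cOr A B).andM (Tm.cOr C D)).comp (Tm.ck A C B D))
  | diag5 (A B : Frm) :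
      MEq (Tm.ck A B Frm.bot Frm.bot)
          (((Tm.dOrFrom A).andM (Tm.dOrFrom B)).comp
            ((Tm.dOrTo (A.and B)).comp ((Tm.id (A.and B)).orM Tm.wAndTo)))
  | diag6 (A B : Frm) :
      MEq (Tm.ck A Frm.top B Frm.top)
          (((Tm.id (A.or B)).andM Tm.wOrFrom).comp
            ((Tm.dAndFrom (A.or B)).comp ((Tm.dAndTo A).orM (Tm.dAndTo B))))
  | diag7 :
      MEq (Tm.bOrTo Frm.top Frm.top Frm.top)
          ((Tm.wOrFrom.orM (Tm.id Frm.top)).comp ((Tm.id Frm.top).orM Tm.wOrTo))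
  | diag8 :
      MEq (Tm.bAndTo Frm.bot Frm.bot Frm.bot)
          ((Tm.wAndFrom.andM (Tm.id Frm.bot)).comp ((Tm.id Frm.bot).andM Tm.wAndTo))
  | diag9 :
      MEq ((Tm.id Frm.top).orM Tm.kappa) (Tm.wOrFrom.comp (Tm.dOrTo Frm.top))
  | diag10 :
      MEq ((Tm.id Frm.bot).andM Tm.kappa) ((Tm.dAndFrom Frm.bot).comp Tm.wAndTo)
  | diag11 :
      MEq (Tm.ck Frm.top Frm.bot Frm.bot Frm.top)
          (((Tm.dOrFrom Frm.top).andM (Tm.sOrFrom Frm.top)).comp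
            ((Tm.dAndFrom Frm.top).comp
              (Tm.kappa.comp
                ((Tm.dOrTo Frm.bot).comp ((Tm.sAndTo Frm.bot).orM (Tm.dAndTo Frm.bot))))))
  | diag12 : MEq (Tm.cOr Frm.top Frm.top) (Tm.wOrFrom.comp Tm.wOrTo)
  | diag13 : MEq (Tm.cAnd Frm.bot Frm.bot) (Tm.wAndFrom.comp Tm.wAndTo)

end SMI

namespace SMI

/-- Normalized disjunction : `B∨⊥ ↦ B`, `⊥∨B ↦ B`, `⊤∨⊤ ↦ ⊤`. -/
def orN : Frm → Frm → Frm
  | Frm.bot, B => B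
  | A, Frm.bot => A
  | Frm.top, Frm.top => Frm.top
  | A, B => A.or B

/-- Normalized conjunction : `B∧⊤ ↦ B`, `⊤∧B ↦ B`, `⊥∧⊥ ↦ ⊥`. -/
def andN : Frm → Frm → Frm
  | Frm.top, B => B
  | A, Frm.top => A
  | Frm.bot, Frm.bot => Frm.bot
  | A, B => A.and B

/-- The unit-normal form ν(A), obtained by iterated replacing of subformulas
`B∨⊥`, `⊥∨B`, `B∧⊤`, `⊤∧B` by `B`, of `⊥∧⊥` by `⊥` and of `⊤∨⊤` by `⊤`. -/
def nu : Frm → Frm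
  | Frm.or A B => orN (nu A) (nu B)
  | Frm.and A B => andN (nu A) (nu B)
  | A => A

/-- `⊥` occurs in the formula. -/
def hasBot : Frm → Prop
  | Frm.bot => True
  | Frm.pl _ => False
  | Frm.top => False
  | Frm.or A B => hasBot A ∨ hasBot B
  | Frm.and A B => hasBot A ∨ hasBot B

/-- `⊤` occurs in the formula. -/
def hasTop : Frm → Prop
  | Frm.top => True
  | Frm.pl _ => False
  | Frm.bot => False
  | Frm.or A B => hasTop A ∨ hasTop B
  | Frm.and A B => hasTop A ∨ hasTop B

/-- `A` is ⊥-pure : there is no occurrence of `⊥` in ν(A). -/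
def BotPure (A : Frm) : Prop := ¬ hasBot (nu A)

/-- `A` is ⊤-pure : there is no occurrence of `⊤` in ν(A). -/
def TopPure (A : Frm) : Prop := ¬ hasTop (nu A)

/-- `A` is pure : both ⊥-pure and ⊤-pure. -/
def Pure (A : Frm) : Prop := BotPure A ∧ TopPure A

end SMI

namespace SMI

/-- Number of occurrences of the letter `n` in a formula. -/
def cnt (n : ℕ) : Frm → ℕ
  | Frm.pl m => if m = n then 1 else 0
  | Frm.bot => 0
  | Frm.top => 0
  | Frm.or A B => cnt n A + cnt n B
  | Frm.and A B => cnt n A + cnt n B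

/-- A formula is diversified when every letter occurs in it at most once. -/
def Div (A : Frm) : Prop := ∀ n : ℕ, cnt n A ≤ 1

/-- No propositional letter occurs in the formula. -/
def NoLtr (A : Frm) : Prop := ∀ n : ℕ, cnt n A = 0

open CategoryTheory MonoidalCategory BraidedCategory

/-- Arrows of the free SMI category: arrow terms up to provable equality. -/
def Arrow (A B : Frm) : Type := Quot (@MEq A B)

instance : Category Frm where
  Hom := Arrow
  id A := Quot.mk _ (Tm.id A)
  comp := Quot.map₂ (fun f g => g.comp f) (fun _ _ _ h => h.comp_congr (.refl _))
    (fun _ _ _ h => (MEq.refl _).comp_congr h)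
  id_comp := by rintro _ _ ⟨f⟩; exact Quot.sound (MEq.comp_id f)
  comp_id := by rintro _ _ ⟨f⟩; exact Quot.sound (MEq.id_comp f)
  assoc := by rintro _ _ _ _ ⟨f⟩ ⟨g⟩ ⟨h⟩; exact Quot.sound (MEq.comp_assoc h g f).symm

/-- The arrow named by an arrow term. -/
def Tm.hom {A B : Frm} (f : Tm A B) : A ⟶ B := Quot.mk _ f

lemma MEq.hom_eq {A B : Frm} {f g : Tm A B} (h : MEq f g) : f.hom = g.hom := Quot.sound h

lemma Tm.hom_eq_iff {A B : Frm} {f g : Tm A B} : f.hom = g.hom ↔ MEq f g :=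
  Quot.eq.trans (Equivalence.eqvGen_iff ⟨MEq.refl, MEq.symm, MEq.trans⟩)

lemma Tm.hom_comp {A B C : Frm} (g : Tm B C) (f : Tm A B) : (g.comp f).hom = f.hom ≫ g.hom := rfl

lemma Tm.hom_ind {A B : Frm} {p : (A ⟶ B) → Prop} (h : ∀ f : Tm A B, p f.hom) (f : A ⟶ B) : p f :=
  Quot.ind h f

/-- The isomorphism given by two mutually inverse arrow terms. -/
@[simps]
def isoOf {A B : Frm} (f : Tm A B) (g : Tm B A) (h₁ : MEq (g.comp f) (.id A))
    (h₂ : MEq (f.comp g) (.id B)) : A ≅ B where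
  hom := f.hom
  inv := g.hom
  hom_inv_id := h₁.hom_eq
  inv_hom_id := h₂.hom_eq

/-- Conjunction of arrows. -/
def andH {A B C D : Frm} : (A ⟶ B) → (C ⟶ D) → (A.and C ⟶ B.and D) :=
  Quot.map₂ Tm.andM (fun _ _ _ h => (MEq.refl _).and_congr h) (fun _ _ _ h => h.and_congr (.refl _))

/-- Disjunction of arrows. -/
def orH {A B C D : Frm} : (A ⟶ B) → (C ⟶ D) → (A.or C ⟶ B.or D) :=
  Quot.map₂ Tm.orM (fun _ _ _ h => (MEq.refl _).or_congr h) (fun _ _ _ h => h.or_congr (.refl _))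

@[simp] lemma andH_id (A B : Frm) : andH (𝟙 A) (𝟙 B) = 𝟙 (A.and B) := (MEq.and_id A B).hom_eq

@[simp] lemma andH_comp {A B C A' B' C' : Frm} (f : A ⟶ B) (f' : A' ⟶ B') (g : B ⟶ C)
    (g' : B' ⟶ C') : andH f f' ≫ andH g g' = andH (f ≫ g) (f' ≫ g') := by
  induction f using Tm.hom_ind with | _ f
  induction f' using Tm.hom_ind with | _ f'
  induction g using Tm.hom_ind with | _ g
  induction g' using Tm.hom_ind with | _ g'
  exact (MEq.and_comp g f g' f').symm.hom_eq

@[simp] lemma orH_id (A B : Frm) : orH (𝟙 A) (𝟙 B) = 𝟙 (A.or B) := (MEq.or_id A B).hom_eq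

@[simp] lemma orH_comp {A B C A' B' C' : Frm} (f : A ⟶ B) (f' : A' ⟶ B') (g : B ⟶ C)
    (g' : B' ⟶ C') : orH f f' ≫ orH g g' = orH (f ≫ g) (f' ≫ g') := by
  induction f using Tm.hom_ind with | _ f
  induction f' using Tm.hom_ind with | _ f'
  induction g using Tm.hom_ind with | _ g
  induction g' using Tm.hom_ind with | _ g'
  exact (MEq.or_comp g f g' f').symm.hom_eq

@[simp] lemma orH_comp_assoc {A B C A' B' C' X : Frm} (f : A ⟶ B) (f' : A' ⟶ B') (g : B ⟶ C)
    (g' : B' ⟶ C') (h : C.or C' ⟶ X) :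
    orH f f' ≫ orH g g' ≫ h = orH (f ≫ g) (f' ≫ g') ≫ h := by
  rw [← Category.assoc, orH_comp]

/-- Disjunction of isomorphisms. -/
@[simps]
def orIso {A B C D : Frm} (f : A ≅ B) (g : C ≅ D) : A.or C ≅ B.or D where
  hom := orH f.hom g.hom
  inv := orH f.inv g.inv

instance {A B C D : Frm} (f : A ⟶ B) (g : C ⟶ D) [IsIso f] [IsIso g] : IsIso (orH f g) :=
  (orIso (asIso f) (asIso g)).isIso_hom

/-- Conjunction of isomorphisms. -/
@[simps]
def andIso {A B C D : Frm} (f : A ≅ B) (g : C ≅ D) : A.and C ≅ B.and D where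
  hom := andH f.hom g.hom
  inv := andH f.inv g.inv

instance : MonoidalCategoryStruct Frm where
  tensorObj := Frm.and
  whiskerLeft X _ _ f := andH (𝟙 X) f
  whiskerRight f Y := andH f (𝟙 Y)
  tensorHom := andH
  tensorUnit := Frm.top
  associator A B C := isoOf (.bAndFrom A B C) (.bAndTo A B C) (.bAnd_iso1 A B C) (.bAnd_iso2 A B C)
  leftUnitor A := isoOf (.sAndTo A) (.sAndFrom A) (.sAnd_iso2 A) (.sAnd_iso1 A)
  rightUnitor A := isoOf (.dAndTo A) (.dAndFrom A) (.dAnd_iso2 A) (.dAnd_iso1 A)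

lemma andH_assoc_inv {A A' B B' C C' : Frm} (f : A ⟶ A') (g : B ⟶ B') (h : C ⟶ C') :
    (f ⊗ₘ (g ⊗ₘ h)) ≫ (α_ A' B' C').inv = (α_ A B C).inv ≫ ((f ⊗ₘ g) ⊗ₘ h) := by
  induction f using Tm.hom_ind with | _ f
  induction g using Tm.hom_ind with | _ g
  induction h using Tm.hom_ind with | _ h
  exact (MEq.bAnd_nat f g h).hom_eq

instance : MonoidalCategory Frm := .ofTensorHom
  (id_tensorHom_id := andH_id)
  (id_tensorHom := fun _ _ _ _ => rfl)
  (tensorHom_id := fun _ _ => rfl)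
  (tensorHom_comp_tensorHom := andH_comp)
  (associator_naturality := by
    intros _ _ _ _ _ _ f g h
    rw [← Iso.inv_comp_eq, ← Category.assoc, ← andH_assoc_inv, Category.assoc, Iso.inv_hom_id,
      Category.comp_id])
  (leftUnitor_naturality := by rintro _ _ ⟨f⟩; exact (MEq.sAnd_nat f).hom_eq)
  (rightUnitor_naturality := by rintro _ _ ⟨f⟩; exact (MEq.dAnd_nat f).hom_eq)
  (pentagon := by
    intro A B C D
    have h := (MEq.pentagonAnd A B C D).hom_eq
    simp only [Tm.hom_comp, Category.assoc] at h
    have h : ((α_ A B (C ⊗ D)).symm ≪≫ (α_ (A ⊗ B) C D).symm) =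
        andIso (Iso.refl A) (α_ B C D).symm ≪≫ (α_ A (B ⊗ C) D).symm ≪≫
          andIso (α_ A B C).symm (Iso.refl D) :=
      Iso.ext h
    exact (Category.assoc _ _ _).symm.trans (congrArg Iso.inv h).symm)
  (triangle := by
    intro A B
    have h : (α_ A (𝟙_ Frm) B).inv ≫ ((ρ_ A).hom ⊗ₘ 𝟙 B) = 𝟙 A ⊗ₘ (λ_ B).hom :=
      (MEq.triangleAnd A B).hom_eq
    rw [← h, Iso.hom_inv_id_assoc])

/-- The objects of the free SMI category, with the monoidal structure given by disjunction. -/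
def OrFrm : Type := Frm

instance : Category OrFrm := inferInstanceAs (Category Frm)

instance : MonoidalCategoryStruct OrFrm where
  tensorObj := Frm.or
  whiskerLeft X _ _ f := orH (𝟙 X) f
  whiskerRight f Y := orH f (𝟙 Y)
  tensorHom := orH
  tensorUnit := Frm.bot
  associator A B C := isoOf (.bOrFrom A B C) (.bOrTo A B C) (.bOr_iso1 A B C) (.bOr_iso2 A B C)
  leftUnitor A := isoOf (.sOrTo A) (.sOrFrom A) (.sOr_iso2 A) (.sOr_iso1 A)
  rightUnitor A := isoOf (.dOrTo A) (.dOrFrom A) (.dOr_iso2 A) (.dOr_iso1 A)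

lemma orH_assoc_inv {A A' B B' C C' : OrFrm} (f : A ⟶ A') (g : B ⟶ B') (h : C ⟶ C') :
    (f ⊗ₘ (g ⊗ₘ h)) ≫ (α_ A' B' C').inv = (α_ A B C).inv ≫ ((f ⊗ₘ g) ⊗ₘ h) := by
  induction f using Tm.hom_ind with | _ f
  induction g using Tm.hom_ind with | _ g
  induction h using Tm.hom_ind with | _ h
  exact (MEq.bOr_nat f g h).hom_eq

instance : MonoidalCategory OrFrm := .ofTensorHom
  (id_tensorHom_id := orH_id)
  (id_tensorHom := fun _ _ _ _ => rfl)
  (tensorHom_id := fun _ _ => rfl)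
  (tensorHom_comp_tensorHom := orH_comp)
  (associator_naturality := by
    intros _ _ _ _ _ _ f g h
    rw [← Iso.inv_comp_eq, ← Category.assoc, ← orH_assoc_inv, Category.assoc, Iso.inv_hom_id,
      Category.comp_id])
  (leftUnitor_naturality := by rintro _ _ ⟨f⟩; exact (MEq.sOr_nat f).hom_eq)
  (rightUnitor_naturality := by rintro _ _ ⟨f⟩; exact (MEq.dOr_nat f).hom_eq)
  (pentagon := by
    intro A B C D
    have h := (MEq.pentagonOr A B C D).hom_eq
    simp only [Tm.hom_comp, Category.assoc] at h
    have h : ((α_ A B (C ⊗ D)).symm ≪≫ (α_ (A ⊗ B) C D).symm) =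
        orIso (Iso.refl A) (α_ B C D).symm ≪≫ (α_ A (B ⊗ C) D).symm ≪≫
          orIso (α_ A B C).symm (Iso.refl D) :=
      Iso.ext h
    exact (Category.assoc _ _ _).symm.trans (congrArg Iso.inv h).symm)
  (triangle := by
    intro A B
    have h : (α_ A (𝟙_ OrFrm) B).inv ≫ ((ρ_ A).hom ⊗ₘ 𝟙 B) = 𝟙 A ⊗ₘ (λ_ B).hom :=
      (MEq.triangleOr A B).hom_eq
    rw [← h, Iso.hom_inv_id_assoc])

instance : SymmetricCategory Frm where
  braiding A B := isoOf (.cAnd A B) (.cAnd B A) (.cAnd_inv A B) (.cAnd_inv B A)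
  braiding_naturality_left := by
    rintro A B ⟨f⟩ C; exact (MEq.cAnd_nat f (.id C)).hom_eq
  braiding_naturality_right := by
    rintro C A B ⟨f⟩; exact (MEq.cAnd_nat (.id C) f).hom_eq
  hexagon_reverse A B C := by
    have h := (MEq.hexagonAnd A B C).hom_eq
    simp only [Tm.hom_comp, Category.assoc] at h
    exact h
  hexagon_forward A B C := by
    have h := (MEq.hexagonAnd B C A).hom_eq
    simp only [Tm.hom_comp, Category.assoc] at h
    let β (A B : Frm) : A ⊗ B ≅ B ⊗ A := isoOf (.cAnd A B) (.cAnd B A) (.cAnd_inv A B) (.cAnd_inv B A)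
    have h : ((α_ B C A).symm ≪≫ β (B ⊗ C) A ≪≫ (α_ A B C).symm) =
        andIso (Iso.refl B) (β C A) ≪≫ (α_ B A C).symm ≪≫ andIso (β B A) (Iso.refl C) :=
      Iso.ext h
    exact (Category.assoc _ _ _).symm.trans ((congrArg Iso.inv h).trans (Category.assoc _ _ _))
  symmetry A B := (MEq.cAnd_inv A B).hom_eq

lemma orUnitors_eq : (Tm.sOrTo Frm.bot).hom = (Tm.dOrTo Frm.bot).hom :=
  unitors_equal (C := OrFrm)

section Absorption

variable {C : Type*} [Category C]

/-- The arrow is an identity. -/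
inductive Triv : ∀ {x y : C}, (x ⟶ y) → Prop
  | id (x : C) : Triv (𝟙 x)

lemma Triv.of_eq {x : C} {f : x ⟶ x} (h : f = 𝟙 x) : Triv f := h ▸ .id x

lemma Triv.symm {A B x y : C} {u : A ≅ x} {v : B ≅ y} {f : A ⟶ B} {g : B ⟶ A} (hgf : g ≫ f = 𝟙 B)
    (h : Triv (u.inv ≫ f ≫ v.hom)) : Triv (v.inv ≫ g ≫ u.hom) := by
  generalize hk : u.inv ≫ f ≫ v.hom = k at h
  cases h
  rw [Iso.inv_comp_eq, Category.comp_id] at hk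
  exact .of_eq (by rw [← hk, reassoc_of% hgf, Iso.inv_hom_id])

variable [MonoidalCategory C] {t : C} {w : t ⊗ t ≅ t}

/-- `Absorb w x y z m` says that the tensor product of `x` and `y` simplifies to `z` along `m` using
a unit isomorphism or the isomorphism `w`. -/
inductive Absorb (w : t ⊗ t ≅ t) : ∀ x y z : C, (x ⊗ y ≅ z) → Prop
  | unitL {x y z : C} {m : x ⊗ y ≅ z} (hx : x = 𝟙_ C) (hz : y = z) (hm : HEq m (λ_ y)) :
      Absorb w x y z m
  | unitR {x y z : C} {m : x ⊗ y ≅ z} (hy : y = 𝟙_ C) (hz : x = z) (hm : HEq m (ρ_ x)) :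
      Absorb w x y z m
  | idem {x y z : C} {m : x ⊗ y ≅ z} (hx : x = t) (hy : y = t) (hz : z = t) (hm : HEq m w) :
      Absorb w x y z m

namespace Absorb

lemma leftUnitor (x : C) : Absorb w (𝟙_ C) x x (λ_ x) := .unitL rfl rfl .rfl

lemma rightUnitor (x : C) : Absorb w x (𝟙_ C) x (ρ_ x) := .unitR rfl rfl .rfl

lemma self : Absorb w t t t w := .idem rfl rfl rfl .rfl

/-- The result of absorption is unique. -/
lemma unique (ht : t ≠ 𝟙_ C) {x y z z' : C} {m : x ⊗ y ≅ z} {m' : x ⊗ y ≅ z'}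
    (h : Absorb w x y z m) (h' : Absorb w x y z' m') :
    (⟨z, m⟩ : Σ z, x ⊗ y ≅ z) = ⟨z', m'⟩ := by
  have key : λ_ (𝟙_ C) = ρ_ (𝟙_ C) := Iso.ext unitors_equal
  cases h <;> cases h' <;> subst_vars <;> simp_all

lemma triv_of_left (ht : t ≠ 𝟙_ C) {y z : C} {m : 𝟙_ C ⊗ y ≅ z} (h : Absorb w (𝟙_ C) y z m) :
    (⟨z, m⟩ : Σ z, 𝟙_ C ⊗ y ≅ z) = ⟨y, λ_ y⟩ := h.unique ht (.leftUnitor y)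

lemma triv_of_right (ht : t ≠ 𝟙_ C) {x z : C} {m : x ⊗ 𝟙_ C ≅ z} (h : Absorb w x (𝟙_ C) z m) :
    (⟨z, m⟩ : Σ z, x ⊗ 𝟙_ C ≅ z) = ⟨x, ρ_ x⟩ := h.unique ht (.rightUnitor x)

lemma associator (ht : t ≠ 𝟙_ C) (hw : (α_ t t t).hom ≫ t ◁ w.hom = w.hom ▷ t)
    {x y z p q r s : C} {m : x ⊗ y ≅ p} {n : p ⊗ z ≅ q} {m' : y ⊗ z ≅ r} {n' : x ⊗ r ≅ s}
    (h₁ : Absorb w x y p m) (h₂ : Absorb w p z q n) (h₃ : Absorb w y z r m')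
    (h₄ : Absorb w x r s n') :
    Triv (n.inv ≫ m.inv ▷ z ≫ (α_ x y z).hom ≫ x ◁ m'.hom ≫ n'.hom) := by
  cases h₁ with
  | unitL hx hz hm =>
    subst hx hz hm
    cases h₂.unique ht h₃
    cases triv_of_left ht h₄
    exact .of_eq (by simp)
  | unitR hx hz hm =>
    subst hx hz hm
    cases triv_of_left ht h₃
    cases h₂.unique ht h₄
    exact .of_eq (by simp)
  | idem hx hy hz hm =>
    subst hx hy hz; cases hm
    cases h₃ with
    | unitL hx => exact (ht hx).elim
    | unitR hx hz hm =>
      subst hx hz hm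
      cases h₄.unique ht .self
      cases triv_of_right ht h₂
      exact .of_eq (by simp)
    | idem hx hy hz hm =>
      subst hy hz hm
      cases h₄.unique ht .self
      cases h₂.unique ht .self
      exact .of_eq (by rw [reassoc_of% hw]; simp)

lemma braiding [SymmetricCategory C] (ht : t ≠ 𝟙_ C) (hw : (β_ t t).hom = 𝟙 _) {x y z z' : C}
    {m : x ⊗ y ≅ z} {n : y ⊗ x ≅ z'} (h₁ : Absorb w x y z m) (h₂ : Absorb w y x z' n) :
    Triv (m.inv ≫ (β_ x y).hom ≫ n.hom) := by
  cases h₁ with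
  | unitL hx hz hm =>
    subst hx hz hm
    cases triv_of_right ht h₂
    exact .of_eq (by simp)
  | unitR hx hz hm =>
    subst hx hz hm
    cases triv_of_left ht h₂
    exact .of_eq (by simp)
  | idem hx hy hz hm =>
    subst hx hy hz; cases hm
    cases h₂.unique ht .self
    exact .of_eq (by simp [hw])

end Absorb

end Absorption

/-- The number of occurrences of letters in a formula. -/
def letters : Frm → ℕ
  | .pl _ => 1
  | .bot => 0
  | .top => 0
  | .or A B => letters A + letters B
  | .and A B => letters A + letters B

/-- The truth value of a formula when all letters are false. -/
def truth : Frm → Prop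
  | .pl _ => False
  | .bot => False
  | .top => True
  | .or A B => truth A ∨ truth B
  | .and A B => truth A ∧ truth B

/-- Somewhere in the formula a true letterless formula is disjoined with a formula with letters. -/
def TopImpure : Frm → Prop
  | .pl _ => False
  | .bot => False
  | .top => False
  | .or A B => TopImpure A ∨ TopImpure B ∨ (letters A = 0 ∧ truth A ∧ 0 < letters B) ∨
      (letters B = 0 ∧ truth B ∧ 0 < letters A)
  | .and A B => TopImpure A ∨ TopImpure B

/-- Somewhere in the formula a false letterless formula is conjoined with a formula with letters. -/
def BotImpure : Frm → Prop
  | .pl _ => False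
  | .bot => False
  | .top => False
  | .or A B => BotImpure A ∨ BotImpure B
  | .and A B => BotImpure A ∨ BotImpure B ∨ (letters A = 0 ∧ ¬ truth A ∧ 0 < letters B) ∨
      (letters B = 0 ∧ ¬ truth B ∧ 0 < letters A)

lemma Tm.letters_eq {A B : Frm} (f : Tm A B) : letters A = letters B := by
  induction f <;> grind [letters]

lemma Tm.cnt_eq {A B : Frm} (n : ℕ) (f : Tm A B) : cnt n A = cnt n B := by
  induction f <;> grind [cnt]

lemma Tm.truth_imp {A B : Frm} (f : Tm A B) : truth A → truth B := by
  induction f <;> grind [truth]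

lemma Tm.topImpure_imp {A B : Frm} (f : Tm A B) : TopImpure A → TopImpure B := by
  induction f with
  | orM f g =>
    have := f.letters_eq; have := g.letters_eq; have := f.truth_imp; have := g.truth_imp
    simp only [TopImpure] at *; grind
  | _ => grind [TopImpure, letters, truth]

lemma Tm.botImpure_imp {A B : Frm} (f : Tm A B) : BotImpure B → BotImpure A := by
  induction f with
  | andM f g =>
    have := f.letters_eq; have := g.letters_eq; have := f.truth_imp; have := g.truth_imp
    simp only [BotImpure] at *; grind
  | _ => grind [BotImpure, letters, truth]

instance : SymmetricCategory OrFrm where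
  braiding A B := isoOf (.cOr A B) (.cOr B A) (.cOr_inv A B) (.cOr_inv B A)
  braiding_naturality_left := by
    rintro A B ⟨f⟩ C; exact (MEq.cOr_nat f (.id C)).hom_eq
  braiding_naturality_right := by
    rintro C A B ⟨f⟩; exact (MEq.cOr_nat (.id C) f).hom_eq
  hexagon_reverse A B C := by
    have h := (MEq.hexagonOr A B C).hom_eq
    simp only [Tm.hom_comp, Category.assoc] at h
    exact h
  hexagon_forward A B C := by
    have h := (MEq.hexagonOr B C A).hom_eq
    simp only [Tm.hom_comp, Category.assoc] at h
    let β (A B : OrFrm) : A ⊗ B ≅ B ⊗ A := isoOf (.cOr A B) (.cOr B A) (.cOr_inv A B) (.cOr_inv B A)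
    have h : ((α_ B C A).symm ≪≫ β (B ⊗ C) A ≪≫ (α_ A B C).symm) =
        orIso (Iso.refl B) (β C A) ≪≫ (α_ B A C).symm ≪≫ orIso (β B A) (Iso.refl C) :=
      Iso.ext h
    exact (Category.assoc _ _ _).symm.trans ((congrArg Iso.inv h).trans (Category.assoc _ _ _))
  symmetry A B := (MEq.cOr_inv A B).hom_eq

/-- The isomorphism `⊤ ∨ ⊤ ≅ ⊤`. -/
def topOr :
    Iso (C := OrFrm) (tensorObj (C := OrFrm) Frm.top Frm.top) Frm.top := isoOf .wOrTo .wOrFrom .wOr_iso2 .wOr_iso1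

/-- The isomorphism `⊥ ∧ ⊥ ≅ ⊥`. -/
def botAnd : Frm.bot ⊗ Frm.bot ≅ Frm.bot := isoOf .wAndTo .wAndFrom .wAnd_iso2 .wAnd_iso1

/-- One-step simplification of disjunctions. -/
abbrev Join (x y z : Frm) (m : x.or y ≅ z) : Prop :=
  Absorb (C := OrFrm) topOr x y z m

/-- One-step simplification of conjunctions. -/
abbrev Meet (x y z : Frm) (m : x.and y ≅ z) : Prop :=
  Absorb botAnd x y z m

lemma join_bot_left (x : Frm) : Join .bot x x (leftUnitor (C := OrFrm) x) := Absorb.leftUnitor (C := OrFrm) x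

lemma join_bot_right (x : Frm) : Join x .bot x (rightUnitor (C := OrFrm) x) := Absorb.rightUnitor (C := OrFrm) x

lemma join_top : Join .top .top .top topOr := Absorb.self

lemma meet_top_left (x : Frm) : Meet .top x x (λ_ x) := Absorb.leftUnitor x

lemma meet_top_right (x : Frm) : Meet x .top x (ρ_ x) := Absorb.rightUnitor x

lemma meet_bot : Meet .bot .bot .bot botAnd := Absorb.self

/-- `Red A x u` says that `A` reduces to the letter or constant `x` along `u`. -/
inductive Red : ∀ A x : Frm, (A ≅ x) → Prop
  | pl (n : ℕ) : Red (.pl n) (.pl n) (Iso.refl _)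
  | bot : Red .bot .bot (Iso.refl _)
  | top : Red .top .top (Iso.refl _)
  | or {A B x y z : Frm} {u : A ≅ x} {v : B ≅ y} {m : x.or y ≅ z} :
      Red A x u → Red B y v → Join x y z m → Red (A.or B) z (orIso u v ≪≫ m)
  | and {A B x y z : Frm} {u : A ≅ x} {v : B ≅ y} {m : x.and y ≅ z} :
      Red A x u → Red B y v → Meet x y z m → Red (A.and B) z (andIso u v ≪≫ m)

lemma top_ne_unit : (Frm.top : OrFrm) ≠ 𝟙_ OrFrm := fun h : Frm.top = Frm.bot => Frm.noConfusion h

lemma bot_ne_unit : Frm.bot ≠ 𝟙_ Frm := fun h : Frm.bot = Frm.top => Frm.noConfusion h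

lemma Join.unique {x y z z' : Frm} {m : x.or y ≅ z} {m' : x.or y ≅ z'} (h : Join x y z m)
    (h' : Join x y z' m') : (⟨z, m⟩ : Σ z, x.or y ≅ z) = ⟨z', m'⟩ :=
  Absorb.unique top_ne_unit h h'

lemma Meet.unique {x y z z' : Frm} {m : x.and y ≅ z} {m' : x.and y ≅ z'} (h : Meet x y z m)
    (h' : Meet x y z' m') : (⟨z, m⟩ : Σ z, x.and y ≅ z) = ⟨z', m'⟩ :=
  Absorb.unique bot_ne_unit h h'

lemma Red.unique {A x x' : Frm} {u : A ≅ x} {u' : A ≅ x'} (h : Red A x u) (h' : Red A x' u') :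
    (⟨x, u⟩ : Σ x, A ≅ x) = ⟨x', u'⟩ := by
  induction h generalizing x' with
  | pl n => cases h'; rfl
  | bot => cases h'; rfl
  | top => cases h'; rfl
  | or _ _ hm ih₁ ih₂ =>
    cases h' with | or h₁ h₂ hm'
    cases ih₁ h₁
    cases ih₂ h₂
    cases Join.unique hm hm'
    rfl
  | and _ _ hm ih₁ ih₂ =>
    cases h' with | and h₁ h₂ hm'
    cases ih₁ h₁
    cases ih₂ h₂
    cases Meet.unique hm hm'
    rfl

lemma exists_red_aux (A : Frm) (hT : ¬ TopImpure A) (hB : ¬ BotImpure A) (hL : letters A ≤ 1) :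
    ∃ x u, Red A x u ∧ ((letters A = 0 ∧ ¬ truth A ∧ x = .bot) ∨ (letters A = 0 ∧ truth A ∧ x = .top) ∨
      (letters A = 1)) := by
  induction A with
  | pl n => exact ⟨_, _, .pl n, by simp [letters]⟩
  | bot => exact ⟨_, _, .bot, by simp [letters, truth]⟩
  | top => exact ⟨_, _, .top, by simp [letters, truth]⟩
  | or A B ihA ihB =>
    simp only [TopImpure, BotImpure, letters, not_or, truth] at *
    obtain ⟨x, u, hu, hx⟩ := ihA hT.1 hB.1 (by omega)
    obtain ⟨y, v, hv, hy⟩ := ihB hT.2.1 hB.2 (by omega)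
    obtain ⟨z, m, hm, hz⟩ : ∃ z m, Join x y z m ∧ (z = if x = .bot then y else x) := by
      by_cases hx0 : x = .bot
      · subst hx0; exact ⟨_, _, join_bot_left _, by simp⟩
      by_cases hy0 : y = .bot
      · subst hy0; exact ⟨_, _, join_bot_right _, by simp [hx0]⟩
      obtain ⟨rfl, rfl⟩ : x = .top ∧ y = .top := by grind
      exact ⟨_, _, join_top, by simp⟩
    exact ⟨_, _, .or hu hv hm, by grind⟩
  | and A B ihA ihB =>
    simp only [TopImpure, BotImpure, letters, not_or, truth] at *
    obtain ⟨x, u, hu, hx⟩ := ihA hT.1 hB.1 (by omega)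
    obtain ⟨y, v, hv, hy⟩ := ihB hT.2 hB.2.1 (by omega)
    obtain ⟨z, m, hm, hz⟩ : ∃ z m, Meet x y z m ∧ (z = if x = .top then y else x) := by
      by_cases hx0 : x = .top
      · subst hx0; exact ⟨_, _, meet_top_left _, by simp⟩
      by_cases hy0 : y = .top
      · subst hy0; exact ⟨_, _, meet_top_right _, by simp [hx0]⟩
      obtain ⟨rfl, rfl⟩ : x = .bot ∧ y = .bot := by grind
      exact ⟨_, _, meet_bot, by simp⟩
    exact ⟨_, _, .and hu hv hm, by grind⟩

/-- An arrow which is an identity or `κ`. -/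
inductive Basic : ∀ {x y : Frm}, (x ⟶ y) → Prop
  | id (x : Frm) : Basic (𝟙 x)
  | kappa : Basic Tm.kappa.hom

lemma Triv.basic {x y : Frm} {f : x ⟶ y} (h : Triv f) : Basic f := by cases h; exact .id x

lemma Basic.comp {x y z : Frm} {f : x ⟶ y} {g : y ⟶ z} (hf : Basic f) (hg : Basic g) :
    Basic (f ≫ g) := by
  cases hf with
  | id => simpa using hg
  | kappa => cases hg; simpa using Basic.kappa

lemma Basic.eq {x y : Frm} {f g : x ⟶ y} (hf : Basic f) (hg : Basic g) : f = g := by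
  cases hf <;> cases hg <;> rfl

section Absorption

variable {C : Type*} [Category C] [MonoidalCategory C] {t : C} {w : t ⊗ t ≅ t}

namespace Absorb

lemma assoc_of_inv (h : (α_ t t t).inv = t ◁ w.hom ≫ w.inv ▷ t) :
    (α_ t t t).hom ≫ t ◁ w.hom = w.hom ▷ t := by
  rw [← cancel_epi (α_ t t t).inv, Iso.inv_hom_id_assoc, h, Category.assoc, inv_hom_whiskerRight,
    Category.comp_id]

lemma associator_tensorIso (ht : t ≠ 𝟙_ C) (hw : (α_ t t t).hom ≫ t ◁ w.hom = w.hom ▷ t)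
    {x y z p q r s : C} {m : x ⊗ y ≅ p} {n : p ⊗ z ≅ q} {m' : y ⊗ z ≅ r} {n' : x ⊗ r ≅ s}
    (h₁ : Absorb w x y p m) (h₂ : Absorb w p z q n) (h₃ : Absorb w y z r m')
    (h₄ : Absorb w x r s n') {A B D : C} (a : A ≅ x) (b : B ≅ y) (d : D ≅ z) :
    Triv ((tensorIso (tensorIso a b ≪≫ m) d ≪≫ n).inv ≫ (α_ A B D).hom ≫
      (tensorIso a (tensorIso b d ≪≫ m') ≪≫ n').hom) := by
  convert h₁.associator ht hw h₂ h₃ h₄ using 1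
  have e₁ : a.hom ⊗ₘ ((b.hom ⊗ₘ d.hom) ≫ m'.hom) = (a.hom ⊗ₘ (b.hom ⊗ₘ d.hom)) ≫ x ◁ m'.hom := by
    simp [← id_tensorHom, tensorHom_comp_tensorHom]
  have e₂ : (m.inv ≫ (a.inv ⊗ₘ b.inv)) ⊗ₘ d.inv = m.inv ▷ z ≫ ((a.inv ⊗ₘ b.inv) ⊗ₘ d.inv) := by
    rw [← tensorHom_id, tensorHom_comp_tensorHom, Category.id_comp]
  have e₃ : (a.inv ⊗ₘ b.inv) ⊗ₘ d.inv = inv ((a.hom ⊗ₘ b.hom) ⊗ₘ d.hom) := by simp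
  simp only [Iso.trans_inv, tensorIso_inv, Iso.trans_hom, tensorIso_hom, e₁, e₂, Category.assoc]
  rw [← associator_naturality_assoc, e₃, IsIso.inv_hom_id_assoc]

lemma leftUnitor_tensorIso (ht : t ≠ 𝟙_ C) {A y z : C} {m : 𝟙_ C ⊗ y ≅ z}
    (h : Absorb w (𝟙_ C) y z m) (a : A ≅ y) :
    Triv ((tensorIso (Iso.refl _) a ≪≫ m).inv ≫ (λ_ A).hom ≫ a.hom) := by
  cases h.triv_of_left ht
  exact .of_eq (by simp)

lemma rightUnitor_tensorIso (ht : t ≠ 𝟙_ C) {A x z : C} {m : x ⊗ 𝟙_ C ≅ z}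
    (h : Absorb w x (𝟙_ C) z m) (a : A ≅ x) :
    Triv ((tensorIso a (Iso.refl _) ≪≫ m).inv ≫ (ρ_ A).hom ≫ a.hom) := by
  cases h.triv_of_right ht
  exact .of_eq (by simp)

lemma braiding_tensorIso [SymmetricCategory C] (ht : t ≠ 𝟙_ C) (hw : (β_ t t).hom = 𝟙 _)
    {x y z z' : C} {m : x ⊗ y ≅ z} {n : y ⊗ x ≅ z'} (h₁ : Absorb w x y z m)
    (h₂ : Absorb w y x z' n) {A B : C} (a : A ≅ x) (b : B ≅ y) :
    Triv ((tensorIso a b ≪≫ m).inv ≫ (β_ A B).hom ≫ (tensorIso b a ≪≫ n).hom) := by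
  convert h₁.braiding ht hw h₂ using 1
  simp

end Absorb

end Absorption

lemma topOr_assoc : (associator (C := OrFrm) Frm.top Frm.top Frm.top).hom ≫
    whiskerLeft (C := OrFrm) Frm.top topOr.hom = whiskerRight (C := OrFrm) topOr.hom Frm.top :=
  Absorb.assoc_of_inv (C := OrFrm) (MEq.diag7.hom_eq)

lemma botAnd_assoc : (α_ Frm.bot Frm.bot Frm.bot).hom ≫ Frm.bot ◁ botAnd.hom =
    botAnd.hom ▷ Frm.bot :=
  Absorb.assoc_of_inv (MEq.diag8.hom_eq)

lemma braiding_top : (BraidedCategory.braiding (C := OrFrm) Frm.top Frm.top).hom = 𝟙 _ :=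
  MEq.diag12.hom_eq.trans topOr.hom_inv_id

lemma braiding_bot : (β_ Frm.bot Frm.bot).hom = 𝟙 _ :=
  MEq.diag13.hom_eq.trans botAnd.hom_inv_id

/-- Between the reducts of its source and target, the arrow is an identity or `κ`. -/
def Good {A B : Frm} (f : A ⟶ B) : Prop :=
  ∀ ⦃x y : Frm⦄ ⦃u : A ≅ x⦄ ⦃v : B ≅ y⦄, Red A x u → Red B y v → Basic (u.inv ≫ f ≫ v.hom)

/-- Between the reducts of its source and target, the arrow is an identity. -/
def TrivOnRed {A B : Frm} (f : A ⟶ B) : Prop :=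
  ∀ ⦃x y : Frm⦄ ⦃u : A ≅ x⦄ ⦃v : B ≅ y⦄, Red A x u → Red B y v → Triv (u.inv ≫ f ≫ v.hom)

lemma TrivOnRed.good {A B : Frm} {f : A ⟶ B} (h : TrivOnRed f) : Good f :=
  fun _ _ _ _ hu hv => (h hu hv).basic

lemma TrivOnRed.symm {A B : Frm} {f : A ⟶ B} {g : B ⟶ A} (h : TrivOnRed f) (hgf : g ≫ f = 𝟙 B) :
    TrivOnRed g :=
  fun _ _ _ _ hu hv => (h hv hu).symm hgf

lemma TrivOnRed.id (A : Frm) : TrivOnRed (𝟙 A) := by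
  intro x y u v hu hv
  cases hu.unique hv
  exact .of_eq (by simp)

lemma trivOnRed_bOrFrom (A B D : Frm) : TrivOnRed (Tm.bOrFrom A B D).hom := by
  intro x y u v hu hv
  cases hu with | or hAB hD hn
  cases hAB with | or hA hB hm
  cases hv with | or hA' hBD hn'
  cases hBD with | or hB' hD' hm'
  cases hA.unique hA'
  cases hB.unique hB'
  cases hD.unique hD'
  exact hm.associator_tensorIso top_ne_unit topOr_assoc hn hm' hn' _ _ _

lemma trivOnRed_bAndFrom (A B D : Frm) : TrivOnRed (Tm.bAndFrom A B D).hom := by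
  intro x y u v hu hv
  cases hu with | and hAB hD hn
  cases hAB with | and hA hB hm
  cases hv with | and hA' hBD hn'
  cases hBD with | and hB' hD' hm'
  cases hA.unique hA'
  cases hB.unique hB'
  cases hD.unique hD'
  exact hm.associator_tensorIso bot_ne_unit botAnd_assoc hn hm' hn' _ _ _

lemma trivOnRed_cOr (A B : Frm) : TrivOnRed (Tm.cOr A B).hom := by
  intro x y u v hu hv
  cases hu with | or hA hB hm
  cases hv with | or hB' hA' hm'
  cases hA.unique hA'
  cases hB.unique hB'
  exact hm.braiding_tensorIso top_ne_unit braiding_top hm' _ _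

lemma trivOnRed_cAnd (A B : Frm) : TrivOnRed (Tm.cAnd A B).hom := by
  intro x y u v hu hv
  cases hu with | and hA hB hm
  cases hv with | and hB' hA' hm'
  cases hA.unique hA'
  cases hB.unique hB'
  exact hm.braiding_tensorIso bot_ne_unit braiding_bot hm' _ _

lemma trivOnRed_dOrTo (A : Frm) : TrivOnRed (Tm.dOrTo A).hom := by
  intro x y u v hu hv
  cases hu with | or hA hB hm
  cases hB
  cases hA.unique hv
  exact hm.rightUnitor_tensorIso top_ne_unit _

lemma trivOnRed_sOrTo (A : Frm) : TrivOnRed (Tm.sOrTo A).hom := by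
  intro x y u v hu hv
  cases hu with | or hB hA hm
  cases hB
  cases hA.unique hv
  exact hm.leftUnitor_tensorIso top_ne_unit _

lemma trivOnRed_dAndTo (A : Frm) : TrivOnRed (Tm.dAndTo A).hom := by
  intro x y u v hu hv
  cases hu with | and hA hB hm
  cases hB
  cases hA.unique hv
  exact hm.rightUnitor_tensorIso bot_ne_unit _

lemma trivOnRed_sAndTo (A : Frm) : TrivOnRed (Tm.sAndTo A).hom := by
  intro x y u v hu hv
  cases hu with | and hB hA hm
  cases hB
  cases hA.unique hv
  exact hm.leftUnitor_tensorIso bot_ne_unit _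

lemma trivOnRed_wOrTo : TrivOnRed Tm.wOrTo.hom := by
  intro x y u v hu hv
  cases hv
  cases hu.unique (.or .top .top join_top)
  refine .of_eq ((Iso.inv_comp_eq _).2 ?_)
  change Tm.wOrTo.hom ≫ 𝟙 _ = (orH (𝟙 _) (𝟙 _) ≫ Tm.wOrTo.hom) ≫ 𝟙 _
  rw [orH_id, Category.id_comp]

lemma trivOnRed_wAndTo : TrivOnRed Tm.wAndTo.hom := by
  intro x y u v hu hv
  cases hv
  cases hu.unique (.and .bot .bot meet_bot)
  refine .of_eq ((Iso.inv_comp_eq _).2 ?_)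
  change Tm.wAndTo.hom ≫ 𝟙 _ = (andH (𝟙 _) (𝟙 _) ≫ Tm.wAndTo.hom) ≫ 𝟙 _
  rw [andH_id, Category.id_comp]

lemma good_kappa : Good Tm.kappa.hom := by
  intro x y u v hu hv
  cases hu
  cases hv
  simpa using Basic.kappa

section Absorption

variable {C : Type*} [Category C] [MonoidalCategory C] [SymmetricCategory C] {t : C} {w : t ⊗ t ≅ t}

lemma whiskerRight_of_whiskerLeft_unit {k : 𝟙_ C ⟶ t} (hw : (β_ t t).hom = 𝟙 _)
    (h : t ◁ k ≫ w.hom = (ρ_ t).hom) : k ▷ t ≫ w.hom = (λ_ t).hom := by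
  have e : k ▷ t = (β_ _ _).hom ≫ t ◁ k ≫ (β_ _ _).hom := by simp
  simp [e, hw, h]

lemma whiskerRight_of_whiskerLeft_counit {k : t ⟶ 𝟙_ C} (hw : (β_ t t).hom = 𝟙 _)
    (h : t ◁ k ≫ (ρ_ t).hom = w.hom) : k ▷ t ≫ (λ_ t).hom = w.hom := by
  rw [← braiding_rightUnitor, braiding_naturality_left_assoc, hw, Category.id_comp, h]

end Absorption

lemma kappa_or_top : orH Tm.kappa.hom (𝟙 Frm.top) ≫ topOr.hom = (Tm.sOrTo Frm.top).hom := by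
  refine whiskerRight_of_whiskerLeft_unit (C := OrFrm) braiding_top (k := Tm.kappa.hom) ?_
  exact (Iso.eq_comp_inv (C := OrFrm) topOr).1 MEq.diag9.hom_eq

lemma top_or_kappa : orH (𝟙 Frm.top) Tm.kappa.hom ≫ topOr.hom = (Tm.dOrTo Frm.top).hom :=
  (Iso.eq_comp_inv (C := OrFrm) topOr).1 MEq.diag9.hom_eq

lemma bot_and_kappa : Frm.bot ◁ Tm.kappa.hom ≫ (ρ_ Frm.bot).hom = botAnd.hom := by
  have h : Frm.bot ◁ Tm.kappa.hom = botAnd.hom ≫ (ρ_ Frm.bot).inv := MEq.diag10.hom_eq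
  rw [h, Category.assoc, Iso.inv_hom_id, Category.comp_id]

lemma kappa_and_bot : Tm.kappa.hom ▷ Frm.bot ≫ (λ_ Frm.bot).hom = botAnd.hom :=
  whiskerRight_of_whiskerLeft_counit braiding_bot bot_and_kappa

lemma Basic.of_eq_kappa {k : Frm.bot ⟶ Frm.top} (h : k = Tm.kappa.hom) : Basic k := h ▸ .kappa

lemma Basic.of_eq_id {x : Frm} {k : x ⟶ x} (h : k = 𝟙 x) : Basic k := h ▸ .id x

lemma Join.eq_of_left {y z : Frm} {m : Frm.bot.or y ≅ z} (h : Join .bot y z m) :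
    (⟨z, m⟩ : Σ z, Frm.bot.or y ≅ z) = ⟨y, isoOf (.sOrTo y) (.sOrFrom y) (.sOr_iso2 y) (.sOr_iso1 y)⟩ :=
  Join.unique h (join_bot_left y)

lemma Join.eq_of_right {x z : Frm} {m : x.or Frm.bot ≅ z} (h : Join x .bot z m) :
    (⟨z, m⟩ : Σ z, x.or Frm.bot ≅ z) = ⟨x, isoOf (.dOrTo x) (.dOrFrom x) (.dOr_iso2 x) (.dOr_iso1 x)⟩ :=
  Join.unique h (join_bot_right x)

lemma Join.eq_of_top {z : Frm} {m : Frm.top.or Frm.top ≅ z} (h : Join .top .top z m) :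
    (⟨z, m⟩ : Σ z, Frm.top.or Frm.top ≅ z) = ⟨.top, topOr⟩ :=
  Join.unique h join_top

lemma Meet.eq_of_left {y z : Frm} {m : Frm.top.and y ≅ z} (h : Meet .top y z m) :
    (⟨z, m⟩ : Σ z, Frm.top.and y ≅ z) = ⟨y, λ_ y⟩ :=
  Meet.unique h (meet_top_left y)

lemma Meet.eq_of_right {x z : Frm} {m : x.and Frm.top ≅ z} (h : Meet x .top z m) :
    (⟨z, m⟩ : Σ z, x.and Frm.top ≅ z) = ⟨x, ρ_ x⟩ :=
  Meet.unique h (meet_top_right x)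

lemma Meet.eq_of_bot {z : Frm} {m : Frm.bot.and Frm.bot ≅ z} (h : Meet .bot .bot z m) :
    (⟨z, m⟩ : Σ z, Frm.bot.and Frm.bot ≅ z) = ⟨.bot, botAnd⟩ :=
  Meet.unique h meet_bot

lemma Join.cases {x y z : Frm} {m : x.or y ≅ z} (h : Join x y z m) :
    x = .bot ∨ y = .bot ∨ (x = .top ∧ y = .top) := by
  cases h with
  | unitL h => exact .inl h
  | unitR h => exact .inr (.inl h)
  | idem h h' => exact .inr (.inr ⟨h, h'⟩)

lemma Meet.cases {x y z : Frm} {m : x.and y ≅ z} (h : Meet x y z m) :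
    x = .top ∨ y = .top ∨ (x = .bot ∧ y = .bot) := by
  cases h with
  | unitL h => exact .inl h
  | unitR h => exact .inr (.inl h)
  | idem h h' => exact .inr (.inr ⟨h, h'⟩)

lemma sOr_nat {A B : Frm} (f : A ⟶ B) :
    orH (𝟙 Frm.bot) f ≫ (Tm.sOrTo B).hom = (Tm.sOrTo A).hom ≫ f := by
  induction f using Tm.hom_ind with | _ f
  exact (MEq.sOr_nat f).hom_eq

lemma dOr_nat {A B : Frm} (f : A ⟶ B) :
    orH f (𝟙 Frm.bot) ≫ (Tm.dOrTo B).hom = (Tm.dOrTo A).hom ≫ f := by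
  induction f using Tm.hom_ind with | _ f
  exact (MEq.dOr_nat f).hom_eq

lemma basic_orH {x x' y y' z z' : Frm} {k₁ : x ⟶ x'} {k₂ : y ⟶ y'} {m : x.or y ≅ z}
    {m' : x'.or y' ≅ z'} (h₁ : Basic k₁) (h₂ : Basic k₂) (h : Join x y z m) (h' : Join x' y' z' m') :
    Basic (m.inv ≫ orH k₁ k₂ ≫ m'.hom) := by
  cases h₁ with
  | id =>
    cases h₂ with
    | id =>
      cases h.unique h'
      exact .of_eq_id (by simp)
    | kappa =>
      cases h.eq_of_right
      obtain rfl | h₀ | ⟨rfl, -⟩ := h'.cases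
      · cases h'.eq_of_left
        refine .of_eq_kappa ?_
        rw [Iso.inv_comp_eq]
        exact (sOr_nat _).trans (by rw [orUnitors_eq]; rfl)
      · cases h₀
      · cases h'.eq_of_top
        refine .of_eq_id ?_
        rw [Iso.inv_comp_eq]
        exact top_or_kappa.trans (by simp)
  | kappa =>
    cases h.eq_of_left
    cases h₂ with
    | id =>
      obtain h₀ | rfl | ⟨-, rfl⟩ := h'.cases
      · cases h₀
      · cases h'.eq_of_right
        refine .of_eq_kappa ?_
        rw [Iso.inv_comp_eq]
        exact (dOr_nat _).trans (by rw [← orUnitors_eq]; rfl)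
      · cases h'.eq_of_top
        refine .of_eq_id ?_
        rw [Iso.inv_comp_eq]
        exact kappa_or_top.trans (by simp)
    | kappa =>
      cases h'.eq_of_top
      refine .of_eq_kappa ?_
      have e : orH Tm.kappa.hom Tm.kappa.hom = orH (𝟙 _) Tm.kappa.hom ≫ orH Tm.kappa.hom (𝟙 _) := by
        simp
      rw [Iso.inv_comp_eq, e, Category.assoc, kappa_or_top]
      exact sOr_nat _

lemma basic_andH {x x' y y' z z' : Frm} {k₁ : x ⟶ x'} {k₂ : y ⟶ y'} {m : x.and y ≅ z}
    {m' : x'.and y' ≅ z'} (h₁ : Basic k₁) (h₂ : Basic k₂) (h : Meet x y z m) (h' : Meet x' y' z' m') :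
    Basic (m.inv ≫ andH k₁ k₂ ≫ m'.hom) := by
  cases h₁ with
  | id =>
    cases h₂ with
    | id =>
      cases h.unique h'
      exact .of_eq_id (by simp)
    | kappa =>
      cases h'.eq_of_right
      obtain rfl | h₀ | ⟨rfl, -⟩ := h.cases
      · cases h.eq_of_left
        refine .of_eq_kappa ?_
        rw [Iso.inv_comp_eq]
        exact (congrArg (_ ≫ ·) unitors_equal.symm).trans (leftUnitor_naturality Tm.kappa.hom)
      · cases h₀
      · cases h.eq_of_bot
        refine .of_eq_id ?_
        rw [Iso.inv_comp_eq]
        exact bot_and_kappa.trans (by simp)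
  | kappa =>
    cases h'.eq_of_left
    cases h₂ with
    | id =>
      obtain h₀ | rfl | ⟨-, rfl⟩ := h.cases
      · cases h₀
      · cases h.eq_of_right
        refine .of_eq_kappa ?_
        rw [Iso.inv_comp_eq]
        exact (congrArg (_ ≫ ·) unitors_equal).trans (rightUnitor_naturality Tm.kappa.hom)
      · cases h.eq_of_bot
        refine .of_eq_id ?_
        rw [Iso.inv_comp_eq]
        exact kappa_and_bot.trans (by simp)
    | kappa =>
      cases h.eq_of_bot
      refine .of_eq_kappa ?_
      have e : Tm.kappa.hom ⊗ₘ Tm.kappa.hom =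
        Tm.kappa.hom ▷ _ ≫ _ ◁ Tm.kappa.hom := MonoidalCategory.tensorHom_def _ _
      rw [Iso.inv_comp_eq]
      change (Tm.kappa.hom ⊗ₘ Tm.kappa.hom) ≫ _ = _
      have e' : Frm.top ◁ Tm.kappa.hom ≫ (λ_ Frm.top).hom = (λ_ _).hom ≫ Tm.kappa.hom :=
        leftUnitor_naturality _
      rw [e, Category.assoc, e', reassoc_of% kappa_and_bot]

lemma ck_nat {A A' B B' C C' D D' : Frm} (f : A ⟶ A') (g : B ⟶ B') (h : C ⟶ C') (k : D ⟶ D') :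
    orH (andH f g) (andH h k) ≫ (Tm.ck A' B' C' D').hom =
      (Tm.ck A B C D).hom ≫ andH (orH f h) (orH g k) := by
  induction f using Tm.hom_ind with | _ f
  induction g using Tm.hom_ind with | _ g
  induction h using Tm.hom_ind with | _ h
  induction k using Tm.hom_ind with | _ k
  exact (MEq.ck_nat f g h k).hom_eq

lemma cOr_nat {A A' B B' : Frm} (f : A ⟶ A') (g : B ⟶ B') :
    orH f g ≫ (Tm.cOr A' B').hom = (Tm.cOr A B).hom ≫ orH g f := by
  induction f using Tm.hom_ind with | _ f
  induction g using Tm.hom_ind with | _ g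
  exact (MEq.cOr_nat f g).hom_eq

lemma cAnd_nat {A A' B B' : Frm} (f : A ⟶ A') (g : B ⟶ B') :
    andH f g ≫ (Tm.cAnd A' B').hom = (Tm.cAnd A B).hom ≫ andH g f := by
  induction f using Tm.hom_ind with | _ f
  induction g using Tm.hom_ind with | _ g
  exact (MEq.cAnd_nat f g).hom_eq

lemma sOr_eq (A : Frm) : (Tm.sOrTo A).hom = (Tm.cOr .bot A).hom ≫ (Tm.dOrTo A).hom :=
  (MEq.sigmaOr_c A).hom_eq

lemma sAnd_eq (A : Frm) : (Tm.sAndTo A).hom = (Tm.cAnd .top A).hom ≫ (Tm.dAndTo A).hom :=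
  (MEq.sigmaAnd_c A).hom_eq

lemma dOr_eq (A : Frm) : (Tm.dOrTo A).hom = (Tm.cOr A .bot).hom ≫ (Tm.sOrTo A).hom := by
  have h : (Tm.cOr A .bot).hom ≫ (Tm.cOr .bot A).hom = 𝟙 _ := (MEq.cOr_inv A .bot).hom_eq
  rw [sOr_eq, reassoc_of% h]

lemma cOr_ck (A B C D : Frm) : (Tm.cOr (A.and C) (B.and D)).hom ≫ (Tm.ck B D A C).hom =
    (Tm.ck A C B D).hom ≫ andH (Tm.cOr A B).hom (Tm.cOr C D).hom :=
  (MEq.diag4 A B C D).hom_eq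

lemma ck_cAnd (A B C D : Frm) : (Tm.ck A B C D).hom ≫ (Tm.cAnd (A.or C) (B.or D)).hom =
    orH (Tm.cAnd A B).hom (Tm.cAnd C D).hom ≫ (Tm.ck B A D C).hom :=
  (MEq.diag3 A B C D).hom_eq

lemma ck_bot_right (A B : Frm) :
    (Tm.ck A B .bot .bot).hom ≫ andH (Tm.dOrTo A).hom (Tm.dOrTo B).hom =
      orH (𝟙 (A.and B)) Tm.wAndTo.hom ≫ (Tm.dOrTo (A.and B)).hom := by
  have h : (Tm.ck A B .bot .bot).hom =
    (orH (𝟙 (A.and B)) Tm.wAndTo.hom ≫ (Tm.dOrTo (A.and B)).hom) ≫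
      andH (Tm.dOrFrom A).hom (Tm.dOrFrom B).hom := (MEq.diag5 A B).hom_eq
  have e (A) : (Tm.dOrFrom A).hom ≫ (Tm.dOrTo A).hom = 𝟙 _ := (MEq.dOr_iso1 A).hom_eq
  rw [h, Category.assoc, andH_comp, e, e, andH_id, Category.comp_id]

lemma ck_bot_left (A B : Frm) :
    (Tm.ck .bot .bot A B).hom ≫ andH (Tm.sOrTo A).hom (Tm.sOrTo B).hom =
      orH Tm.wAndTo.hom (𝟙 (A.and B)) ≫ (Tm.sOrTo (A.and B)).hom := by
  rw [sOr_eq, sOr_eq, ← andH_comp, ← Category.assoc, ← cOr_ck, Category.assoc, ck_bot_right,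
    ← Category.assoc, ← cOr_nat, Category.assoc, ← sOr_eq]

lemma ck_top_right (A B : Frm) :
    (Tm.ck A .top B .top).hom ≫ andH (𝟙 (A.or B)) Tm.wOrTo.hom ≫ (Tm.dAndTo (A.or B)).hom =
      orH (Tm.dAndTo A).hom (Tm.dAndTo B).hom := by
  have h : (Tm.ck A .top B .top).hom =
    (orH (Tm.dAndTo A).hom (Tm.dAndTo B).hom ≫ (Tm.dAndFrom (A.or B)).hom) ≫
      andH (𝟙 (A.or B)) Tm.wOrFrom.hom := (MEq.diag6 A B).hom_eq
  have e : (Tm.dAndFrom (A.or B)).hom ≫ (Tm.dAndTo (A.or B)).hom = 𝟙 _ :=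
    (MEq.dAnd_iso1 (A.or B)).hom_eq
  have e' : Tm.wOrFrom.hom ≫ Tm.wOrTo.hom = 𝟙 _ := MEq.wOr_iso1.hom_eq
  rw [h, Category.assoc, ← Category.assoc (andH _ _), andH_comp, e', Category.comp_id, andH_id,
    Category.id_comp, Category.assoc, e, Category.comp_id]

lemma ck_top_left (A B : Frm) :
    (Tm.ck .top A .top B).hom ≫ andH Tm.wOrTo.hom (𝟙 (A.or B)) ≫ (Tm.sAndTo (A.or B)).hom =
      orH (Tm.sAndTo A).hom (Tm.sAndTo B).hom := by
  rw [sAnd_eq, ← Category.assoc (andH _ _), cAnd_nat, Category.assoc, ← Category.assoc, ck_cAnd,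
    Category.assoc, ck_top_right, orH_comp, ← sAnd_eq, ← sAnd_eq]

lemma ck_top_bot : (Tm.ck .top .bot .bot .top).hom ≫
    andH (Tm.dOrTo .top).hom (Tm.sOrTo .top).hom ≫ (Tm.dAndTo .top).hom =
      orH (Tm.sAndTo .bot).hom (Tm.dAndTo .bot).hom ≫ (Tm.dOrTo .bot).hom ≫ Tm.kappa.hom := by
  have h : (Tm.ck .top .bot .bot .top).hom =
    (((orH (Tm.sAndTo .bot).hom (Tm.dAndTo .bot).hom ≫ (Tm.dOrTo .bot).hom) ≫ Tm.kappa.hom) ≫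
      (Tm.dAndFrom .top).hom) ≫ andH (Tm.dOrFrom .top).hom (Tm.sOrFrom .top).hom :=
    MEq.diag11.hom_eq
  have e₁ : (Tm.dOrFrom .top).hom ≫ (Tm.dOrTo .top).hom = 𝟙 _ := (MEq.dOr_iso1 .top).hom_eq
  have e₂ : (Tm.sOrFrom .top).hom ≫ (Tm.sOrTo .top).hom = 𝟙 _ := (MEq.sOr_iso1 .top).hom_eq
  have e₃ : (Tm.dAndFrom .top).hom ≫ (Tm.dAndTo .top).hom = 𝟙 _ := (MEq.dAnd_iso1 .top).hom_eq
  rw [h, Category.assoc, ← Category.assoc (andH _ _), andH_comp, e₁, e₂, andH_id,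
    Category.id_comp, Category.assoc, e₃, Category.comp_id, Category.assoc]

lemma ck_bot_top : (Tm.ck .bot .top .top .bot).hom ≫
    andH (Tm.sOrTo .top).hom (Tm.dOrTo .top).hom ≫ (Tm.dAndTo .top).hom =
      orH (Tm.dAndTo .bot).hom (Tm.sAndTo .bot).hom ≫ (Tm.dOrTo .bot).hom ≫ Tm.kappa.hom := by
  rw [sOr_eq, dOr_eq .top, ← andH_comp, Category.assoc, ← Category.assoc, ← cOr_ck, Category.assoc,
    ← dOr_eq, ck_top_bot, ← Category.assoc, ← cOr_nat, Category.assoc, ← Category.assoc (Tm.cOr _ _).hom,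
    ← sOr_eq, orUnitors_eq]

lemma basic_ck {a b c d p q r p' q' r' : Frm} {m₁ : a.and b ≅ p} {m₂ : c.and d ≅ q}
    {n : p.or q ≅ r} {n₁ : a.or c ≅ p'} {n₂ : b.or d ≅ q'} {m : p'.and q' ≅ r'}
    (h₁ : Meet a b p m₁) (h₂ : Meet c d q m₂) (h : Join p q r n)
    (h₁' : Join a c p' n₁) (h₂' : Join b d q' n₂) (h' : Meet p' q' r' m) :
    Basic ((orIso m₁ m₂ ≪≫ n).inv ≫ (Tm.ck a b c d).hom ≫ (andIso n₁ n₂ ≪≫ m).hom) := by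
  have pattern : (a = .top ∧ c = .top) ∨ (b = .top ∧ d = .top) ∨ (a = .bot ∧ b = .bot) ∨
      (c = .bot ∧ d = .bot) ∨ (a = .top ∧ b = .bot ∧ c = .bot ∧ d = .top) ∨
      (a = .bot ∧ b = .top ∧ c = .top ∧ d = .bot) := by
    have := h₁.cases
    have := h₂.cases
    have := h₁'.cases
    have := h₂'.cases
    grind
  obtain ⟨rfl, rfl⟩ | ⟨rfl, rfl⟩ | ⟨rfl, rfl⟩ | ⟨rfl, rfl⟩ | ⟨rfl, rfl, rfl, rfl⟩ |
    ⟨rfl, rfl, rfl, rfl⟩ := pattern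
  · cases h₁.eq_of_left
    cases h₂.eq_of_left
    cases h₁'.eq_of_top
    cases h'.eq_of_left
    cases h.unique h₂'
    refine .of_eq_id ?_
    rw [Iso.inv_comp_eq]
    change (Tm.ck .top b .top d).hom ≫ andH Tm.wOrTo.hom n.hom ≫ (Tm.sAndTo _).hom =
      (orH (Tm.sAndTo b).hom (Tm.sAndTo d).hom ≫ n.hom) ≫ 𝟙 _
    have e : andH Tm.wOrTo.hom n.hom = andH Tm.wOrTo.hom (𝟙 _) ≫ andH (𝟙 _) n.hom := by simp
    have e' : andH (𝟙 Frm.top) n.hom ≫ (Tm.sAndTo _).hom = (Tm.sAndTo _).hom ≫ n.hom :=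
      leftUnitor_naturality _
    rw [e, Category.assoc, e', ← ck_top_left]
    simp
  · cases h₁.eq_of_right
    cases h₂.eq_of_right
    cases h₂'.eq_of_top
    cases h'.eq_of_right
    cases h.unique h₁'
    refine .of_eq_id ?_
    rw [Iso.inv_comp_eq]
    change (Tm.ck a .top c .top).hom ≫ andH n.hom Tm.wOrTo.hom ≫ (Tm.dAndTo _).hom =
      (orH (Tm.dAndTo a).hom (Tm.dAndTo c).hom ≫ n.hom) ≫ 𝟙 _
    have e : andH n.hom Tm.wOrTo.hom = andH (𝟙 _) Tm.wOrTo.hom ≫ andH n.hom (𝟙 _) := by simp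
    have e' : andH n.hom (𝟙 Frm.top) ≫ (Tm.dAndTo _).hom = (Tm.dAndTo _).hom ≫ n.hom :=
      rightUnitor_naturality _
    rw [e, Category.assoc, e', ← ck_top_right]
    simp
  · cases h₁.eq_of_bot
    cases h.eq_of_left
    cases h₁'.eq_of_left
    cases h₂'.eq_of_left
    cases h₂.unique h'
    refine .of_eq_id ?_
    rw [Iso.inv_comp_eq]
    simp only [Iso.trans_hom, andIso_hom, orIso_hom, isoOf_hom, Category.comp_id]
    rw [← Category.assoc, ck_bot_left, Category.assoc, ← sOr_nat]
    exact orH_comp_assoc _ _ _ _ _ |>.trans (by simp; rfl)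
  · cases h₂.eq_of_bot
    cases h.eq_of_right
    cases h₁'.eq_of_right
    cases h₂'.eq_of_right
    cases h₁.unique h'
    refine .of_eq_id ?_
    rw [Iso.inv_comp_eq]
    simp only [Iso.trans_hom, andIso_hom, orIso_hom, isoOf_hom, Category.comp_id]
    rw [← Category.assoc, ck_bot_right, Category.assoc, ← dOr_nat]
    exact orH_comp_assoc _ _ _ _ _ |>.trans (by simp; rfl)
  · cases h₁.eq_of_left
    cases h₂.eq_of_right
    cases h.eq_of_right
    cases h₁'.eq_of_right
    cases h₂'.eq_of_left
    cases h'.eq_of_right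
    refine .of_eq_kappa ?_
    rw [Iso.inv_comp_eq]
    exact ck_top_bot.trans (Category.assoc _ _ _).symm
  · cases h₁.eq_of_right
    cases h₂.eq_of_left
    cases h.eq_of_right
    cases h₁'.eq_of_left
    cases h₂'.eq_of_right
    cases h'.eq_of_right
    refine .of_eq_kappa ?_
    rw [Iso.inv_comp_eq]
    exact ck_bot_top.trans (Category.assoc _ _ _).symm

lemma good_ck (A B C D : Frm) : Good (Tm.ck A B C D).hom := by
  intro x y u v hu hv
  cases hu with | or hAB hCD h
  cases hAB with | and hA hB h₁
  cases hCD with | and hC hD h₂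
  cases hv with | and hAC hBD h'
  cases hAC with | or hA' hC' h₁'
  cases hBD with | or hB' hD' h₂'
  cases hA.unique hA'
  cases hB.unique hB'
  cases hC.unique hC'
  cases hD.unique hD'
  convert basic_ck h₁ h₂ h h₁' h₂' h' using 1
  rw [Iso.inv_comp_eq]
  simp only [Iso.trans_hom, andIso_hom, orIso_hom, Iso.trans_inv, orIso_inv, Category.assoc,
    Iso.hom_inv_id_assoc, orH_comp_assoc, Iso.hom_inv_id, Category.comp_id]
  rw [← andH_comp, Category.assoc, reassoc_of% ck_nat]

lemma Good.comp {A B C : Frm} {f : A ⟶ B} {g : B ⟶ C} (hf : Good f) (hg : Good g) {y : Frm}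
    {v : B ≅ y} (hv : Red B y v) : Good (f ≫ g) := by
  intro x z u w hu hw
  simpa using (hf hu hv).comp (hg hv hw)

lemma Good.orH {A A' B B' : Frm} {f : A ⟶ A'} {g : B ⟶ B'} (hf : Good f) (hg : Good g) :
    Good (orH f g) := by
  intro x y u v hu hv
  cases hu with | or hA hB h
  cases hv with | or hA' hB' h'
  simpa using basic_orH (hf hA hA') (hg hB hB') h h'

lemma Good.andH {A A' B B' : Frm} {f : A ⟶ A'} {g : B ⟶ B'} (hf : Good f) (hg : Good g) :
    Good (andH f g) := by
  intro x y u v hu hv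
  cases hu with | and hA hB h
  cases hv with | and hA' hB' h'
  have := basic_andH (hf hA hA') (hg hB hB') h h'
  simpa [← andH_comp] using this

lemma Tm.good {A B : Frm} (f : Tm A B) (hB : ¬ TopImpure B) (hA : ¬ BotImpure A)
    (hL : letters A ≤ 1) : Good f.hom := by
  induction f with
  | id A => exact (TrivOnRed.id A).good
  | comp g f ihg ihf =>
    have hT := mt g.topImpure_imp hB
    have hF := mt f.botImpure_imp hA
    have hL' := f.letters_eq ▸ hL
    obtain ⟨_, _, hv, -⟩ := exists_red_aux _ hT hF hL'
    exact (ihf hT hA hL).comp (ihg hB hF hL') hv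
  | orM f g ihf ihg =>
    simp only [TopImpure, BotImpure, letters, not_or] at *
    exact (ihf hB.1 hA.1 (by lia)).orH (ihg hB.2.1 hA.2 (by lia))
  | andM f g ihf ihg =>
    simp only [TopImpure, BotImpure, letters, not_or] at *
    exact (ihf hB.1 hA.1 (by lia)).andH (ihg hB.2 hA.2.1 (by lia))
  | bOrTo A B C => exact ((trivOnRed_bOrFrom A B C).symm (MEq.bOr_iso2 A B C).hom_eq).good
  | bOrFrom A B C => exact (trivOnRed_bOrFrom A B C).good
  | bAndTo A B C => exact ((trivOnRed_bAndFrom A B C).symm (MEq.bAnd_iso2 A B C).hom_eq).good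
  | bAndFrom A B C => exact (trivOnRed_bAndFrom A B C).good
  | cOr A B => exact (trivOnRed_cOr A B).good
  | cAnd A B => exact (trivOnRed_cAnd A B).good
  | dOrTo A => exact (trivOnRed_dOrTo A).good
  | dOrFrom A => exact ((trivOnRed_dOrTo A).symm (MEq.dOr_iso1 A).hom_eq).good
  | sOrTo A => exact (trivOnRed_sOrTo A).good
  | sOrFrom A => exact ((trivOnRed_sOrTo A).symm (MEq.sOr_iso1 A).hom_eq).good
  | dAndTo A => exact (trivOnRed_dAndTo A).good
  | dAndFrom A => exact ((trivOnRed_dAndTo A).symm (MEq.dAnd_iso1 A).hom_eq).good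
  | sAndTo A => exact (trivOnRed_sAndTo A).good
  | sAndFrom A => exact ((trivOnRed_sAndTo A).symm (MEq.sAnd_iso1 A).hom_eq).good
  | ck A B C D => exact good_ck A B C D
  | wAndTo => exact trivOnRed_wAndTo.good
  | wAndFrom => exact (trivOnRed_wAndTo.symm MEq.wAnd_iso1.hom_eq).good
  | wOrTo => exact trivOnRed_wOrTo.good
  | wOrFrom => exact (trivOnRed_wOrTo.symm MEq.wOr_iso1.hom_eq).good
  | kappa => exact good_kappa

/-- There is at most one arrow from `A` to `B`. -/
def Uniq (A B : Frm) : Prop := ∀ f g : A ⟶ B, f = g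

lemma uniq_of_letters_le_one {A B : Frm} (hB : ¬ TopImpure B) (hA : ¬ BotImpure A)
    (hL : letters A ≤ 1) : Uniq A B := by
  intro f g
  induction f using Tm.hom_ind with | _ f
  induction g using Tm.hom_ind with | _ g
  obtain ⟨_, u, hu, -⟩ := exists_red_aux _ (mt f.topImpure_imp hB) hA hL
  obtain ⟨_, v, hv, -⟩ := exists_red_aux _ hB (mt f.botImpure_imp hA) (f.letters_eq ▸ hL)
  have h := (f.good hB hA hL hu hv).eq (g.good hB hA hL hu hv)
  rwa [cancel_epi, cancel_mono] at h

lemma impure_of_letters_eq_zero {A : Frm} (h : letters A = 0) : ¬ TopImpure A ∧ ¬ BotImpure A := by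
  induction A <;> grind [letters, TopImpure, BotImpure]

lemma uniq_of_letters_eq_zero {A B : Frm} (hA : letters A = 0) (hB : letters B = 0) : Uniq A B :=
  uniq_of_letters_le_one (impure_of_letters_eq_zero hB).1 (impure_of_letters_eq_zero hA).2 (by lia)

section Interchange

open Functor.OplaxMonoidal Opposite

variable {C D : Type*} [Category* C] [MonoidalCategory C] [BraidedCategory C]
  [Category* D] [MonoidalCategory D] [BraidedCategory D]

instance prodBraided : BraidedCategory (C × D) where
  braiding X Y := (β_ X.1 Y.1).prod (β_ X.2 Y.2)

lemma tensorμ_op (W X Y Z : C) :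
    tensorμ (op W) (op X) (op Y) (op Z) = (tensorμ W Y X Z).op := by
  simp only [tensorμ, op_comp, Category.assoc]
  rfl

/-- The opposite of an oplax monoidal functor is lax monoidal. -/
abbrev laxOp (F : C ⥤ D) [F.OplaxMonoidal] : F.op.LaxMonoidal where
  ε := (η F).op
  μ X Y := (δ F X.unop Y.unop).op
  μ_natural_left f X := Quiver.Hom.unop_inj (δ_natural_left F f.unop X.unop)
  μ_natural_right X f := Quiver.Hom.unop_inj (δ_natural_right F X.unop f.unop)
  associativity X Y Z := Quiver.Hom.unop_inj <| by
    simp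
  left_unitality X := Quiver.Hom.unop_inj <| by
    simp
  right_unitality X := Quiver.Hom.unop_inj <| by
    simp

lemma map_tensorμ_comp_δ (F : C ⥤ D) [F.OplaxMonoidal]
    (h : ∀ X Y, F.map (β_ X Y).hom ≫ δ F Y X = δ F X Y ≫ (β_ (F.obj X) (F.obj Y)).hom)
    (W X Y Z : C) :
    F.map (tensorμ W X Y Z) ≫ δ F (W ⊗ Y) (X ⊗ Z) ≫ (δ F W Y ⊗ₘ δ F X Z) =
      δ F (W ⊗ X) (Y ⊗ Z) ≫ (δ F W X ⊗ₘ δ F Y Z) ≫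
        tensorμ (F.obj W) (F.obj X) (F.obj Y) (F.obj Z) := by
  let _ : F.op.LaxBraided :=
    { laxOp F with braided X Y := Quiver.Hom.unop_inj (h Y.unop X.unop) }
  have := congrArg Quiver.Hom.unop
    (tensorμ_comp_μ_tensorHom_μ_comp_μ F.op (op W) (op Y) (op X) (op Z))
  have e := tensorμ_op (F.obj W) (F.obj Y) (F.obj X) (F.obj Z)
  have e' := tensorμ_op W Y X Z
  simp only [Functor.op_obj] at this
  rw [e, e'] at this
  exact ((Category.assoc _ _ _).symm.trans this.symm).trans (Category.assoc _ _ _)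

end Interchange

/-- Disjunction as a functor. -/
@[simps]
def orFunctor : Frm × Frm ⥤ Frm where
  obj X := X.1.or X.2
  map f := orH f.1 f.2
  map_id X := orH_id X.1 X.2
  map_comp f g := (orH_comp f.1 f.2 g.1 g.2).symm

lemma ck_assoc (A B C D E F : Frm) :
    (Tm.ck (A.and B) C (D.and E) F).hom ≫ andH (Tm.ck A B D E).hom (𝟙 (C.or F)) ≫
      (α_ (A.or D) (B.or E) (C.or F)).hom =
    orH (α_ A B C).hom (α_ D E F).hom ≫ (Tm.ck A (B.and C) D (E.and F)).hom ≫
      andH (𝟙 (A.or D)) (Tm.ck B C E F).hom := by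
  have h : ((Tm.ck A (B.and C) D (E.and F)).hom ≫ andH (𝟙 (A.or D)) (Tm.ck B C E F).hom) ≫
      (α_ (A.or D) (B.or E) (C.or F)).inv = (orH (α_ A B C).inv (α_ D E F).inv ≫
      (Tm.ck (A.and B) C (D.and E) F).hom) ≫ andH (Tm.ck A B D E).hom (𝟙 (C.or F)) :=
    (MEq.diag1 A B C D E F).hom_eq
  refine (Iso.inv_comp_eq (orIso (α_ A B C) (α_ D E F))).1 ?_
  rw [Iso.comp_inv_eq] at h
  simpa using h.symm

instance : orFunctor.OplaxMonoidal where
  η := Tm.wOrTo.hom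
  δ X Y := (Tm.ck X.1 Y.1 X.2 Y.2).hom
  δ_natural_left f X := by
    have := ck_nat f.1 (𝟙 X.1) f.2 (𝟙 X.2)
    rw [orH_id] at this
    exact this.symm
  δ_natural_right X f := by
    have := ck_nat (𝟙 X.1) f.1 (𝟙 X.2) f.2
    rw [orH_id] at this
    exact this.symm
  oplax_associativity X Y Z := ck_assoc X.1 Y.1 Z.1 X.2 Y.2 Z.2
  oplax_left_unitality X := by
    refine ((Iso.inv_comp_eq (orIso (λ_ X.1) (λ_ X.2))).2 ((Iso.eq_comp_inv _).2 ?_)).symm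
    exact (Category.assoc _ _ _).trans (ck_top_left X.1 X.2)
  oplax_right_unitality X := by
    refine ((Iso.inv_comp_eq (orIso (ρ_ X.1) (ρ_ X.2))).2 ((Iso.eq_comp_inv _).2 ?_)).symm
    exact (Category.assoc _ _ _).trans (ck_top_right X.1 X.2)

lemma ck_interchange (A₁ A₂ B₁ B₂ C₁ C₂ D₁ D₂ : Frm) :
    orH (tensorμ A₁ A₂ B₁ B₂) (tensorμ C₁ C₂ D₁ D₂) ≫
      (Tm.ck (A₁.and B₁) (A₂.and B₂) (C₁.and D₁) (C₂.and D₂)).hom ≫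
        ((Tm.ck A₁ B₁ C₁ D₁).hom ⊗ₘ (Tm.ck A₂ B₂ C₂ D₂).hom) =
      (Tm.ck (A₁.and A₂) (B₁.and B₂) (C₁.and C₂) (D₁.and D₂)).hom ≫
        ((Tm.ck A₁ A₂ C₁ C₂).hom ⊗ₘ (Tm.ck B₁ B₂ D₁ D₂).hom) ≫
          tensorμ (A₁.or C₁) (A₂.or C₂) (B₁.or D₁) (B₂.or D₂) :=
  map_tensorμ_comp_δ orFunctor (fun X Y => (ck_cAnd X.1 Y.1 X.2 Y.2).symm)
    (A₁, C₁) (A₂, C₂) (B₁, D₁) (B₂, D₂)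

/-- The letter `n` if `b` is true, and `⊤` otherwise. -/
def part : Bool → ℕ → Frm
  | true, n => .pl n
  | false, _ => .top

/-- The formula with all letters outside `S` replaced by `⊤`. -/
def sub (S : ℕ → Bool) : Frm → Frm
  | .pl n => part (S n) n
  | .bot => .bot
  | .top => .top
  | .or A B => (sub S A).or (sub S B)
  | .and A B => (sub S A).and (sub S B)

/-- The arrow term with all letters outside `S` replaced by `⊤`. -/
def subTm (S : ℕ → Bool) {A B : Frm} : Tm A B → Tm (sub S A) (sub S B)
  | .id A => .id _
  | .comp g f => (subTm S g).comp (subTm S f)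
  | .orM f g => (subTm S f).orM (subTm S g)
  | .andM f g => (subTm S f).andM (subTm S g)
  | .bOrTo A B C => .bOrTo _ _ _
  | .bOrFrom A B C => .bOrFrom _ _ _
  | .bAndTo A B C => .bAndTo _ _ _
  | .bAndFrom A B C => .bAndFrom _ _ _
  | .cOr A B => .cOr _ _
  | .cAnd A B => .cAnd _ _
  | .dOrTo A => .dOrTo _
  | .dOrFrom A => .dOrFrom _
  | .sOrTo A => .sOrTo _
  | .sOrFrom A => .sOrFrom _
  | .dAndTo A => .dAndTo _
  | .dAndFrom A => .dAndFrom _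
  | .sAndTo A => .sAndTo _
  | .sAndFrom A => .sAndFrom _
  | .ck A B C D => .ck _ _ _ _
  | .wAndTo => .wAndTo
  | .wAndFrom => .wAndFrom
  | .wOrTo => .wOrTo
  | .wOrFrom => .wOrFrom
  | .kappa => .kappa

/-- The complementary set of letters. -/
def compl (S : ℕ → Bool) (n : ℕ) : Bool := !S n

/-- A letter as a conjunction of itself with `⊤`. -/
def splitLetter (n : ℕ) : ∀ b : Bool, Frm.pl n ⟶ (part b n).and (part (!b) n)
  | true => (ρ_ (Frm.pl n)).inv
  | false => (λ_ (Frm.pl n)).inv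

/-- The canonical arrow distributing the letters of a formula over a conjunction. -/
def dist (S : ℕ → Bool) : ∀ A : Frm, A ⟶ (sub S A).and (sub (compl S) A)
  | .pl n => splitLetter n (S n)
  | .bot => Tm.wAndFrom.hom
  | .top => (λ_ Frm.top).inv
  | .or A B => orH (dist S A) (dist S B) ≫
      (Tm.ck (sub S A) (sub (compl S) A) (sub S B) (sub (compl S) B)).hom
  | .and A B => andH (dist S A) (dist S B) ≫
      tensorμ (sub S A) (sub (compl S) A) (sub S B) (sub (compl S) B)

/-- Naturality of `dist` at an arrow term. -/
def DistNat (S : ℕ → Bool) {A B : Frm} (f : Tm A B) : Prop :=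
  f.hom ≫ dist S B = dist S A ≫ andH (subTm S f).hom (subTm (compl S) f).hom

lemma braiding_comp_tensorμ {C : Type*} [Category* C] [MonoidalCategory C] [SymmetricCategory C]
    (A₁ A₂ B₁ B₂ : C) :
    (β_ (A₁ ⊗ A₂) (B₁ ⊗ B₂)).hom ≫ tensorμ B₁ B₂ A₁ A₂ =
      tensorμ A₁ A₂ B₁ B₂ ≫ ((β_ A₁ B₁).hom ⊗ₘ (β_ A₂ B₂).hom) := by
  simp [tensorμ, SymmetricCategory.braiding_swap_eq_inv_braiding A₁ B₂,
    MonoidalCategory.tensorHom_def]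

section DistNaturality

variable {A B C D A₁ A₂ B₁ B₂ C₁ C₂ D₁ D₂ : Frm}

lemma bOrTo_ck (a : A ⟶ A₁.and A₂) (b : B ⟶ B₁.and B₂) (c : C ⟶ C₁.and C₂) :
    (Tm.bOrTo A B C).hom ≫ orH (orH a b ≫ (Tm.ck A₁ A₂ B₁ B₂).hom) c ≫
        (Tm.ck (A₁.or B₁) (A₂.or B₂) C₁ C₂).hom =
      (orH a (orH b c ≫ (Tm.ck B₁ B₂ C₁ C₂).hom) ≫ (Tm.ck A₁ A₂ (B₁.or C₁) (B₂.or C₂)).hom) ≫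
        andH (Tm.bOrTo A₁ B₁ C₁).hom (Tm.bOrTo A₂ B₂ C₂).hom := by
  have h : (orH (𝟙 (A₁.and A₂)) (Tm.ck B₁ B₂ C₁ C₂).hom ≫
      (Tm.ck A₁ A₂ (B₁.or C₁) (B₂.or C₂)).hom) ≫
        andH (Tm.bOrTo A₁ B₁ C₁).hom (Tm.bOrTo A₂ B₂ C₂).hom =
    ((Tm.bOrTo (A₁.and A₂) (B₁.and B₂) (C₁.and C₂)).hom ≫
      orH (Tm.ck A₁ A₂ B₁ B₂).hom (𝟙 (C₁.and C₂))) ≫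
      (Tm.ck (A₁.or B₁) (A₂.or B₂) C₁ C₂).hom := (MEq.diag2 A₁ B₁ C₁ A₂ B₂ C₂).hom_eq
  have n : orH a (orH b c) ≫ (Tm.bOrTo _ _ _).hom = (Tm.bOrTo A B C).hom ≫ orH (orH a b) c :=
    orH_assoc_inv a b c
  rw [← Category.comp_id a, ← orH_comp, Category.comp_id, Category.assoc, Category.assoc,
    ← Category.assoc (orH _ _) _ (andH _ _), h, Category.assoc, reassoc_of% n, orH_comp_assoc,
    Category.comp_id]

lemma bAndFrom_tensorμ (a : A ⟶ A₁ ⊗ A₂) (b : B ⟶ B₁ ⊗ B₂) (c : C ⟶ C₁ ⊗ C₂) :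
    (α_ A B C).hom ≫ (a ⊗ₘ ((b ⊗ₘ c) ≫ tensorμ B₁ B₂ C₁ C₂)) ≫
        tensorμ A₁ A₂ (B₁ ⊗ C₁) (B₂ ⊗ C₂) =
      ((((a ⊗ₘ b) ≫ tensorμ A₁ A₂ B₁ B₂) ⊗ₘ c) ≫ tensorμ (A₁ ⊗ B₁) (A₂ ⊗ B₂) C₁ C₂) ≫
        ((α_ A₁ B₁ C₁).hom ⊗ₘ (α_ A₂ B₂ C₂).hom) := by
  have e₁ : ((a ⊗ₘ b) ≫ tensorμ A₁ A₂ B₁ B₂) ⊗ₘ c =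
      ((a ⊗ₘ b) ⊗ₘ c) ≫ tensorμ A₁ A₂ B₁ B₂ ▷ _ := by
    rw [← tensorHom_id, tensorHom_comp_tensorHom, Category.comp_id]
  have e₂ : a ⊗ₘ ((b ⊗ₘ c) ≫ tensorμ B₁ B₂ C₁ C₂) =
      (a ⊗ₘ (b ⊗ₘ c)) ≫ _ ◁ tensorμ B₁ B₂ C₁ C₂ := by
    rw [← id_tensorHom, tensorHom_comp_tensorHom, Category.comp_id]
  rw [e₁, e₂, Category.assoc, Category.assoc, Category.assoc, tensor_associativity,
    associator_naturality_assoc]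

lemma cAnd_tensorμ (a : A ⟶ A₁ ⊗ A₂) (b : B ⟶ B₁ ⊗ B₂) :
    (β_ A B).hom ≫ (b ⊗ₘ a) ≫ tensorμ B₁ B₂ A₁ A₂ =
      ((a ⊗ₘ b) ≫ tensorμ A₁ A₂ B₁ B₂) ≫ ((β_ A₁ B₁).hom ⊗ₘ (β_ A₂ B₂).hom) := by
  rw [← braiding_naturality_assoc, braiding_comp_tensorμ, Category.assoc]

lemma cOr_ck' (a : A ⟶ A₁.and A₂) (b : B ⟶ B₁.and B₂) :
    (Tm.cOr A B).hom ≫ orH b a ≫ (Tm.ck B₁ B₂ A₁ A₂).hom =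
      (orH a b ≫ (Tm.ck A₁ A₂ B₁ B₂).hom) ≫ andH (Tm.cOr A₁ B₁).hom (Tm.cOr A₂ B₂).hom := by
  rw [Category.assoc, ← cOr_ck, ← reassoc_of% cOr_nat]

lemma dOrTo_ck (a : A ⟶ A₁.and A₂) :
    (Tm.dOrTo A).hom ≫ a = (orH a Tm.wAndFrom.hom ≫ (Tm.ck A₁ A₂ .bot .bot).hom) ≫
      andH (Tm.dOrTo A₁).hom (Tm.dOrTo A₂).hom := by
  have h : Tm.wAndFrom.hom ≫ Tm.wAndTo.hom = 𝟙 _ := MEq.wAnd_iso1.hom_eq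
  rw [Category.assoc, ck_bot_right, orH_comp_assoc, h, Category.comp_id, dOr_nat]

lemma sOrTo_ck (a : A ⟶ A₁.and A₂) :
    (Tm.sOrTo A).hom ≫ a = (orH Tm.wAndFrom.hom a ≫ (Tm.ck .bot .bot A₁ A₂).hom) ≫
      andH (Tm.sOrTo A₁).hom (Tm.sOrTo A₂).hom := by
  have h : Tm.wAndFrom.hom ≫ Tm.wAndTo.hom = 𝟙 _ := MEq.wAnd_iso1.hom_eq
  rw [Category.assoc, ck_bot_left, orH_comp_assoc, h, Category.comp_id, sOr_nat]

lemma dAndTo_tensorμ (a : A ⟶ A₁ ⊗ A₂) :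
    (ρ_ A).hom ≫ a = ((a ⊗ₘ (λ_ (𝟙_ Frm)).inv) ≫ tensorμ A₁ A₂ (𝟙_ Frm) (𝟙_ Frm)) ≫
      ((ρ_ A₁).hom ⊗ₘ (ρ_ A₂).hom) := by
  rw [← Category.comp_id a, ← Category.id_comp (λ_ _).inv, ← tensorHom_comp_tensorHom,
    id_tensorHom, Category.assoc, Category.assoc,
    ← tensor_right_unitality]
  simp

lemma sAndTo_tensorμ (a : A ⟶ A₁ ⊗ A₂) :
    (λ_ A).hom ≫ a = (((λ_ (𝟙_ Frm)).inv ⊗ₘ a) ≫ tensorμ (𝟙_ Frm) (𝟙_ Frm) A₁ A₂) ≫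
      ((λ_ A₁).hom ⊗ₘ (λ_ A₂).hom) := by
  rw [← Category.comp_id a, ← Category.id_comp (λ_ _).inv, ← tensorHom_comp_tensorHom,
    tensorHom_id, Category.assoc, Category.assoc,
    ← tensor_left_unitality]
  simp

lemma ck_tensorμ (a : A ⟶ A₁ ⊗ A₂) (b : B ⟶ B₁ ⊗ B₂) (c : C ⟶ C₁ ⊗ C₂) (d : D ⟶ D₁ ⊗ D₂) :
    (Tm.ck A B C D).hom ≫ ((orH a c ≫ (Tm.ck A₁ A₂ C₁ C₂).hom) ⊗ₘ
        (orH b d ≫ (Tm.ck B₁ B₂ D₁ D₂).hom)) ≫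
        tensorμ (A₁.or C₁) (A₂.or C₂) (B₁.or D₁) (B₂.or D₂) =
      (orH ((a ⊗ₘ b) ≫ tensorμ A₁ A₂ B₁ B₂) ((c ⊗ₘ d) ≫ tensorμ C₁ C₂ D₁ D₂) ≫
        (Tm.ck (A₁.and B₁) (A₂.and B₂) (C₁.and D₁) (C₂.and D₂)).hom) ≫
        ((Tm.ck A₁ B₁ C₁ D₁).hom ⊗ₘ (Tm.ck A₂ B₂ C₂ D₂).hom) := by
  have h := (ck_nat a b c d).symm =≫ (((Tm.ck A₁ A₂ C₁ C₂).hom ⊗ₘ (Tm.ck B₁ B₂ D₁ D₂).hom) ≫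
    tensorμ (A₁.or C₁) (A₂.or C₂) (B₁.or D₁) (B₂.or D₂))
  rw [← orH_comp, Category.assoc, Category.assoc, ck_interchange, ← tensorHom_comp_tensorHom,
    Category.assoc]
  rw [Category.assoc, Category.assoc] at h
  exact h

end DistNaturality

lemma DistNat.symm {S : ℕ → Bool} {A B : Frm} {f : Tm A B} {g : Tm B A} (h : DistNat S f)
    (e : MEq (f.comp g) (.id B)) (e₁ : MEq ((subTm S g).comp (subTm S f)) (.id _))
    (e₂ : MEq ((subTm (compl S) g).comp (subTm (compl S) f)) (.id _)) : DistNat S g := by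
  have e₁ : (subTm S f).hom ≫ (subTm S g).hom = 𝟙 _ := e₁.hom_eq
  have e₂ : (subTm (compl S) f).hom ≫ (subTm (compl S) g).hom = 𝟙 _ := e₂.hom_eq
  have e : g.hom ≫ f.hom = 𝟙 _ := e.hom_eq
  have k : andH (subTm S f).hom (subTm (compl S) f).hom ≫
    andH (subTm S g).hom (subTm (compl S) g).hom = 𝟙 _ := by simp [e₁, e₂]
  unfold DistNat at *
  rw [← Category.comp_id (dist S A), ← k, ← reassoc_of% h, reassoc_of% e]

lemma distNat_comp {S : ℕ → Bool} {A B C : Frm} {g : Tm B C} {f : Tm A B} (hg : DistNat S g)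
    (hf : DistNat S f) : DistNat S (g.comp f) := by
  simp only [DistNat, Tm.hom_comp, subTm] at *
  rw [Category.assoc, hg, reassoc_of% hf, andH_comp]

lemma distNat_orM {S : ℕ → Bool} {A B C D : Frm} {f : Tm A B} {g : Tm C D} (hf : DistNat S f)
    (hg : DistNat S g) : DistNat S (f.orM g) := by
  unfold DistNat at *
  change orH f.hom g.hom ≫ orH _ _ ≫ _ = (orH _ _ ≫ _) ≫
    andH (orH (subTm S f).hom (subTm S g).hom)
      (orH (subTm (compl S) f).hom (subTm (compl S) g).hom)
  rw [Category.assoc, orH_comp_assoc, hf, hg, ← ck_nat, orH_comp_assoc]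

lemma tensorHom_tensorμ {A B C D A₁ A₂ B₁ B₂ C₁ C₂ D₁ D₂ : Frm} {a : A ⟶ A₁ ⊗ A₂}
    {b : B ⟶ B₁ ⊗ B₂} {c : C ⟶ C₁ ⊗ C₂} {d : D ⟶ D₁ ⊗ D₂} {f : A ⟶ B} {f₁ : A₁ ⟶ B₁}
    {f₂ : A₂ ⟶ B₂} {g : C ⟶ D} {g₁ : C₁ ⟶ D₁} {g₂ : C₂ ⟶ D₂} (hf : f ≫ b = a ≫ (f₁ ⊗ₘ f₂))
    (hg : g ≫ d = c ≫ (g₁ ⊗ₘ g₂)) :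
    (f ⊗ₘ g) ≫ (b ⊗ₘ d) ≫ tensorμ B₁ B₂ D₁ D₂ =
      ((a ⊗ₘ c) ≫ tensorμ A₁ A₂ C₁ C₂) ≫ ((f₁ ⊗ₘ g₁) ⊗ₘ (f₂ ⊗ₘ g₂)) := by
  rw [Category.assoc, ← tensorμ_natural, tensorHom_comp_tensorHom_assoc, hf, hg,
    tensorHom_comp_tensorHom_assoc]

/-- Distributing letters is natural. -/
lemma dist_nat (S : ℕ → Bool) {A B : Frm} (f : Tm A B) : DistNat S f := by
  induction f with
  | id A => exact (Category.id_comp _).trans (by erw [andH_id]; exact (Category.comp_id _).symm)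
  | comp g f hg hf => exact distNat_comp hg hf
  | orM f g hf hg => exact distNat_orM hf hg
  | andM f g hf hg => exact tensorHom_tensorμ hf hg
  | bOrTo A B C => exact bOrTo_ck _ _ _
  | bOrFrom A B C =>
    exact DistNat.symm (f := .bOrTo A B C) (bOrTo_ck _ _ _) (.bOr_iso1 ..) (.bOr_iso2 ..)
      (.bOr_iso2 ..)
  | bAndTo A B C =>
    exact DistNat.symm (f := .bAndFrom A B C) (bAndFrom_tensorμ _ _ _) (.bAnd_iso2 ..)
      (.bAnd_iso1 ..) (.bAnd_iso1 ..)
  | bAndFrom A B C => exact bAndFrom_tensorμ _ _ _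
  | cOr A B => exact cOr_ck' _ _
  | cAnd A B => exact cAnd_tensorμ _ _
  | dOrTo A => exact dOrTo_ck _
  | dOrFrom A =>
    exact DistNat.symm (f := .dOrTo A) (dOrTo_ck _) (.dOr_iso1 ..) (.dOr_iso2 ..) (.dOr_iso2 ..)
  | sOrTo A => exact sOrTo_ck _
  | sOrFrom A =>
    exact DistNat.symm (f := .sOrTo A) (sOrTo_ck _) (.sOr_iso1 ..) (.sOr_iso2 ..) (.sOr_iso2 ..)
  | dAndTo A => exact dAndTo_tensorμ _
  | dAndFrom A =>
    exact DistNat.symm (f := .dAndTo A) (dAndTo_tensorμ _) (.dAnd_iso1 ..) (.dAnd_iso2 ..)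
      (.dAnd_iso2 ..)
  | sAndTo A => exact sAndTo_tensorμ _
  | sAndFrom A =>
    exact DistNat.symm (f := .sAndTo A) (sAndTo_tensorμ _) (.sAnd_iso1 ..) (.sAnd_iso2 ..)
      (.sAnd_iso2 ..)
  | ck A B C D => exact ck_tensorμ _ _ _ _
  | wAndTo | wAndFrom | wOrTo | wOrFrom | kappa => exact uniq_of_letters_eq_zero rfl rfl _ _

/-- The dual formula, with `∨`, `∧` and `⊥`, `⊤` interchanged and the order reversed. -/
def dual : Frm → Frm
  | .pl n => .pl n
  | .bot => .top
  | .top => .bot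
  | .or A B => (dual B).and (dual A)
  | .and A B => (dual B).or (dual A)

/-- The dual arrow term. -/
def dualTm {A B : Frm} : Tm A B → Tm (dual B) (dual A)
  | .id A => .id _
  | .comp g f => (dualTm f).comp (dualTm g)
  | .orM f g => (dualTm g).andM (dualTm f)
  | .andM f g => (dualTm g).orM (dualTm f)
  | .bOrTo A B C => .bAndTo (dual C) (dual B) (dual A)
  | .bOrFrom A B C => .bAndFrom (dual C) (dual B) (dual A)
  | .bAndTo A B C => .bOrTo (dual C) (dual B) (dual A)
  | .bAndFrom A B C => .bOrFrom (dual C) (dual B) (dual A)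
  | .cOr A B => .cAnd (dual A) (dual B)
  | .cAnd A B => .cOr (dual A) (dual B)
  | .dOrTo A => .sAndFrom (dual A)
  | .dOrFrom A => .sAndTo (dual A)
  | .sOrTo A => .dAndFrom (dual A)
  | .sOrFrom A => .dAndTo (dual A)
  | .dAndTo A => .sOrFrom (dual A)
  | .dAndFrom A => .sOrTo (dual A)
  | .sAndTo A => .dOrFrom (dual A)
  | .sAndFrom A => .dOrTo (dual A)
  | .ck A B C D => .ck (dual D) (dual B) (dual C) (dual A)
  | .wAndTo => .wOrFrom
  | .wAndFrom => .wOrTo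
  | .wOrTo => .wAndFrom
  | .wOrFrom => .wAndTo
  | .kappa => .kappa

@[simp] lemma dual_dual (A : Frm) : dual (dual A) = A := by
  induction A <;> simp_all [dual]

lemma dualTm_dualTm {A B : Frm} (f : Tm A B) : dualTm (dualTm f) ≍ f := by
  induction f <;> grind [dual_dual, dualTm, dual]

lemma MEq.assoc_right {A B C D : Frm} {h : Tm C D} {g : Tm B C} {f : Tm A B} {k : Tm A D}
    (e : MEq (h.comp (g.comp f)) k) : MEq ((h.comp g).comp f) k := (MEq.comp_assoc _ _ _).trans e

lemma MEq.assoc_left {A B C D : Frm} {h : Tm C D} {g : Tm B C} {f : Tm A B} {k : Tm A D}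
    (e : MEq k (h.comp (g.comp f))) : MEq k ((h.comp g).comp f) :=
  e.trans (MEq.comp_assoc _ _ _).symm

/-- Naturality of isomorphisms implies naturality of their inverses. -/
lemma MEq.inverse_nat {A A' B B' : Frm} {t : Tm A B} {t' : Tm A' B'} {s : Tm B A} {s' : Tm B' A'}
    {x : Tm A A'} {y : Tm B B'} (h : MEq (t'.comp x) (y.comp t)) (e : MEq (t.comp s) (.id _))
    (e' : MEq (s'.comp t') (.id _)) : MEq (x.comp s) (s'.comp y) := by
  refine Tm.hom_eq_iff.1 ?_
  have h := h.hom_eq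
  have e : s.hom ≫ t.hom = 𝟙 _ := e.hom_eq
  have e' : t'.hom ≫ s'.hom = 𝟙 _ := e'.hom_eq
  simp only [Tm.hom_comp] at h ⊢
  rw [← Category.comp_id (s.hom ≫ x.hom), ← e', Category.assoc, reassoc_of% h, reassoc_of% e]

lemma dAndFrom_eq (A : Frm) : MEq (.dAndFrom A) ((Tm.cAnd .top A).comp (.sAndFrom A)) :=
  Tm.hom_eq_iff.1 (leftUnitor_inv_braiding A).symm

lemma dOrFrom_eq (A : Frm) : MEq (.dOrFrom A) ((Tm.cOr .bot A).comp (.sOrFrom A)) := by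
  have h := sOr_eq A
  exact Tm.hom_eq_iff.1 ((Iso.eq_inv_comp (C := OrFrm) (λ_ _)).2
    ((Iso.comp_inv_eq (C := OrFrm) (ρ_ _)).2 h))

lemma triangleAnd_inv (A B : Frm) :
    MEq ((Tm.bAndTo A .top B).comp ((Tm.id A).andM (.sAndFrom B))) ((Tm.dAndFrom A).andM (.id B)) := by
  refine Tm.hom_eq_iff.1 ?_
  change A ◁ (λ_ B).inv ≫ (α_ A (𝟙_ Frm) B).inv = (ρ_ A).inv ▷ B
  simp

lemma triangleOr_inv (A B : Frm) :
    MEq ((Tm.bOrTo A .bot B).comp ((Tm.id A).orM (.sOrFrom B))) ((Tm.dOrFrom A).orM (.id B)) :=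
  Tm.hom_eq_iff.1 (triangle_assoc_comp_left_inv (C := OrFrm) A B)

lemma ck_top_left' (A B : Frm) : MEq (.ck .top A .top B)
    ((Tm.wOrFrom.andM (.id (A.or B))).comp
      ((Tm.sAndFrom (A.or B)).comp ((Tm.sAndTo A).orM (.sAndTo B)))) := by
  refine Tm.hom_eq_iff.1 ?_
  have h : (Tm.ck .top A .top B).hom ≫ (andIso topOr (.refl (A.or B)) ≪≫ λ_ (A.or B)).hom =
    orH (Tm.sAndTo A).hom (Tm.sAndTo B).hom := ck_top_left A B
  exact ((Iso.eq_comp_inv _).2 h).trans (Category.assoc _ _ _).symm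

lemma ck_bot_left' (A B : Frm) : MEq (.ck .bot .bot A B)
    (((Tm.sOrFrom A).andM (.sOrFrom B)).comp
      ((Tm.sOrTo (A.and B)).comp (Tm.wAndTo.orM (.id (A.and B))))) := by
  refine Tm.hom_eq_iff.1 ?_
  exact (Iso.eq_comp_inv (andIso (isoOf (.sOrTo A) (.sOrFrom A) (.sOr_iso2 A) (.sOr_iso1 A))
    (isoOf (.sOrTo B) (.sOrFrom B) (.sOr_iso2 B) (.sOr_iso1 B)))).2 (ck_bot_left A B)

lemma MEq.dual {A B : Frm} {f g : Tm A B} (h : MEq f g) : MEq (dualTm f) (dualTm g) := by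
  induction h with
  | refl => exact .refl _
  | symm _ h => exact h.symm
  | trans _ _ h k => exact h.trans k
  | comp_congr _ _ h k => exact k.comp_congr h
  | or_congr _ _ h k => exact k.and_congr h
  | and_congr _ _ h k => exact k.or_congr h
  | id_comp f => exact .comp_id _
  | comp_id f => exact .id_comp _
  | comp_assoc => exact (MEq.comp_assoc _ _ _).symm
  | or_id => exact .and_id _ _
  | and_id => exact .or_id _ _
  | or_comp => exact .and_comp _ _ _ _
  | and_comp => exact .or_comp _ _ _ _
  | bOr_nat => exact (MEq.bAnd_nat _ _ _).symm
  | bAnd_nat => exact (MEq.bOr_nat _ _ _).symm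
  | cOr_nat => exact (MEq.cAnd_nat _ _).symm
  | cAnd_nat => exact (MEq.cOr_nat _ _).symm
  | dOr_nat => exact (MEq.sAnd_nat _).inverse_nat (.sAnd_iso1 _) (.sAnd_iso2 _)
  | sOr_nat => exact (MEq.dAnd_nat _).inverse_nat (.dAnd_iso1 _) (.dAnd_iso2 _)
  | dAnd_nat => exact (MEq.sOr_nat _).inverse_nat (.sOr_iso1 _) (.sOr_iso2 _)
  | sAnd_nat => exact (MEq.dOr_nat _).inverse_nat (.dOr_iso1 _) (.dOr_iso2 _)
  | ck_nat => exact (MEq.ck_nat _ _ _ _).symm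
  | bOr_iso1 => exact .bAnd_iso2 _ _ _
  | bOr_iso2 => exact .bAnd_iso1 _ _ _
  | bAnd_iso1 => exact .bOr_iso2 _ _ _
  | bAnd_iso2 => exact .bOr_iso1 _ _ _
  | dOr_iso1 => exact .sAnd_iso1 _
  | dOr_iso2 => exact .sAnd_iso2 _
  | sOr_iso1 => exact .dAnd_iso1 _
  | sOr_iso2 => exact .dAnd_iso2 _
  | dAnd_iso1 => exact .sOr_iso1 _
  | dAnd_iso2 => exact .sOr_iso2 _
  | sAnd_iso1 => exact .dOr_iso1 _
  | sAnd_iso2 => exact .dOr_iso2 _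
  | cOr_inv => exact .cAnd_inv _ _
  | cAnd_inv => exact .cOr_inv _ _
  | pentagonOr => exact (MEq.pentagonAnd _ _ _ _).assoc_left
  | pentagonAnd => exact (MEq.pentagonOr _ _ _ _).assoc_left
  | triangleOr => exact triangleAnd_inv _ _
  | triangleAnd => exact triangleOr_inv _ _
  | hexagonOr => exact (MEq.hexagonAnd _ _ _).assoc_right.assoc_left
  | hexagonAnd => exact (MEq.hexagonOr _ _ _).assoc_right.assoc_left
  | sigmaOr_c => exact dAndFrom_eq _
  | sigmaAnd_c => exact dOrFrom_eq _
  | diag1 => exact (MEq.diag2 _ _ _ _ _ _).symm.assoc_right.assoc_left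
  | diag2 => exact (MEq.diag1 _ _ _ _ _ _).symm.assoc_right.assoc_left
  | diag3 => exact .diag4 _ _ _ _
  | diag4 => exact .diag3 _ _ _ _
  | diag5 => exact (ck_top_left' _ _).assoc_left
  | diag6 => exact (ck_bot_left' _ _).assoc_left
  | wOr_iso1 | wOr_iso2 | wAnd_iso1 | wAnd_iso2 | diag7 | diag8 | diag9 | diag10 | diag11 | diag12
  | diag13 => exact Tm.hom_eq_iff.1 (uniq_of_letters_eq_zero rfl rfl _ _)

lemma MEq.of_heq {A A' B B' : Frm} {f g : Tm A B} {f' g' : Tm A' B'} (hA : A = A') (hB : B = B')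
    (hf : f ≍ f') (hg : g ≍ g') (h : MEq f g) : MEq f' g' := by
  subst hA hB hf hg
  exact h

lemma MEq.of_dual {A B : Frm} {f g : Tm A B} (h : MEq (dualTm f) (dualTm g)) : MEq f g :=
  h.dual.of_heq (dual_dual A) (dual_dual B) (dualTm_dualTm f) (dualTm_dualTm g)

lemma Uniq.of_dual {A B : Frm} (h : Uniq (SMI.dual B) (SMI.dual A)) : Uniq A B := by
  intro f g
  induction f using Tm.hom_ind with | _ f
  induction g using Tm.hom_ind with | _ g
  exact (Tm.hom_eq_iff.1 (h _ _)).of_dual.hom_eq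

lemma Uniq.of_iso {A A' B B' : Frm} (e : A ≅ A') (e' : B ≅ B') (h : Uniq A' B') : Uniq A B := by
  intro f g
  rw [← cancel_epi e.inv, ← cancel_mono e'.hom]
  exact h _ _

lemma cnt_dual (n : ℕ) (A : Frm) : cnt n (dual A) = cnt n A := by
  induction A <;> grind [cnt, dual]

lemma letters_dual (A : Frm) : letters (dual A) = letters A := by
  induction A <;> grind [letters, dual]

/-- Neither constant occurs in the formula. -/
def ConstFree (A : Frm) : Prop := ¬ hasBot A ∧ ¬ hasTop A

lemma ConstFree.dual {A : Frm} (h : ConstFree A) : ConstFree (dual A) := by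
  induction A <;> grind [ConstFree, SMI.dual, hasBot, hasTop]

lemma ConstFree.letters_pos {A : Frm} (h : ConstFree A) : 0 < letters A := by
  induction A <;> grind [ConstFree, letters, hasBot, hasTop]

lemma ConstFree.not_topImpure {A : Frm} (h : ConstFree A) : ¬ TopImpure A := by
  induction A <;> grind [ConstFree, TopImpure, hasBot, hasTop, ConstFree.letters_pos]

lemma ConstFree.not_botImpure {A : Frm} (h : ConstFree A) : ¬ BotImpure A := by
  induction A <;> grind [ConstFree, BotImpure, hasBot, hasTop, ConstFree.letters_pos]

lemma letters_pos_iff {A : Frm} : 0 < letters A ↔ ∃ n, 0 < cnt n A := by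
  induction A with
  | pl n => exact iff_of_true Nat.one_pos ⟨n, by simp [cnt]⟩
  | bot | top => simp [letters, cnt]
  | or A B hA hB | and A B hA hB =>
    simp only [letters, cnt, Nat.add_pos_iff_pos_or_pos, hA, hB, exists_or]

lemma nonempty_iso_top {A : Frm} (h : letters A = 0) (hA : ¬ hasBot A) : Nonempty (A ≅ Frm.top) := by
  induction A with
  | pl n => simp [letters] at h
  | bot => simp [hasBot] at hA
  | top => exact ⟨.refl _⟩
  | or A B ha hb =>
    simp only [letters, hasBot, Nat.add_eq_zero_iff, not_or] at h hA
    exact ⟨orIso (ha h.1 hA.1).some (hb h.2 hA.2).some ≪≫ topOr⟩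
  | and A B ha hb =>
    simp only [letters, hasBot, Nat.add_eq_zero_iff, not_or] at h hA
    exact ⟨andIso (ha h.1 hA.1).some (hb h.2 hA.2).some ≪≫ ρ_ _⟩

lemma exists_constFree {A : Frm} (h : 0 < letters A) (hA : ¬ hasBot A) (hT : ¬ TopImpure A) :
    ∃ A', ConstFree A' ∧ Nonempty (A ≅ A') := by
  induction A with
  | pl n => exact ⟨_, by simp [ConstFree, hasBot, hasTop], ⟨.refl _⟩⟩
  | bot | top => simp [letters] at h
  | or A B ha hb =>
    have ht {C : Frm} (h : letters C = 0) (hC : ¬ hasBot C) : truth C := by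
      have e : C ≅ .top := (nonempty_iso_top h hC).some
      obtain ⟨f, -⟩ : ∃ f : Tm .top C, f.hom = e.inv := Quot.exists_rep _
      exact f.truth_imp trivial
    simp only [hasBot, not_or, TopImpure] at hA hT
    simp only [letters] at h
    have hA0 : 0 < letters A := by grind
    have hB0 : 0 < letters B := by grind
    obtain ⟨A', h₁, ⟨e₁⟩⟩ := ha hA0 hA.1 hT.1
    obtain ⟨B', h₂, ⟨e₂⟩⟩ := hb hB0 hA.2 hT.2.1
    exact ⟨A'.or B', by simp_all [ConstFree, hasBot, hasTop], ⟨orIso e₁ e₂⟩⟩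
  | and A B ha hb =>
    simp only [hasBot, not_or, TopImpure] at hA hT
    simp only [letters] at h
    rcases Nat.eq_zero_or_pos (letters A) with hA0 | hA0
    · obtain ⟨B', h₂, ⟨e₂⟩⟩ := hb (by lia) hA.2 hT.2
      exact ⟨B', h₂, ⟨andIso (nonempty_iso_top hA0 hA.1).some e₂ ≪≫ λ_ _⟩⟩
    obtain ⟨A', h₁, ⟨e₁⟩⟩ := ha hA0 hA.1 hT.1
    rcases Nat.eq_zero_or_pos (letters B) with hB0 | hB0
    · exact ⟨A', h₁, ⟨andIso e₁ (nonempty_iso_top hB0 hA.2).some ≪≫ ρ_ _⟩⟩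
    obtain ⟨B', h₂, ⟨e₂⟩⟩ := hb hB0 hA.2 hT.2
    exact ⟨A'.and B', by simp_all [ConstFree, hasBot, hasTop], ⟨andIso e₁ e₂⟩⟩

lemma hasBot_sub {S : ℕ → Bool} {A : Frm} (h : ¬ hasBot A) : ¬ hasBot (sub S A) := by
  induction A with
  | pl n => cases h : S n <;> simp [sub, part, h, hasBot]
  | bot | top => exact h
  | or A B ha hb | and A B ha hb => simp_all [sub, hasBot]

lemma sub_eq_self {S : ℕ → Bool} {A : Frm} (h : ∀ n, 0 < cnt n A → S n = true) : sub S A = A := by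
  induction A with
  | pl n => simp [sub, h n (by simp [cnt]), part]
  | bot | top => rfl
  | or A B ha hb | and A B ha hb =>
    simp only [sub, ha fun n hn => h n (by simp only [cnt]; lia),
      hb fun n hn => h n (by simp only [cnt]; lia)]

lemma letters_sub_eq_zero {S : ℕ → Bool} {A : Frm} (h : ∀ n, 0 < cnt n A → S n = false) :
    letters (sub S A) = 0 := by
  induction A with
  | pl n => simp [sub, h n (by simp [cnt]), part, letters]
  | bot | top => rfl
  | or A B ha hb | and A B ha hb =>
    simp only [sub, letters, ha fun n hn => h n (by simp only [cnt]; lia),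
      hb fun n hn => h n (by simp only [cnt]; lia)]

lemma isIso_ck_top_right {A B C D : Frm} (b : B ≅ .top) (d : D ≅ .top) :
    IsIso (Tm.ck A B C D).hom := by
  have h : (Tm.ck A .top C .top).hom ≫ (andIso (.refl (A.or C)) topOr ≪≫ ρ_ _).hom =
    (orIso (ρ_ A) (ρ_ C)).hom := ck_top_right A C
  have : IsIso (Tm.ck A .top C .top).hom := by
    rw [← Iso.eq_comp_inv] at h
    rw [h]
    infer_instance
  have n := ck_nat (𝟙 A) b.hom (𝟙 C) d.hom
  have n : (Tm.ck A B C D).hom = (orIso (andIso (.refl A) b) (andIso (.refl C) d)).hom ≫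
    (Tm.ck A .top C .top).hom ≫ (andIso (.refl (A.or C)) (orIso b d)).inv := by
    rw [← Category.assoc, Iso.eq_comp_inv]
    simpa using n.symm
  rw [n]
  infer_instance

lemma isIso_ck_top_left {A B C D : Frm} (a : A ≅ .top) (c : C ≅ .top) :
    IsIso (Tm.ck A B C D).hom := by
  have h : (Tm.ck A B C D).hom =
    (orIso (β_ A B) (β_ C D)).hom ≫ (Tm.ck B A D C).hom ≫ (β_ (A.or C) (B.or D)).inv := by
    rw [← Category.assoc, Iso.eq_comp_inv]
    exact ck_cAnd A B C D
  have := isIso_ck_top_right (A := B) (C := D) a c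
  rw [h]
  infer_instance

instance {A B C D : Frm} : IsIso (tensorμ A B C D) :=
  ⟨_, tensorμ_tensorδ A B C D, tensorδ_tensorμ A B C D⟩

lemma isIso_splitLetter (n : ℕ) : ∀ b, IsIso (splitLetter n b)
  | true => inferInstanceAs (IsIso (ρ_ (Frm.pl n)).inv)
  | false => inferInstanceAs (IsIso (λ_ (Frm.pl n)).inv)

lemma isIso_dist {S : ℕ → Bool} {b : Bool} {A : Frm} (hA : ¬ hasBot A)
    (h : ∀ n, 0 < cnt n A → S n = b) : IsIso (dist S A) := by
  induction A with
  | pl n => exact isIso_splitLetter n (S n)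
  | bot => simp [hasBot] at hA
  | top => exact inferInstanceAs (IsIso (λ_ _).inv)
  | or A B ha hb =>
    simp only [hasBot, not_or, cnt] at hA h
    have hA' n (hn : 0 < cnt n A) : S n = b := h n (by lia)
    have hB' n (hn : 0 < cnt n B) : S n = b := h n (by lia)
    have := ha hA.1 hA'
    have := hb hA.2 hB'
    have : IsIso (Tm.ck (sub S A) (sub (compl S) A) (sub S B) (sub (compl S) B)).hom := by
      cases b with
      | true =>
        exact isIso_ck_top_right
          (nonempty_iso_top (letters_sub_eq_zero fun n hn => by simp [compl, hA' n hn])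
            (hasBot_sub hA.1)).some
          (nonempty_iso_top (letters_sub_eq_zero fun n hn => by simp [compl, hB' n hn])
            (hasBot_sub hA.2)).some
      | false =>
        exact isIso_ck_top_left
          (nonempty_iso_top (letters_sub_eq_zero hA') (hasBot_sub hA.1)).some
          (nonempty_iso_top (letters_sub_eq_zero hB') (hasBot_sub hA.2)).some
    exact inferInstanceAs (IsIso (orH (dist S A) (dist S B) ≫
      (Tm.ck (sub S A) (sub (compl S) A) (sub S B) (sub (compl S) B)).hom))
  | and A B ha hb =>
    simp only [hasBot, not_or, cnt] at hA h
    have := ha hA.1 fun n hn => h n (by lia)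
    have := hb hA.2 fun n hn => h n (by lia)
    exact inferInstanceAs (IsIso ((dist S A ⊗ₘ dist S B) ≫ tensorμ _ _ _ _))

lemma ConstFree.or_iff {A B : Frm} : ConstFree (A.or B) ↔ ConstFree A ∧ ConstFree B := by
  simp only [ConstFree, hasBot, hasTop]; tauto

lemma ConstFree.and_iff {A B : Frm} : ConstFree (A.and B) ↔ ConstFree A ∧ ConstFree B := by
  simp only [ConstFree, hasBot, hasTop]; tauto

/-- The arrows from `sub S A` are determined, if those from constant-free formulas are. -/
lemma uniq_sub {S : ℕ → Bool} {A B C : Frm} (hA : ConstFree A) (hC : ConstFree C) (f : Tm A B)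
    (e : sub S B ≅ C) (ih : ∀ A', ConstFree A' → Uniq A' C) : Uniq (sub S A) (sub S B) := by
  obtain ⟨g, -⟩ : ∃ g : Tm (sub S B) C, g.hom = e.hom := Quot.exists_rep _
  have g := g.comp (subTm S f)
  obtain ⟨A', hA', ⟨e'⟩⟩ := exists_constFree (g.letters_eq ▸ hC.letters_pos) (hasBot_sub hA.1)
    fun h => hC.not_topImpure (g.topImpure_imp h)
  exact (ih A' hA').of_iso e' e

lemma uniq_and {A B₁ B₂ : Frm} (hA : ConstFree A) (hB₁ : ConstFree B₁) (hB₂ : ConstFree B₂)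
    (hB : Div (B₁.and B₂)) (ih₁ : ∀ A', ConstFree A' → Uniq A' B₁)
    (ih₂ : ∀ A', ConstFree A' → Uniq A' B₂) : Uniq A (B₁.and B₂) := by
  intro f g
  induction f using Tm.hom_ind with | _ f
  induction g using Tm.hom_ind with | _ g
  let S n := decide (0 < cnt n B₁)
  have h₁ n (hn : 0 < cnt n B₁) : S n = true := decide_eq_true hn
  have h₂ n (hn : 0 < cnt n B₂) : S n = false := by
    have := hB n
    simp only [cnt] at this
    exact decide_eq_false (by lia)
  have h₁' n (hn : 0 < cnt n B₁) : compl S n = false := by simp [compl, h₁ n hn]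
  have h₂' n (hn : 0 < cnt n B₂) : compl S n = true := by simp [compl, h₂ n hn]
  have e₁ : sub S (B₁.and B₂) ≅ B₁ := andIso (eqToIso (sub_eq_self h₁))
    (nonempty_iso_top (letters_sub_eq_zero h₂) (hasBot_sub hB₂.1)).some ≪≫ ρ_ B₁
  have e₂ : sub (compl S) (B₁.and B₂) ≅ B₂ := andIso
    (nonempty_iso_top (letters_sub_eq_zero h₁') (hasBot_sub hB₁.1)).some
      (eqToIso (sub_eq_self h₂')) ≪≫ λ_ B₂
  have := isIso_dist hB₁.1 h₁
  have := isIso_dist hB₂.1 h₂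
  have : IsIso (dist S (B₁.and B₂)) :=
    inferInstanceAs (IsIso ((dist S B₁ ⊗ₘ dist S B₂) ≫ tensorμ _ _ _ _))
  rw [← cancel_mono (dist S (B₁.and B₂)), dist_nat S f, dist_nat S g,
    uniq_sub hA hB₁ f e₁ ih₁ (subTm S f).hom (subTm S g).hom,
    uniq_sub hA hB₂ f e₂ ih₂ (subTm (compl S) f).hom (subTm (compl S) g).hom]

/-- The letters `p` and `q` occur on opposite sides of some conjunction. -/
def Conj (p q : ℕ) : Frm → Prop
  | .pl _ => False
  | .bot => False
  | .top => False
  | .or A B => Conj p q A ∨ Conj p q B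
  | .and A B => Conj p q A ∨ Conj p q B ∨ (0 < cnt p A ∧ 0 < cnt q B) ∨ (0 < cnt q A ∧ 0 < cnt p B)

lemma Tm.conj_imp {p q : ℕ} {A B : Frm} (f : Tm A B) : Conj p q A → Conj p q B := by
  induction f with
  | andM f g =>
    have := f.cnt_eq p; have := f.cnt_eq q; have := g.cnt_eq p; have := g.cnt_eq q
    simp only [Conj] at *; grind
  | _ => grind [Conj, cnt]

lemma Conj.cnt_pos {p q : ℕ} {A : Frm} (h : Conj p q A) : 0 < cnt p A ∧ 0 < cnt q A := by
  induction A <;> grind [Conj, cnt]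

/-- No arrow goes from a conjunction to a disjunction, in the diversified constant-free case. -/
lemma not_tm_and_or {A₁ A₂ B₁ B₂ : Frm} (hA : ConstFree (A₁.and A₂)) (hB : ConstFree (B₁.or B₂))
    (hD : Div (B₁.or B₂)) (f : Tm (A₁.and A₂) (B₁.or B₂)) : False := by
  have key {p q : ℕ} (hp : 0 < cnt p A₁) (hq : 0 < cnt q A₂) : 0 < cnt p B₁ ↔ 0 < cnt q B₁ := by
    have hp' := hD p
    have hq' := hD q
    simp only [cnt] at hp' hq'
    have h : Conj p q (A₁.and A₂) := .inr (.inr (.inl ⟨hp, hq⟩))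
    rcases f.conj_imp h with h | h <;> have := h.cnt_pos <;> constructor <;> intro <;> lia
  rw [ConstFree.and_iff] at hA
  rw [ConstFree.or_iff] at hB
  obtain ⟨p, hp⟩ := letters_pos_iff.1 hA.1.letters_pos
  obtain ⟨q, hq⟩ := letters_pos_iff.1 hA.2.letters_pos
  obtain ⟨r, hr⟩ := letters_pos_iff.1 hB.1.letters_pos
  obtain ⟨s, hs⟩ := letters_pos_iff.1 hB.2.letters_pos
  have hr' := f.cnt_eq r
  have hs' := f.cnt_eq s
  have hs'' := hD s
  simp only [cnt] at hr' hs' hs''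
  have h₁ := @key p q hp hq
  have h₂ : 0 < cnt p B₁ := by
    rcases Nat.eq_zero_or_pos (cnt r A₁) with h | h
    · exact (key hp (by lia)).2 hr
    · exact h₁.2 ((key h hq).1 hr)
  have h₃ : 0 < cnt s B₁ := by
    rcases Nat.eq_zero_or_pos (cnt s A₁) with h | h
    · exact (key hp (by lia)).1 h₂
    · exact (key h hq).2 (h₁.1 h₂)
  lia

lemma Div.of_tm {A B : Frm} (f : Tm A B) (h : Div B) : Div A := fun n => f.cnt_eq n ▸ h n

lemma Div.dual {A : Frm} (h : Div A) : Div (dual A) := fun n => (cnt_dual n A).trans_le (h n)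

lemma uniq_of_constFree {A B : Frm} (hA : ConstFree A) (hB : ConstFree B) (hD : Div B) :
    Uniq A B := by
  induction hn : letters B using Nat.strong_induction_on generalizing A B with
  | _ n ih
  intro f g
  obtain ⟨t, -⟩ : ∃ t : Tm A B, t.hom = f := Quot.exists_rep _
  revert f g
  change Uniq A B
  have hAB := t.letters_eq
  cases B with
  | bot => simp [ConstFree, hasBot] at hB
  | top => simp [ConstFree, hasTop] at hB
  | pl q =>
    exact uniq_of_letters_le_one hB.not_topImpure hA.not_botImpure hAB.le
  | and B₁ B₂ =>
    have hB' := ConstFree.and_iff.1 hB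
    have h₁ := hB'.1.letters_pos
    have h₂ := hB'.2.letters_pos
    simp only [letters] at hn
    refine uniq_and hA hB'.1 hB'.2 hD (fun A' hA' => ih (letters B₁) (by lia) hA' hB'.1 ?_ rfl)
      fun A' hA' => ih (letters B₂) (by lia) hA' hB'.2 ?_ rfl
    all_goals intro m; have := hD m; simp only [cnt] at this; lia
  | or B₁ B₂ =>
    cases A with
    | bot => simp [ConstFree, hasBot] at hA
    | top => simp [ConstFree, hasTop] at hA
    | pl p => 
      have h₁ := (ConstFree.or_iff.1 hB).1.letters_pos
      have h₂ := (ConstFree.or_iff.1 hB).2.letters_pos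
      simp only [letters] at hAB
      lia
    | and A₁ A₂ => exact (not_tm_and_or hA hB hD t).elim
    | or A₁ A₂ =>
      have hA' := ConstFree.or_iff.1 hA
      have h₁ := hA'.1.letters_pos
      have h₂ := hA'.2.letters_pos
      rw [hn] at hAB
      simp only [letters] at hAB
      have hD' := hD.of_tm t
      refine Uniq.of_dual (uniq_and hB.dual hA'.2.dual hA'.1.dual (hD'.dual)
        (fun A' hA'' => ih (letters (SMI.dual A₂)) ?_ hA'' hA'.2.dual ?_ rfl)
        fun A' hA'' => ih (letters (SMI.dual A₁)) ?_ hA'' hA'.1.dual ?_ rfl)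
      · rw [letters_dual]; lia
      · refine Div.dual fun m => ?_
        have := hD' m; simp only [cnt] at this; lia
      · rw [letters_dual]; lia
      · refine Div.dual fun m => ?_
        have := hD' m; simp only [cnt] at this; lia

/-- Every formula is isomorphic to its unit-normal form. -/
lemma nonempty_iso_nu (A : Frm) : Nonempty (A ≅ nu A) := by
  induction A with
  | pl n => exact ⟨.refl _⟩
  | bot | top => exact ⟨.refl _⟩
  | or A B ha hb =>
    obtain ⟨⟨a⟩, ⟨b⟩⟩ := And.intro ha hb
    suffices h : ∀ A B, Nonempty (A.or B ≅ orN A B) from ⟨orIso a b ≪≫ (h _ _).some⟩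
    intro A B
    unfold orN
    split
    · exact ⟨isoOf (.sOrTo _) (.sOrFrom _) (.sOr_iso2 _) (.sOr_iso1 _)⟩
    · exact ⟨isoOf (.dOrTo _) (.dOrFrom _) (.dOr_iso2 _) (.dOr_iso1 _)⟩
    · exact ⟨topOr⟩
    · exact ⟨.refl _⟩
  | and A B ha hb =>
    obtain ⟨⟨a⟩, ⟨b⟩⟩ := And.intro ha hb
    suffices h : ∀ A B, Nonempty (A.and B ≅ andN A B) from ⟨andIso a b ≪≫ (h _ _).some⟩
    intro A B
    unfold andN
    split
    · exact ⟨λ_ _⟩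
    · exact ⟨ρ_ _⟩
    · exact ⟨botAnd⟩
    · exact ⟨.refl _⟩

lemma NoLtr.letters_eq_zero {A : Frm} (h : NoLtr A) : letters A = 0 := by
  by_contra hA
  obtain ⟨n, hn⟩ := letters_pos_iff.1 (Nat.pos_of_ne_zero hA)
  have := h n
  lia

/-- Theorem 3.1 (Restricted Symmetric Bimonoidal Intermuting Coherence) :
in the free SMI category 𝓜 , if `A` and `B` are either pure and diversified
or no letter occurs in them, then there is at most one arrow `f : A → B`. -/
theorem SMI_coherence {A B : Frm}
    (h : (Pure A ∧ Div A ∧ Pure B ∧ Div B) ∨ (NoLtr A ∧ NoLtr B))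
    (f g : Tm A B) : MEq f g := by
  refine Tm.hom_eq_iff.1 ?_
  rcases h with ⟨hA, -, hB, hD⟩ | ⟨hA, hB⟩
  · obtain ⟨eA⟩ := nonempty_iso_nu A
    obtain ⟨eB⟩ := nonempty_iso_nu B
    obtain ⟨k, -⟩ : ∃ k : Tm (nu B) B, k.hom = eB.inv := Quot.exists_rep _
    exact (uniq_of_constFree hA hB (hD.of_tm k)).of_iso eA eB _ _
  · exact uniq_of_letters_eq_zero hA.letters_eq_zero hB.letters_eq_zero _ _

end SMI
end

section
/- Coherence for symmetric biassociative intermuting categories: in the free SAI category A generated by an infinite set of letters, if objects A and B are diversified, then there is at most one arrow f : A → B. -/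
namespace SAI

/-- Objects of the free symmetric biassociative intermuting (SAI) category 𝓐 :
formulas over an infinite set of letters with the connectives ∨ and ∧. -/
inductive Frm2 : Type
  | pl : ℕ → Frm2
  | or : Frm2 → Frm2 → Frm2
  | and : Frm2 → Frm2 → Frm2
  deriving DecidableEq

/-- Arrow terms of 𝓐 , generated from the associativity, symmetry and
intermutation arrows by composition, ∨ and ∧. -/
inductive Tm2 : Frm2 → Frm2 → Type
  | id (A : Frm2) : Tm2 A A
  | comp {A B C : Frm2} : Tm2 B C → Tm2 A B → Tm2 A C
  | orM {A B C D : Frm2} : Tm2 A B → Tm2 C D → Tm2 (A.or C) (B.or D)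
  | andM {A B C D : Frm2} : Tm2 A B → Tm2 C D → Tm2 (A.and C) (B.and D)
  | bOrTo (A B C : Frm2) : Tm2 (A.or (B.or C)) ((A.or B).or C)
  | bOrFrom (A B C : Frm2) : Tm2 ((A.or B).or C) (A.or (B.or C))
  | bAndTo (A B C : Frm2) : Tm2 (A.and (B.and C)) ((A.and B).and C)
  | bAndFrom (A B C : Frm2) : Tm2 ((A.and B).and C) (A.and (B.and C))
  | cOr (A B : Frm2) : Tm2 (A.or B) (B.or A)
  | cAnd (A B : Frm2) : Tm2 (A.and B) (B.and A)
  | ck (A B C D : Frm2) : Tm2 ((A.and B).or (C.and D)) ((A.or C).and (B.or D))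

/-- The equality of arrows of the free SAI category 𝓐 : the smallest
congruence containing the equations of the two symmetric "monoidal without
units" structures (Mac Lane's pentagon and hexagon, naturality, isomorphism
and symmetry-involution conditions) and the coherence diagrams (1)-(4)
for the intermutation cᵏ. -/
inductive Eq2 : ∀ {A B : Frm2}, Tm2 A B → Tm2 A B → Prop
  | refl {A B : Frm2} (f : Tm2 A B) : Eq2 f f
  | symm {A B : Frm2} {f g : Tm2 A B} : Eq2 f g → Eq2 g f
  | trans {A B : Frm2} {f g h : Tm2 A B} : Eq2 f g → Eq2 g h → Eq2 f h
  | comp_congr {A B C : Frm2} {g g' : Tm2 B C} {f f' : Tm2 A B} :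
      Eq2 g g' → Eq2 f f' → Eq2 (g.comp f) (g'.comp f')
  | or_congr {A B C D : Frm2} {f f' : Tm2 A B} {g g' : Tm2 C D} :
      Eq2 f f' → Eq2 g g' → Eq2 (f.orM g) (f'.orM g')
  | and_congr {A B C D : Frm2} {f f' : Tm2 A B} {g g' : Tm2 C D} :
      Eq2 f f' → Eq2 g g' → Eq2 (f.andM g) (f'.andM g')
  | id_comp {A B : Frm2} (f : Tm2 A B) : Eq2 ((Tm2.id B).comp f) f
  | comp_id {A B : Frm2} (f : Tm2 A B) : Eq2 (f.comp (Tm2.id A)) f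
  | comp_assoc {A B C D : Frm2} (h : Tm2 C D) (g : Tm2 B C) (f : Tm2 A B) :
      Eq2 ((h.comp g).comp f) (h.comp (g.comp f))
  | or_id (A B : Frm2) : Eq2 ((Tm2.id A).orM (Tm2.id B)) (Tm2.id (A.or B))
  | and_id (A B : Frm2) : Eq2 ((Tm2.id A).andM (Tm2.id B)) (Tm2.id (A.and B))
  | or_comp {A B C A' B' C' : Frm2} (g : Tm2 B C) (f : Tm2 A B) (g' : Tm2 B' C') (f' : Tm2 A' B') :
      Eq2 ((g.comp f).orM (g'.comp f')) ((g.orM g').comp (f.orM f'))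
  | and_comp {A B C A' B' C' : Frm2} (g : Tm2 B C) (f : Tm2 A B) (g' : Tm2 B' C') (f' : Tm2 A' B') :
      Eq2 ((g.comp f).andM (g'.comp f')) ((g.andM g').comp (f.andM f'))
  | bOr_nat {A A' B B' C C' : Frm2} (f : Tm2 A A') (g : Tm2 B B') (h : Tm2 C C') :
      Eq2 ((Tm2.bOrTo A' B' C').comp (f.orM (g.orM h))) (((f.orM g).orM h).comp (Tm2.bOrTo A B C))
  | bAnd_nat {A A' B B' C C' : Frm2} (f : Tm2 A A') (g : Tm2 B B') (h : Tm2 C C') :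
      Eq2 ((Tm2.bAndTo A' B' C').comp (f.andM (g.andM h))) (((f.andM g).andM h).comp (Tm2.bAndTo A B C))
  | cOr_nat {A A' B B' : Frm2} (f : Tm2 A A') (g : Tm2 B B') :
      Eq2 ((Tm2.cOr A' B').comp (f.orM g)) ((g.orM f).comp (Tm2.cOr A B))
  | cAnd_nat {A A' B B' : Frm2} (f : Tm2 A A') (g : Tm2 B B') :
      Eq2 ((Tm2.cAnd A' B').comp (f.andM g)) ((g.andM f).comp (Tm2.cAnd A B))
  | ck_nat {A A' B B' C C' D D' : Frm2}
      (f : Tm2 A A') (g : Tm2 B B') (h : Tm2 C C') (k : Tm2 D D') :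
      Eq2 ((Tm2.ck A' B' C' D').comp ((f.andM g).orM (h.andM k)))
          (((f.orM h).andM (g.orM k)).comp (Tm2.ck A B C D))
  | bOr_iso1 (A B C : Frm2) : Eq2 ((Tm2.bOrTo A B C).comp (Tm2.bOrFrom A B C)) (Tm2.id _)
  | bOr_iso2 (A B C : Frm2) : Eq2 ((Tm2.bOrFrom A B C).comp (Tm2.bOrTo A B C)) (Tm2.id _)
  | bAnd_iso1 (A B C : Frm2) : Eq2 ((Tm2.bAndTo A B C).comp (Tm2.bAndFrom A B C)) (Tm2.id _)
  | bAnd_iso2 (A B C : Frm2) : Eq2 ((Tm2.bAndFrom A B C).comp (Tm2.bAndTo A B C)) (Tm2.id _)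
  | cOr_inv (A B : Frm2) : Eq2 ((Tm2.cOr B A).comp (Tm2.cOr A B)) (Tm2.id _)
  | cAnd_inv (A B : Frm2) : Eq2 ((Tm2.cAnd B A).comp (Tm2.cAnd A B)) (Tm2.id _)
  | pentagonOr (A B C D : Frm2) :
      Eq2 ((Tm2.bOrTo (A.or B) C D).comp (Tm2.bOrTo A B (C.or D)))
          (((Tm2.bOrTo A B C).orM (Tm2.id D)).comp
            ((Tm2.bOrTo A (B.or C) D).comp ((Tm2.id A).orM (Tm2.bOrTo B C D))))
  | pentagonAnd (A B C D : Frm2) :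
      Eq2 ((Tm2.bAndTo (A.and B) C D).comp (Tm2.bAndTo A B (C.and D)))
          (((Tm2.bAndTo A B C).andM (Tm2.id D)).comp
            ((Tm2.bAndTo A (B.and C) D).comp ((Tm2.id A).andM (Tm2.bAndTo B C D))))
  | hexagonOr (A B C : Frm2) :
      Eq2 ((Tm2.bOrTo C A B).comp ((Tm2.cOr (A.or B) C).comp (Tm2.bOrTo A B C)))
          (((Tm2.cOr A C).orM (Tm2.id B)).comp
            ((Tm2.bOrTo A C B).comp ((Tm2.id A).orM (Tm2.cOr B C))))
  | hexagonAnd (A B C : Frm2) :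
      Eq2 ((Tm2.bAndTo C A B).comp ((Tm2.cAnd (A.and B) C).comp (Tm2.bAndTo A B C)))
          (((Tm2.cAnd A C).andM (Tm2.id B)).comp
            ((Tm2.bAndTo A C B).comp ((Tm2.id A).andM (Tm2.cAnd B C))))
  | diag1 (A B C D E F : Frm2) :
      Eq2 ((Tm2.bAndTo (A.or D) (B.or E) (C.or F)).comp
            (((Tm2.id (A.or D)).andM (Tm2.ck B C E F)).comp (Tm2.ck A (B.and C) D (E.and F))))
          (((Tm2.ck A B D E).andM (Tm2.id (C.or F))).comp
            ((Tm2.ck (A.and B) C (D.and E) F).comp ((Tm2.bAndTo A B C).orM (Tm2.bAndTo D E F))))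
  | diag2 (A B C D E F : Frm2) :
      Eq2 (((Tm2.bOrTo A B C).andM (Tm2.bOrTo D E F)).comp
            ((Tm2.ck A D (B.or C) (E.or F)).comp ((Tm2.id (A.and D)).orM (Tm2.ck B E C F))))
          ((Tm2.ck (A.or B) (D.or E) C F).comp
            (((Tm2.ck A D B E).orM (Tm2.id (C.and F))).comp
              (Tm2.bOrTo (A.and D) (B.and E) (C.and F))))
  | diag3 (A B C D : Frm2) :
      Eq2 ((Tm2.cAnd (A.or C) (B.or D)).comp (Tm2.ck A B C D))
          ((Tm2.ck B A D C).comp ((Tm2.cAnd A B).orM (Tm2.cAnd C D)))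
  | diag4 (A B C D : Frm2) :
      Eq2 ((Tm2.ck B D A C).comp (Tm2.cOr (A.and C) (B.and D)))
          (((Tm2.cOr A B).andM (Tm2.cOr C D)).comp (Tm2.ck A C B D))

/-- Number of occurrences of the letter `n` in a formula. -/
def cnt2 (n : ℕ) : Frm2 → ℕ
  | Frm2.pl m => if m = n then 1 else 0
  | Frm2.or A B => cnt2 n A + cnt2 n B
  | Frm2.and A B => cnt2 n A + cnt2 n B

/-- A formula is diversified when every letter occurs in it at most once. -/
def Div2 (A : Frm2) : Prop := ∀ n : ℕ, cnt2 n A ≤ 1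

end SAI

namespace SAI

open CategoryTheory

/-- A category with a symmetric, associative (but non-unital) tensor product. -/
structure SemiSym (C : Type) [Category.{0} C] where
  obj : C → C → C
  map : ∀ {a a' b b' : C}, (a ⟶ a') → (b ⟶ b') → (obj a b ⟶ obj a' b')
  assoc : ∀ a b c : C, obj (obj a b) c ≅ obj a (obj b c)
  swap : ∀ a b : C, obj a b ⟶ obj b a
  map_id : ∀ a b : C, map (𝟙 a) (𝟙 b) = 𝟙 (obj a b)
  map_comp : ∀ {a b c a' b' c' : C} (f : a ⟶ b) (g : b ⟶ c) (f' : a' ⟶ b') (g' : b' ⟶ c'),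
    map (f ≫ g) (f' ≫ g') = map f f' ≫ map g g'
  assoc_nat : ∀ {a b c a' b' c' : C} (f : a ⟶ a') (g : b ⟶ b') (h : c ⟶ c'),
    map f (map g h) ≫ (assoc a' b' c').inv = (assoc a b c).inv ≫ map (map f g) h
  swap_nat : ∀ {a b a' b' : C} (f : a ⟶ a') (g : b ⟶ b'),
    map f g ≫ swap a' b' = swap a b ≫ map g f
  swap_swap : ∀ a b : C, swap a b ≫ swap b a = 𝟙 _
  pentagon : ∀ a b c d : C,
    (assoc a b (obj c d)).inv ≫ (assoc (obj a b) c d).inv =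
      map (𝟙 a) (assoc b c d).inv ≫ (assoc a (obj b c) d).inv ≫ map (assoc a b c).inv (𝟙 d)
  hexagon : ∀ a b c : C,
    (assoc a b c).inv ≫ swap (obj a b) c ≫ (assoc c a b).inv =
      map (𝟙 a) (swap b c) ≫ (assoc a c b).inv ≫ map (swap a c) (𝟙 b)

/-- The objects of `C` together with a formal unit. -/
inductive Plus (C : Type) : Type
  | unit : Plus C
  | of : C → Plus C

namespace Plus

variable {C : Type} [Category.{0} C]

/-- Arrows of `Plus C`: those of `C`, and the identity of the unit. -/
inductive Hom : Plus C → Plus C → Type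
  | unit : Hom unit unit
  | of {a b : C} : (a ⟶ b) → Hom (of a) (of b)

/-- Composition in `Plus C`. -/
def Hom.comp : ∀ {X Y Z : Plus C}, Hom X Y → Hom Y Z → Hom X Z
  | _, _, _, .unit, .unit => .unit
  | _, _, _, .of f, .of g => .of (f ≫ g)

instance : Category (Plus C) where
  Hom := Hom
  id X := match X with
    | .unit => .unit
    | .of a => .of (𝟙 a)
  comp := Hom.comp
  id_comp f := by cases f <;> simp [Hom.comp]
  comp_id f := by cases f <;> simp [Hom.comp]
  assoc f g h := by cases f <;> cases g <;> cases h <;> simp [Hom.comp]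

/-- The embedding of `C` in `Plus C`, on arrows. -/
def emb {a b : C} (f : a ⟶ b) : Plus.of a ⟶ Plus.of b := Hom.of f

/-- Eliminator for the arrows of `Plus C`. -/
@[elab_as_elim]
theorem hom_cases {motive : ∀ {X Y : Plus C}, (X ⟶ Y) → Prop}
    (unit : motive (𝟙 (Plus.unit : Plus C)))
    (of : ∀ {a b : C} (f : a ⟶ b), motive (emb f)) {X Y : Plus C} (f : X ⟶ Y) : motive f := by
  match X, Y, f with
  | _, _, Hom.unit => exact unit
  | _, _, Hom.of f => exact of f

theorem emb_injective {a b : C} {f g : a ⟶ b} (h : emb f = emb g) : f = g := Hom.of.inj h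

theorem emb_surjective {a b : C} (f : Plus.of a ⟶ Plus.of b) : ∃ g, f = emb g := by
  match f with
  | Hom.of g => exact ⟨g, rfl⟩

theorem emb_comp {a b c : C} (f : a ⟶ b) (g : b ⟶ c) : emb (f ≫ g) = emb f ≫ emb g := rfl

/-- Whether an object is the formal unit. -/
def isUnit : Plus C → Bool
  | .unit => true
  | .of _ => false

theorem isUnit_eq {X Y : Plus C} (f : X ⟶ Y) : X.isUnit = Y.isUnit := by
  cases f using hom_cases <;> rfl

variable (S : SemiSym C)

/-- The tensor product of `Plus C` on objects. -/
def op : Plus C → Plus C → Plus C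
  | .unit, Y => Y
  | .of a, .unit => .of a
  | .of a, .of b => .of (S.obj a b)

theorem isUnit_op (X Y : Plus C) : (op S X Y).isUnit = (X.isUnit && Y.isUnit) := by
  cases X <;> cases Y <;> rfl

/-- The tensor product of `Plus C` on arrows. -/
def opMap : ∀ {X X' Y Y' : Plus C}, (X ⟶ X') → (Y ⟶ Y') → (op S X Y ⟶ op S X' Y')
  | _, _, _, _, Hom.unit, g => g
  | _, _, _, _, Hom.of f, Hom.unit => Hom.of f
  | _, _, _, _, Hom.of f, Hom.of g => Hom.of (S.map f g)

/-- The embedding of isomorphisms. -/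
def embIso {a b : C} (e : a ≅ b) : Plus.of a ≅ Plus.of b where
  hom := emb e.hom
  inv := emb e.inv
  hom_inv_id := by rw [← emb_comp, e.hom_inv_id]; rfl
  inv_hom_id := by rw [← emb_comp, e.inv_hom_id]; rfl

/-- The associator of `Plus C`. -/
def opAssoc : ∀ X Y Z : Plus C, op S (op S X Y) Z ≅ op S X (op S Y Z)
  | .of a, .of b, .of c => embIso (S.assoc a b c)
  | .unit, .unit, _ => Iso.refl _
  | .unit, .of _, .unit => Iso.refl _
  | .unit, .of _, .of _ => Iso.refl _
  | .of _, .unit, .unit => Iso.refl _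
  | .of _, .unit, .of _ => Iso.refl _
  | .of _, .of _, .unit => Iso.refl _

/-- The right unitor of `Plus C`. -/
def opRight : ∀ X : Plus C, op S X .unit ≅ X
  | .unit => Iso.refl _
  | .of _ => Iso.refl _

/-- The symmetry of `Plus C`. -/
def opSwap : ∀ X Y : Plus C, op S X Y ⟶ op S Y X
  | .of a, .of b => emb (S.swap a b)
  | .unit, .unit => 𝟙 _
  | .unit, .of _ => 𝟙 _
  | .of _, .unit => 𝟙 _

theorem opSwap_opSwap (X Y : Plus C) : opSwap S X Y ≫ opSwap S Y X = 𝟙 _ := by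
  cases X <;> cases Y <;> first
    | exact Category.comp_id _
    | exact congrArg emb (S.swap_swap _ _)

theorem opMap_id (X Y : Plus C) : opMap S (𝟙 X) (𝟙 Y) = 𝟙 (op S X Y) := by
  cases X <;> cases Y <;> first
    | rfl
    | exact congrArg emb (S.map_id _ _)

theorem opMap_comp {X Y Z X' Y' Z' : Plus C} (f : X ⟶ Y) (f' : X' ⟶ Y') (g : Y ⟶ Z)
    (g' : Y' ⟶ Z') : opMap S f f' ≫ opMap S g g' = opMap S (f ≫ g) (f' ≫ g') := by
  cases f using hom_cases <;> cases f' using hom_cases <;> cases g using hom_cases <;>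
    cases g' using hom_cases <;> first
    | rfl
    | exact congrArg emb (S.map_comp _ _ _ _).symm

theorem opSwap_nat {X X' Y Y' : Plus C} (f : X ⟶ X') (g : Y ⟶ Y') :
    opMap S f g ≫ opSwap S X' Y' = opSwap S X Y ≫ opMap S g f := by
  cases f using hom_cases <;> cases g using hom_cases <;> first
    | exact congrArg emb (S.swap_nat _ _)
    | exact (Category.comp_id _).trans (Category.id_comp _).symm

theorem opAssoc_nat {X X' Y Y' Z Z' : Plus C} (f : X ⟶ X') (g : Y ⟶ Y') (h : Z ⟶ Z') :
    opMap S f (opMap S g h) ≫ (opAssoc S X' Y' Z').inv =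
      (opAssoc S X Y Z).inv ≫ opMap S (opMap S f g) h := by
  cases f using hom_cases <;> cases g using hom_cases <;> cases h using hom_cases <;> first
    | exact congrArg emb (S.assoc_nat _ _ _)
    | exact (Category.comp_id _).trans (Category.id_comp _).symm

theorem opPentagon (W X Y Z : Plus C) :
    (opAssoc S W X (op S Y Z)).inv ≫ (opAssoc S (op S W X) Y Z).inv =
      opMap S (𝟙 W) (opAssoc S X Y Z).inv ≫ (opAssoc S W (op S X Y) Z).inv ≫
        opMap S (opAssoc S W X Y).inv (𝟙 Z) := by
  cases W <;> cases X <;> cases Y <;> cases Z <;> first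
    | rfl
    | exact congrArg emb (S.pentagon _ _ _ _)
    | simp [opAssoc, op, opMap_id] <;> first
      | exact (Category.comp_id _).symm
      | exact (Category.id_comp _).symm

theorem opHexagon (X Y Z : Plus C) :
    (opAssoc S X Y Z).inv ≫ opSwap S (op S X Y) Z ≫ (opAssoc S Z X Y).inv =
      opMap S (𝟙 X) (opSwap S Y Z) ≫ (opAssoc S X Z Y).inv ≫ opMap S (opSwap S X Z) (𝟙 Y) := by
  cases X <;> cases Y <;> cases Z <;> first
    | rfl
    | exact congrArg emb (S.hexagon _ _ _)
    | simp [opAssoc, opSwap, op, opMap_id] <;> first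
      | exact (Category.comp_id _).symm
      | exact (Category.id_comp _).symm

end Plus

namespace Plus

open MonoidalCategory

variable {C : Type} [Category.{0} C] (S : SemiSym C)

/-- Adjoining a unit to a non-unital symmetric monoidal category. -/
@[reducible]
def monoidal : MonoidalCategory (Plus C) :=
  letI : MonoidalCategoryStruct (Plus C) :=
    { tensorObj := op S
      whiskerLeft := fun X _ _ f => opMap S (𝟙 X) f
      whiskerRight := fun f Y => opMap S f (𝟙 Y)
      tensorHom := opMap S
      tensorUnit := .unit
      associator := opAssoc S
      leftUnitor := fun X => Iso.refl X
      rightUnitor := opRight S }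
  MonoidalCategory.ofTensorHom
    (id_tensorHom_id := opMap_id S)
    (id_tensorHom := fun _ _ _ _ => rfl)
    (tensorHom_id := fun _ _ => rfl)
    (tensorHom_comp_tensorHom := fun f f' g g' => opMap_comp S f f' g g')
    (associator_naturality := fun {X₁ X₂ X₃ Y₁ Y₂ Y₃} f g h => by
      change opMap S (opMap S f g) h ≫ (opAssoc S Y₁ Y₂ Y₃).hom =
        (opAssoc S X₁ X₂ X₃).hom ≫ opMap S f (opMap S g h)
      rw [← Iso.inv_comp_eq, ← Category.assoc, ← Iso.eq_comp_inv, opAssoc_nat])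
    (leftUnitor_naturality := fun f =>
      (Category.comp_id f).trans (Category.id_comp f).symm)
    (rightUnitor_naturality := fun f => by
      cases f using hom_cases
      · rfl
      · exact (Category.comp_id _).trans (Category.id_comp _).symm)
    (pentagon := fun W X Y Z => by
      have h := opPentagon S W X Y Z
      change opMap S (opAssoc S W X Y).hom (𝟙 Z) ≫ (opAssoc S W (op S X Y) Z).hom ≫
        opMap S (𝟙 W) (opAssoc S X Y Z).hom =
          (opAssoc S (op S W X) Y Z).hom ≫ (opAssoc S W X (op S Y Z)).hom
      have e (A : Plus C) {P Q : Plus C} (i : P ≅ Q) :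
          opMap S (𝟙 A) i.hom ≫ opMap S (𝟙 A) i.inv = 𝟙 _ := by
        rw [opMap_comp, i.hom_inv_id, Category.comp_id, opMap_id]
      have e' (A : Plus C) {P Q : Plus C} (i : P ≅ Q) :
          opMap S i.hom (𝟙 A) ≫ opMap S i.inv (𝟙 A) = 𝟙 _ := by
        rw [opMap_comp, i.hom_inv_id, Category.comp_id, opMap_id]
      rw [← cancel_mono ((opAssoc S W X (op S Y Z)).inv ≫ (opAssoc S (op S W X) Y Z).inv)]
      conv_lhs => rw [h]
      simp only [Category.assoc, Iso.hom_inv_id_assoc, Iso.hom_inv_id, e',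
        reassoc_of% (e W (opAssoc S X Y Z))])
    (triangle := fun X Y => by
      cases X <;> cases Y <;> first
        | rfl
        | exact Category.id_comp _)

/-- The symmetry of the category obtained by adjoining a unit. -/
@[reducible]
def symmetric : letI := monoidal S; SymmetricCategory (Plus C) :=
  letI := monoidal S
  { braiding := fun X Y => ⟨opSwap S X Y, opSwap S Y X, opSwap_opSwap S X Y, opSwap_opSwap S Y X⟩
    braiding_naturality_right := fun X _ _ f => opSwap_nat S (𝟙 X) f
    braiding_naturality_left := fun f Z => opSwap_nat S f (𝟙 Z)
    hexagon_forward := fun X Y Z => by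
      have h := opHexagon S Y Z X
      change (opAssoc S X Y Z).hom ≫ opSwap S X (op S Y Z) ≫ (opAssoc S Y Z X).hom =
        opMap S (opSwap S X Y) (𝟙 Z) ≫ (opAssoc S Y X Z).hom ≫ opMap S (𝟙 Y) (opSwap S X Z)
      have e : opMap S (𝟙 Y) (opSwap S X Z) ≫ opMap S (𝟙 Y) (opSwap S Z X) = 𝟙 _ := by
        rw [opMap_comp, opSwap_opSwap, Category.comp_id, opMap_id]
      have e' : opMap S (opSwap S X Y) (𝟙 Z) ≫ opMap S (opSwap S Y X) (𝟙 Z) = 𝟙 _ := by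
        rw [opMap_comp, opSwap_opSwap, Category.comp_id, opMap_id]
      have i : IsIso (opSwap S (op S Y Z) X) :=
        ⟨opSwap S _ _, opSwap_opSwap S _ _, opSwap_opSwap S _ _⟩
      rw [← cancel_mono
        ((opAssoc S Y Z X).inv ≫ opSwap S (op S Y Z) X ≫ (opAssoc S X Y Z).inv)]
      conv_rhs => rw [h]
      simp only [Category.assoc, Iso.hom_inv_id_assoc, Iso.hom_inv_id, e', reassoc_of% e,
        reassoc_of% (opSwap_opSwap S X (op S Y Z))]
    hexagon_reverse := fun X Y Z => opHexagon S X Y Z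
    symmetry := fun X Y => opSwap_opSwap S X Y }

end Plus

section Split

open MonoidalCategory BraidedCategory

variable {V : Type*} [Category* V] [MonoidalCategory V] [SymmetricCategory V]

theorem braiding_tensorμ (X₁ X₂ Y₁ Y₂ : V) :
    (β_ (X₁ ⊗ X₂) (Y₁ ⊗ Y₂)).hom ≫ tensorμ Y₁ Y₂ X₁ X₂ =
      tensorμ X₁ X₂ Y₁ Y₂ ≫ ((β_ X₁ Y₁).hom ⊗ₘ (β_ X₂ Y₂).hom) := by
  simp [tensorμ, SymmetricCategory.braiding_swap_eq_inv_braiding X₁ Y₂,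
    MonoidalCategory.tensorHom_def]

instance (X₁ X₂ Y₁ Y₂ : V) : IsIso (tensorμ X₁ X₂ Y₁ Y₂) :=
  ⟨tensorδ X₁ X₂ Y₁ Y₂, tensorμ_tensorδ X₁ X₂ Y₁ Y₂, tensorδ_tensorμ X₁ X₂ Y₁ Y₂⟩

/-- The splitting of a tensor product induced by splittings of its factors. -/
def split {X X₁ X₂ Y Y₁ Y₂ : V} (a : X ⟶ X₁ ⊗ X₂) (b : Y ⟶ Y₁ ⊗ Y₂) :
    X ⊗ Y ⟶ (X₁ ⊗ Y₁) ⊗ (X₂ ⊗ Y₂) :=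
  (a ⊗ₘ b) ≫ tensorμ X₁ X₂ Y₁ Y₂

instance {X X₁ X₂ Y Y₁ Y₂ : V} (a : X ⟶ X₁ ⊗ X₂) (b : Y ⟶ Y₁ ⊗ Y₂) [IsIso a] [IsIso b] :
    IsIso (split a b) := by
  unfold split; infer_instance

variable {X X₁ X₂ Y Y₁ Y₂ Z Z₁ Z₂ X' X₁' X₂' Y' Y₁' Y₂' : V}

theorem map_split {f : X ⟶ X'} {g : Y ⟶ Y'} {a : X ⟶ X₁ ⊗ X₂} {a' : X' ⟶ X₁' ⊗ X₂'}
    {b : Y ⟶ Y₁ ⊗ Y₂} {b' : Y' ⟶ Y₁' ⊗ Y₂'} {f₁ : X₁ ⟶ X₁'} {f₂ : X₂ ⟶ X₂'} {g₁ : Y₁ ⟶ Y₁'}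
    {g₂ : Y₂ ⟶ Y₂'} (hf : f ≫ a' = a ≫ (f₁ ⊗ₘ f₂)) (hg : g ≫ b' = b ≫ (g₁ ⊗ₘ g₂)) :
    (f ⊗ₘ g) ≫ split a' b' = split a b ≫ ((f₁ ⊗ₘ g₁) ⊗ₘ (f₂ ⊗ₘ g₂)) := by
  simp only [split]
  rw [Category.assoc, ← tensorμ_natural, tensorHom_comp_tensorHom_assoc, hf, hg,
    tensorHom_comp_tensorHom_assoc]

theorem associator_hom_split (a : X ⟶ X₁ ⊗ X₂) (b : Y ⟶ Y₁ ⊗ Y₂) (c : Z ⟶ Z₁ ⊗ Z₂) :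
    (α_ X Y Z).hom ≫ split a (split b c) =
      split (split a b) c ≫ ((α_ X₁ Y₁ Z₁).hom ⊗ₘ (α_ X₂ Y₂ Z₂).hom) := by
  have h := tensor_associativity X₁ X₂ Y₁ Y₂ Z₁ Z₂
  have e : split (split a b) c = ((a ⊗ₘ b) ⊗ₘ c) ≫
      tensorμ X₁ X₂ Y₁ Y₂ ▷ (Z₁ ⊗ Z₂) ≫ tensorμ (X₁ ⊗ Y₁) (X₂ ⊗ Y₂) Z₁ Z₂ := by
    simp only [split]
    rw [← tensorHom_id, tensorHom_comp_tensorHom_assoc, Category.comp_id]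
  have e' : split a (split b c) = (a ⊗ₘ (b ⊗ₘ c)) ≫
      (X₁ ⊗ X₂) ◁ tensorμ Y₁ Y₂ Z₁ Z₂ ≫ tensorμ X₁ X₂ (Y₁ ⊗ Z₁) (Y₂ ⊗ Z₂) := by
    simp only [split]
    rw [← id_tensorHom, tensorHom_comp_tensorHom_assoc, Category.comp_id]
  rw [e, e', ← associator_naturality_assoc, ← h, Category.assoc, Category.assoc]

theorem associator_inv_split (a : X ⟶ X₁ ⊗ X₂) (b : Y ⟶ Y₁ ⊗ Y₂) (c : Z ⟶ Z₁ ⊗ Z₂) :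
    (α_ X Y Z).inv ≫ split (split a b) c =
      split a (split b c) ≫ ((α_ X₁ Y₁ Z₁).inv ⊗ₘ (α_ X₂ Y₂ Z₂).inv) := by
  rw [Iso.inv_comp_eq, ← Category.assoc, associator_hom_split, Category.assoc,
    tensorHom_comp_tensorHom]
  simp

theorem braiding_split (a : X ⟶ X₁ ⊗ X₂) (b : Y ⟶ Y₁ ⊗ Y₂) :
    (β_ X Y).hom ≫ split b a =
      split a b ≫ ((β_ X₁ Y₁).hom ⊗ₘ (β_ X₂ Y₂).hom) := by
  simp only [split]
  rw [Category.assoc, ← braiding_tensorμ, ← braiding_naturality_assoc]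

end Split

instance homSetoid (A B : Frm2) : Setoid (Tm2 A B) where
  r := Eq2
  iseqv := ⟨Eq2.refl, Eq2.symm, Eq2.trans⟩

/-- The free SAI category: arrows are arrow terms up to provable equality. -/
instance : Category Frm2 where
  Hom A B := Quotient (homSetoid A B)
  id A := Quotient.mk _ (Tm2.id A)
  comp := Quotient.map₂ (fun f g => g.comp f) fun _ _ hf _ _ hg => Eq2.comp_congr hg hf
  id_comp := by rintro _ _ ⟨f⟩; exact Quotient.sound (Eq2.comp_id f)
  comp_id := by rintro _ _ ⟨f⟩; exact Quotient.sound (Eq2.id_comp f)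
  assoc := by
    rintro _ _ _ _ ⟨f⟩ ⟨g⟩ ⟨h⟩; exact Quotient.sound (Eq2.symm (Eq2.comp_assoc h g f))

/-- The arrow of the free SAI category named by an arrow term. -/
def toHom {A B : Frm2} (f : Tm2 A B) : A ⟶ B := Quotient.mk _ f

/-- The disjunction of the free SAI category. -/
def orS : SemiSym Frm2 where
  obj := Frm2.or
  map := Quotient.map₂ Tm2.orM fun _ _ hf _ _ hg => Eq2.or_congr hf hg
  assoc A B C := ⟨toHom (Tm2.bOrFrom A B C), toHom (Tm2.bOrTo A B C),
    Quotient.sound (Eq2.bOr_iso1 A B C), Quotient.sound (Eq2.bOr_iso2 A B C)⟩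
  swap A B := toHom (Tm2.cOr A B)
  map_id A B := Quotient.sound (Eq2.or_id A B)
  map_comp := by
    rintro _ _ _ _ _ _ ⟨f⟩ ⟨g⟩ ⟨f'⟩ ⟨g'⟩; exact Quotient.sound (Eq2.or_comp g f g' f')
  assoc_nat := by
    rintro _ _ _ _ _ _ ⟨f⟩ ⟨g⟩ ⟨h⟩; exact Quotient.sound (Eq2.bOr_nat f g h)
  swap_nat := by rintro _ _ _ _ ⟨f⟩ ⟨g⟩; exact Quotient.sound (Eq2.cOr_nat f g)
  swap_swap A B := Quotient.sound (Eq2.cOr_inv A B)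
  pentagon A B C D :=
    Quotient.sound (Eq2.trans (Eq2.pentagonOr A B C D) (Eq2.symm (Eq2.comp_assoc _ _ _)))
  hexagon A B C := Quotient.sound <|
    Eq2.trans (Eq2.comp_assoc _ _ _) <|
      Eq2.trans (Eq2.hexagonOr A B C) (Eq2.symm (Eq2.comp_assoc _ _ _))

/-- The conjunction of the free SAI category. -/
def andS : SemiSym Frm2 where
  obj := Frm2.and
  map := Quotient.map₂ Tm2.andM fun _ _ hf _ _ hg => Eq2.and_congr hf hg
  assoc A B C := ⟨toHom (Tm2.bAndFrom A B C), toHom (Tm2.bAndTo A B C),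
    Quotient.sound (Eq2.bAnd_iso1 A B C), Quotient.sound (Eq2.bAnd_iso2 A B C)⟩
  swap A B := toHom (Tm2.cAnd A B)
  map_id A B := Quotient.sound (Eq2.and_id A B)
  map_comp := by
    rintro _ _ _ _ _ _ ⟨f⟩ ⟨g⟩ ⟨f'⟩ ⟨g'⟩; exact Quotient.sound (Eq2.and_comp g f g' f')
  assoc_nat := by
    rintro _ _ _ _ _ _ ⟨f⟩ ⟨g⟩ ⟨h⟩; exact Quotient.sound (Eq2.bAnd_nat f g h)
  swap_nat := by rintro _ _ _ _ ⟨f⟩ ⟨g⟩; exact Quotient.sound (Eq2.cAnd_nat f g)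
  swap_swap A B := Quotient.sound (Eq2.cAnd_inv A B)
  pentagon A B C D :=
    Quotient.sound (Eq2.trans (Eq2.pentagonAnd A B C D) (Eq2.symm (Eq2.comp_assoc _ _ _)))
  hexagon A B C := Quotient.sound <|
    Eq2.trans (Eq2.comp_assoc _ _ _) <|
      Eq2.trans (Eq2.hexagonAnd A B C) (Eq2.symm (Eq2.comp_assoc _ _ _))

namespace Plus

/-- Intermutation in the category with an adjoined unit, where it makes sense. -/
def inter : ∀ A B C D : Plus Frm2, A.isUnit = C.isUnit → B.isUnit = D.isUnit →
    (op orS (op andS A B) (op andS C D) ⟶ op andS (op orS A C) (op orS B D))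
  | .of a, .of b, .of c, .of d, _, _ => emb (toHom (Tm2.ck a b c d))
  | .of a, .unit, .of c, .unit, _, _ => 𝟙 (Plus.of (a.or c))
  | .unit, .of b, .unit, .of d, _, _ => 𝟙 (Plus.of (b.or d))
  | .unit, .unit, .unit, .unit, _, _ => 𝟙 _

theorem orS_obj (a b : Frm2) : orS.obj a b = a.or b := rfl

theorem andS_obj (a b : Frm2) : andS.obj a b = a.and b := rfl

theorem inter_nat {A B C D A' B' C' D' : Plus Frm2} (f : A ⟶ A') (g : B ⟶ B') (h : C ⟶ C')
    (k : D ⟶ D') (p : A.isUnit = C.isUnit) (q : B.isUnit = D.isUnit)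
    (p' : A'.isUnit = C'.isUnit) (q' : B'.isUnit = D'.isUnit) :
    opMap orS (opMap andS f g) (opMap andS h k) ≫ inter A' B' C' D' p' q' =
      inter A B C D p q ≫ opMap andS (opMap orS f h) (opMap orS g k) := by
  cases f using hom_cases <;> cases h using hom_cases <;> cases p <;>
    cases g using hom_cases <;> cases k using hom_cases <;> cases q <;> first
    | exact (Category.comp_id _).trans (Category.id_comp _).symm
    | skip
  rename_i f _ _ h _ _ g _ _ k
  obtain ⟨f⟩ := f
  obtain ⟨g⟩ := g
  obtain ⟨h⟩ := h
  obtain ⟨k⟩ := k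
  exact congrArg emb (Quotient.sound (Eq2.ck_nat f g h k))

theorem inter_assoc (A B C D E F : Plus Frm2) (p : A.isUnit = D.isUnit)
    (q : B.isUnit = E.isUnit) (r : C.isUnit = F.isUnit)
    (s : (op andS B C).isUnit = (op andS E F).isUnit)
    (t : (op andS A B).isUnit = (op andS D E).isUnit) :
    inter A (op andS B C) D (op andS E F) p s ≫
        opMap andS (𝟙 (op orS A D)) (inter B C E F q r) ≫ (opAssoc andS _ _ _).inv =
      opMap orS (opAssoc andS A B C).inv (opAssoc andS D E F).inv ≫
        inter (op andS A B) C (op andS D E) F t r ≫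
          opMap andS (inter A B D E p q) (𝟙 (op orS C F)) := by
  cases A <;> cases D <;> cases p <;> cases B <;> cases E <;> cases q <;> cases C <;>
    cases F <;> cases r <;> first
    | rfl
    | exact congrArg emb (Quotient.sound (Eq2.trans (Eq2.comp_assoc _ _ _)
        (Eq2.trans (Eq2.diag1 _ _ _ _ _ _) (Eq2.symm (Eq2.comp_assoc _ _ _)))))
    | (refine congrArg emb ?_; simp [SemiSym.map_id, orS_obj, andS_obj])

theorem inter_swap (A B C D : Plus Frm2) (p : A.isUnit = C.isUnit) (q : B.isUnit = D.isUnit) :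
    inter A B C D p q ≫ opSwap andS _ _ =
      opMap orS (opSwap andS A B) (opSwap andS C D) ≫ inter B A D C q p := by
  cases A <;> cases C <;> cases p <;> cases B <;> cases D <;> cases q <;> first
    | rfl
    | exact congrArg emb (Quotient.sound (Eq2.diag3 _ _ _ _))
    | (refine congrArg emb ?_; simp [SemiSym.map_id, orS_obj])

theorem assoc_inter (A B C D E F : Plus Frm2) (p : A.isUnit = B.isUnit)
    (p' : B.isUnit = C.isUnit) (q : D.isUnit = E.isUnit) (q' : E.isUnit = F.isUnit)
    (s : A.isUnit = (op orS B C).isUnit) (s' : D.isUnit = (op orS E F).isUnit)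
    (t : (op orS A B).isUnit = C.isUnit) (t' : (op orS D E).isUnit = F.isUnit) :
    opMap orS (𝟙 (op andS A D)) (inter B E C F p' q') ≫
        inter A D (op orS B C) (op orS E F) s s' ≫
          opMap andS (opAssoc orS A B C).inv (opAssoc orS D E F).inv =
      (opAssoc orS _ _ _).inv ≫ opMap orS (inter A D B E p q) (𝟙 (op andS C F)) ≫
        inter (op orS A B) (op orS D E) C F t t' := by
  cases A <;> cases B <;> cases p <;> cases C <;> cases p' <;> cases D <;> cases E <;> cases q <;>
    cases F <;> cases q' <;> first
    | rfl
    | exact congrArg emb (Quotient.sound (Eq2.trans (Eq2.comp_assoc _ _ _)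
        (Eq2.trans (Eq2.diag2 _ _ _ _ _ _) (Eq2.symm (Eq2.comp_assoc _ _ _)))))
    | (refine congrArg emb ?_; simp [SemiSym.map_id, orS_obj])

theorem swap_inter (A B C D : Plus Frm2) (p : A.isUnit = B.isUnit) (q : C.isUnit = D.isUnit) :
    opSwap orS (op andS A C) (op andS B D) ≫ inter B D A C p.symm q.symm =
      inter A C B D p q ≫ opMap andS (opSwap orS A B) (opSwap orS C D) := by
  cases A <;> cases B <;> cases p <;> cases C <;> cases D <;> cases q <;> first
    | rfl
    | exact congrArg emb (Quotient.sound (Eq2.diag4 _ _ _ _))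
    | exact congrArg emb ((Category.comp_id _).trans (Category.id_comp _).symm)

/-- The part of a formula built from the letters satisfying `Y`. -/
def res (Y : ℕ → Bool) : Frm2 → Plus Frm2
  | .pl n => bif Y n then .of (.pl n) else .unit
  | .or A B => op orS (res Y A) (res Y B)
  | .and A B => op andS (res Y A) (res Y B)

/-- The complement of a set of letters. -/
def others (Y : ℕ → Bool) : ℕ → Bool := fun n => !Y n

theorem isUnit_res_others {Y : ℕ → Bool} {D : Frm2} (h : (res Y D).isUnit = true) :
    (res (others Y) D).isUnit = false := by
  induction D with
  | pl n => cases e : Y n <;> simp_all [res, others, isUnit]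
  | and A B ihA ihB => simp_all [res, isUnit_op]
  | or A B ihA ihB => simp_all [res, isUnit_op]

theorem others_others (Y : ℕ → Bool) : others (others Y) = Y := funext fun n => Bool.not_not (Y n)

theorem isUnit_res {Y : ℕ → Bool} {D : Frm2} (h : (res (others Y) D).isUnit = true) :
    (res Y D).isUnit = false := by
  simpa [others_others] using isUnit_res_others h

theorem res_eq_of_isUnit {Y : ℕ → Bool} {D : Frm2} (h : (res (others Y) D).isUnit = true) :
    res Y D = .of D := by
  induction D with
  | pl n => cases e : Y n <;> simp_all [res, others, isUnit]
  | and A B ihA ihB => simp_all [res, isUnit_op]; rfl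
  | or A B ihA ihB => simp_all [res, isUnit_op]; rfl

section Conjunction

open MonoidalCategory BraidedCategory

/-- The monoidal structure given by conjunction. -/
@[reducible]
def andMonoidal : MonoidalCategory (Plus Frm2) := monoidal andS

attribute [local instance] andMonoidal

/-- The symmetry of conjunction. -/
@[reducible]
def andSymmetric : SymmetricCategory (Plus Frm2) := symmetric andS

attribute [local instance] andSymmetric

theorem isUnit_tensor {A B C D : Plus Frm2} (p : A.isUnit = C.isUnit) (q : B.isUnit = D.isUnit) :
    (A ⊗ B).isUnit = (C ⊗ D).isUnit := by
  change (op andS A B).isUnit = (op andS C D).isUnit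
  rw [isUnit_op, isUnit_op, p, q]

/-- Intermutation, seen as an arrow into a tensor product. -/
def mix (A B C D : Plus Frm2) (p : A.isUnit = C.isUnit) (q : B.isUnit = D.isUnit) :
    op orS (A ⊗ B) (C ⊗ D) ⟶ op orS A C ⊗ op orS B D :=
  inter A B C D p q

/-- Disjunction as an operation on arrows. -/
def disj {A B C D : Plus Frm2} (f : A ⟶ B) (g : C ⟶ D) : op orS A C ⟶ op orS B D :=
  opMap orS f g

theorem mix_natural {A B C D A' B' C' D' : Plus Frm2} (f : A ⟶ A') (g : B ⟶ B') (h : C ⟶ C')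
    (k : D ⟶ D') (p : A.isUnit = C.isUnit) (q : B.isUnit = D.isUnit)
    (p' : A'.isUnit = C'.isUnit) (q' : B'.isUnit = D'.isUnit) :
    disj (f ⊗ₘ g) (h ⊗ₘ k) ≫ mix A' B' C' D' p' q' =
      mix A B C D p q ≫ (disj f h ⊗ₘ disj g k) :=
  inter_nat f g h k p q p' q'

theorem mix_associator_inv (A B C D E F : Plus Frm2) (p : A.isUnit = D.isUnit)
    (q : B.isUnit = E.isUnit) (r : C.isUnit = F.isUnit) :
    mix A (B ⊗ C) D (E ⊗ F) p (isUnit_tensor q r) ≫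
        op orS A D ◁ mix B C E F q r ≫ (α_ (op orS A D) (op orS B E) (op orS C F)).inv =
      disj (α_ A B C).inv (α_ D E F).inv ≫ mix (A ⊗ B) C (D ⊗ E) F (isUnit_tensor p q) r ≫
          mix A B D E p q ▷ op orS C F :=
  inter_assoc A B C D E F p q r _ _

theorem disj_id (A B : Plus Frm2) : disj (𝟙 A) (𝟙 B) = 𝟙 (op orS A B) := opMap_id orS A B

theorem mix_natural_right {A C B D B' D' : Plus Frm2} (g : B ⟶ B') (k : D ⟶ D')
    (p : A.isUnit = C.isUnit) (q : B.isUnit = D.isUnit) (q' : B'.isUnit = D'.isUnit) :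
    disj (A ◁ g) (C ◁ k) ≫ mix A B' C D' p q' = mix A B C D p q ≫ op orS A C ◁ disj g k := by
  have h := mix_natural (𝟙 A) g (𝟙 C) k p q p q'
  rwa [disj_id, id_tensorHom, id_tensorHom, id_tensorHom] at h

theorem mix_natural_left {A C B D A' C' : Plus Frm2} (f : A ⟶ A') (h : C ⟶ C')
    (p : A.isUnit = C.isUnit) (q : B.isUnit = D.isUnit) (p' : A'.isUnit = C'.isUnit) :
    disj (f ▷ B) (h ▷ D) ≫ mix A' B C' D p' q = mix A B C D p q ≫ disj f h ▷ op orS B D := by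
  have e := mix_natural f (𝟙 B) h (𝟙 D) p q p' q
  rwa [disj_id, tensorHom_id, tensorHom_id, tensorHom_id] at e

theorem disj_comp {A B C A' B' C' : Plus Frm2} (f : A ⟶ B) (g : B ⟶ C) (f' : A' ⟶ B')
    (g' : B' ⟶ C') : disj f f' ≫ disj g g' = disj (f ≫ g) (f' ≫ g') :=
  opMap_comp orS f f' g g'

theorem mix_associator_hom (A B C D E F : Plus Frm2) (p : A.isUnit = D.isUnit)
    (q : B.isUnit = E.isUnit) (r : C.isUnit = F.isUnit) :
    mix (A ⊗ B) C (D ⊗ E) F (isUnit_tensor p q) r ≫ mix A B D E p q ▷ op orS C F ≫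
        (α_ (op orS A D) (op orS B E) (op orS C F)).hom =
      disj (α_ A B C).hom (α_ D E F).hom ≫ mix A (B ⊗ C) D (E ⊗ F) p (isUnit_tensor q r) ≫
        op orS A D ◁ mix B C E F q r := by
  have h := mix_associator_inv A B C D E F p q r
  rw [← Category.assoc, ← Iso.eq_comp_inv]
  simp only [Category.assoc, h]
  rw [reassoc_of% (@disj_comp), Iso.hom_inv_id, Iso.hom_inv_id, disj_id, Category.id_comp]

theorem mix_braiding (A B C D : Plus Frm2) (p : A.isUnit = C.isUnit) (q : B.isUnit = D.isUnit) :
    mix A B C D p q ≫ (β_ (op orS A C) (op orS B D)).hom =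
      disj (β_ A B).hom (β_ C D).hom ≫ mix B A D C q p :=
  inter_swap A B C D p q

theorem tensorμ_mix (A₁ A₂ B₁ B₂ C₁ C₂ D₁ D₂ : Plus Frm2) (p₁ : A₁.isUnit = C₁.isUnit)
    (p₂ : A₂.isUnit = C₂.isUnit) (q₁ : B₁.isUnit = D₁.isUnit) (q₂ : B₂.isUnit = D₂.isUnit) :
    disj (tensorμ A₁ A₂ B₁ B₂) (tensorμ C₁ C₂ D₁ D₂) ≫
        mix (A₁ ⊗ B₁) (A₂ ⊗ B₂) (C₁ ⊗ D₁) (C₂ ⊗ D₂) (isUnit_tensor p₁ q₁)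
          (isUnit_tensor p₂ q₂) ≫ (mix A₁ B₁ C₁ D₁ p₁ q₁ ⊗ₘ mix A₂ B₂ C₂ D₂ p₂ q₂) =
      mix (A₁ ⊗ A₂) (B₁ ⊗ B₂) (C₁ ⊗ C₂) (D₁ ⊗ D₂) (isUnit_tensor p₁ p₂)
          (isUnit_tensor q₁ q₂) ≫ (mix A₁ A₂ C₁ C₂ p₁ p₂ ⊗ₘ mix B₁ B₂ D₁ D₂ q₁ q₂) ≫
        tensorμ (op orS A₁ C₁) (op orS A₂ C₂) (op orS B₁ D₁) (op orS B₂ D₂) := by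
  have inner : mix A₂ (B₁ ⊗ B₂) C₂ (D₁ ⊗ D₂) p₂ (isUnit_tensor q₁ q₂) ≫
      op orS A₂ C₂ ◁ mix B₁ B₂ D₁ D₂ q₁ q₂ ≫
        (α_ (op orS A₂ C₂) (op orS B₁ D₁) (op orS B₂ D₂)).inv ≫
          (β_ (op orS A₂ C₂) (op orS B₁ D₁)).hom ▷ op orS B₂ D₂ ≫
            (α_ (op orS B₁ D₁) (op orS A₂ C₂) (op orS B₂ D₂)).hom =
      disj ((α_ A₂ B₁ B₂).inv ≫ (β_ A₂ B₁).hom ▷ B₂ ≫ (α_ B₁ A₂ B₂).hom)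
          ((α_ C₂ D₁ D₂).inv ≫ (β_ C₂ D₁).hom ▷ D₂ ≫ (α_ D₁ C₂ D₂).hom) ≫
        mix B₁ (A₂ ⊗ B₂) D₁ (C₂ ⊗ D₂) q₁ (isUnit_tensor p₂ q₂) ≫
          op orS B₁ D₁ ◁ mix A₂ B₂ C₂ D₂ p₂ q₂ := by
    rw [reassoc_of% mix_associator_inv, ← comp_whiskerRight_assoc, mix_braiding,
      comp_whiskerRight_assoc, ← reassoc_of% (mix_natural_left _ _ _ _ (isUnit_tensor q₁ p₂)),
      mix_associator_hom, reassoc_of% (@disj_comp), reassoc_of% (@disj_comp)]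
    simp only [Category.assoc]
  simp only [tensorμ]
  rw [tensorHom_def (mix A₁ A₂ C₁ C₂ p₁ p₂), Category.assoc, associator_naturality_right_assoc,
    reassoc_of% mix_associator_hom]
  simp only [← MonoidalCategory.whiskerLeft_comp_assoc, inner]
  conv_rhs =>
    rw [MonoidalCategory.whiskerLeft_comp_assoc,
      ← reassoc_of% (mix_natural_right _ _ _ _ (isUnit_tensor q₁ (isUnit_tensor p₂ q₂))),
      MonoidalCategory.whiskerLeft_comp_assoc, associator_inv_naturality_right,
      reassoc_of% mix_associator_inv, ← MonoidalCategory.tensorHom_def,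
      reassoc_of% (@disj_comp), reassoc_of% (@disj_comp)]
  simp only [MonoidalCategory.whiskerLeft_comp, Category.assoc]

/-- The condition under which intermutation separates `Y` from its complement in a formula. -/
def Separable (Y : ℕ → Bool) : Frm2 → Prop
  | .pl _ => True
  | .and A B => Separable Y A ∧ Separable Y B
  | .or A B => Separable Y A ∧ Separable Y B ∧ (res Y A).isUnit = (res Y B).isUnit ∧
      (res (others Y) A).isUnit = (res (others Y) B).isUnit

theorem of_pl_eq (Y : ℕ → Bool) (n : ℕ) :
    Plus.of (.pl n) = res Y (.pl n) ⊗ res (others Y) (.pl n) := by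
  change _ = op andS (bif Y n then .of (.pl n) else .unit) (bif !Y n then .of (.pl n) else .unit)
  cases Y n <;> rfl

/-- The splitting of a disjunction induced by splittings of the disjuncts. -/
def orSplit {X X₁ X₂ Y Y₁ Y₂ : Plus Frm2} (a : X ⟶ X₁ ⊗ X₂) (b : Y ⟶ Y₁ ⊗ Y₂)
    (p : X₁.isUnit = Y₁.isUnit) (q : X₂.isUnit = Y₂.isUnit) :
    op orS X Y ⟶ op orS X₁ Y₁ ⊗ op orS X₂ Y₂ :=
  disj a b ≫ mix X₁ X₂ Y₁ Y₂ p q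

/-- The arrow separating `Y` from its complement. -/
def separate (Y : ℕ → Bool) : ∀ D : Frm2, Separable Y D →
    (Plus.of D ⟶ res Y D ⊗ res (others Y) D)
  | .pl n, _ => eqToHom (of_pl_eq Y n)
  | .and A B, h => split (separate Y A h.1) (separate Y B h.2)
  | .or A B, h => orSplit (separate Y A h.1) (separate Y B h.2.1) h.2.2.1 h.2.2.2

section OrSplit

variable {X X₁ X₂ Y Y₁ Y₂ Z Z₁ Z₂ X' X₁' X₂' Y' Y₁' Y₂' : Plus Frm2}

theorem disj_orSplit {f : X ⟶ X'} {g : Y ⟶ Y'} {a : X ⟶ X₁ ⊗ X₂} {a' : X' ⟶ X₁' ⊗ X₂'}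
    {b : Y ⟶ Y₁ ⊗ Y₂} {b' : Y' ⟶ Y₁' ⊗ Y₂'} {f₁ : X₁ ⟶ X₁'} {f₂ : X₂ ⟶ X₂'} {g₁ : Y₁ ⟶ Y₁'}
    {g₂ : Y₂ ⟶ Y₂'} (hf : f ≫ a' = a ≫ (f₁ ⊗ₘ f₂)) (hg : g ≫ b' = b ≫ (g₁ ⊗ₘ g₂))
    (p : X₁.isUnit = Y₁.isUnit) (q : X₂.isUnit = Y₂.isUnit) (p' : X₁'.isUnit = Y₁'.isUnit)
    (q' : X₂'.isUnit = Y₂'.isUnit) :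
    disj f g ≫ orSplit a' b' p' q' = orSplit a b p q ≫ (disj f₁ g₁ ⊗ₘ disj f₂ g₂) := by
  simp only [orSplit]
  rw [Category.assoc, ← mix_natural, reassoc_of% (@disj_comp), hf, hg, reassoc_of% (@disj_comp)]

theorem opSwap_orSplit (a : X ⟶ X₁ ⊗ X₂) (b : Y ⟶ Y₁ ⊗ Y₂)
    (p : X₁.isUnit = Y₁.isUnit) (q : X₂.isUnit = Y₂.isUnit) :
    opSwap orS X Y ≫ orSplit b a p.symm q.symm =
      orSplit a b p q ≫ (opSwap orS X₁ Y₁ ⊗ₘ opSwap orS X₂ Y₂) := by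
  have h : opSwap orS (X₁ ⊗ X₂) (Y₁ ⊗ Y₂) ≫ mix Y₁ Y₂ X₁ X₂ p.symm q.symm =
    mix X₁ X₂ Y₁ Y₂ p q ≫ (opSwap orS X₁ Y₁ ⊗ₘ opSwap orS X₂ Y₂) :=
    swap_inter X₁ Y₁ X₂ Y₂ p q
  have e : disj a b ≫ opSwap orS _ _ = opSwap orS _ _ ≫ disj b a := opSwap_nat orS a b
  simp only [orSplit]
  rw [Category.assoc, ← h, ← Category.assoc, ← e, Category.assoc]

theorem isUnit_or {A B C : Plus Frm2} (p : A.isUnit = B.isUnit) (q : B.isUnit = C.isUnit) :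
    A.isUnit = (op orS B C).isUnit := by
  rw [isUnit_op, ← q, p, Bool.and_self]

theorem isUnit_or' {A B C : Plus Frm2} (p : A.isUnit = B.isUnit) (q : B.isUnit = C.isUnit) :
    (op orS A B).isUnit = C.isUnit := by
  rw [isUnit_op, p, q, Bool.and_self]

theorem opAssoc_inv_orSplit (a : X ⟶ X₁ ⊗ X₂) (b : Y ⟶ Y₁ ⊗ Y₂) (c : Z ⟶ Z₁ ⊗ Z₂)
    (p : X₁.isUnit = Y₁.isUnit) (q : X₂.isUnit = Y₂.isUnit)
    (p' : Y₁.isUnit = Z₁.isUnit) (q' : Y₂.isUnit = Z₂.isUnit) :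
    (opAssoc orS X Y Z).inv ≫ orSplit (orSplit a b p q) c (isUnit_or' p p') (isUnit_or' q q') =
      orSplit a (orSplit b c p' q') (isUnit_or p p') (isUnit_or q q') ≫
        ((opAssoc orS X₁ Y₁ Z₁).inv ⊗ₘ (opAssoc orS X₂ Y₂ Z₂).inv) := by
  have h : disj (𝟙 (X₁ ⊗ X₂)) (mix Y₁ Y₂ Z₁ Z₂ p' q') ≫
      mix X₁ X₂ (op orS Y₁ Z₁) (op orS Y₂ Z₂) (isUnit_or p p') (isUnit_or q q') ≫
        ((opAssoc orS X₁ Y₁ Z₁).inv ⊗ₘ (opAssoc orS X₂ Y₂ Z₂).inv) =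
      (opAssoc orS _ _ _).inv ≫ disj (mix X₁ X₂ Y₁ Y₂ p q) (𝟙 (Z₁ ⊗ Z₂)) ≫
        mix (op orS X₁ Y₁) (op orS X₂ Y₂) Z₁ Z₂ (isUnit_or' p p') (isUnit_or' q q') :=
    assoc_inter X₁ Y₁ Z₁ X₂ Y₂ Z₂ p p' q q' _ _ _ _
  have e : disj a (disj b c) ≫ (opAssoc orS _ _ _).inv =
    (opAssoc orS _ _ _).inv ≫ disj (disj a b) c := opAssoc_nat orS a b c
  have e₁ : disj a (disj b c ≫ mix Y₁ Y₂ Z₁ Z₂ p' q') =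
      disj a (disj b c) ≫ disj (𝟙 _) (mix Y₁ Y₂ Z₁ Z₂ p' q') := by
    rw [disj_comp, Category.comp_id]
  have e₂ : disj (disj a b ≫ mix X₁ X₂ Y₁ Y₂ p q) c =
      disj (disj a b) c ≫ disj (mix X₁ X₂ Y₁ Y₂ p q) (𝟙 _) := by
    rw [disj_comp, Category.comp_id]
  simp only [orSplit]
  rw [e₁, e₂, Category.assoc, Category.assoc, Category.assoc, h, reassoc_of% e]

theorem opAssoc_hom_orSplit (a : X ⟶ X₁ ⊗ X₂) (b : Y ⟶ Y₁ ⊗ Y₂) (c : Z ⟶ Z₁ ⊗ Z₂)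
    (p : X₁.isUnit = Y₁.isUnit) (q : X₂.isUnit = Y₂.isUnit)
    (p' : Y₁.isUnit = Z₁.isUnit) (q' : Y₂.isUnit = Z₂.isUnit) :
    (opAssoc orS X Y Z).hom ≫ orSplit a (orSplit b c p' q') (isUnit_or p p') (isUnit_or q q') =
      orSplit (orSplit a b p q) c (isUnit_or' p p') (isUnit_or' q q') ≫
        ((opAssoc orS X₁ Y₁ Z₁).hom ⊗ₘ (opAssoc orS X₂ Y₂ Z₂).hom) := by
  rw [← Iso.eq_inv_comp, reassoc_of% opAssoc_inv_orSplit a b c p q p' q',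
    tensorHom_comp_tensorHom, Iso.inv_hom_id, Iso.inv_hom_id, id_tensorHom_id, Category.comp_id]

theorem mix_split {W W₁ W₂ : Plus Frm2} (a : X ⟶ X₁ ⊗ X₂) (b : Y ⟶ Y₁ ⊗ Y₂) (c : Z ⟶ Z₁ ⊗ Z₂)
    (d : W ⟶ W₁ ⊗ W₂) (s : X.isUnit = Z.isUnit) (t : Y.isUnit = W.isUnit)
    (p₁ : X₁.isUnit = Z₁.isUnit) (p₂ : X₂.isUnit = Z₂.isUnit)
    (q₁ : Y₁.isUnit = W₁.isUnit) (q₂ : Y₂.isUnit = W₂.isUnit) :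
    mix X Y Z W s t ≫ split (orSplit a c p₁ p₂) (orSplit b d q₁ q₂) =
      orSplit (split a b) (split c d) (isUnit_tensor p₁ q₁) (isUnit_tensor p₂ q₂) ≫
        (mix X₁ Y₁ Z₁ W₁ p₁ q₁ ⊗ₘ mix X₂ Y₂ Z₂ W₂ p₂ q₂) := by
  have h := tensorμ_mix X₁ X₂ Y₁ Y₂ Z₁ Z₂ W₁ W₂ p₁ p₂ q₁ q₂
  simp only [orSplit, split]
  rw [← tensorHom_comp_tensorHom_assoc, ← disj_comp, Category.assoc, Category.assoc, h,
    reassoc_of% (@mix_natural)]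

end OrSplit

theorem separate_natural (Y : ℕ → Bool) {A B : Frm2} (f : Tm2 A B) (hB : Separable Y B) :
    ∃ (hA : Separable Y A) (f₁ : res Y A ⟶ res Y B) (f₂ : res (others Y) A ⟶ res (others Y) B),
      emb (toHom f) ≫ separate Y B hB = separate Y A hA ≫ (f₁ ⊗ₘ f₂) := by
  induction f with
  | id A => exact ⟨hB, 𝟙 _, 𝟙 _, by
      rw [id_tensorHom_id, Category.comp_id]; exact Category.id_comp _⟩
  | comp g f ihg ihf =>
    obtain ⟨hB', g₁, g₂, hg⟩ := ihg hB
    obtain ⟨hA, f₁, f₂, hf⟩ := ihf hB'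
    refine ⟨hA, f₁ ≫ g₁, f₂ ≫ g₂, ?_⟩
    change (emb (toHom f) ≫ emb (toHom g)) ≫ _ = _
    rw [Category.assoc, hg, reassoc_of% hf, tensorHom_comp_tensorHom]
  | orM f g ihf ihg =>
    obtain ⟨hf, hg, p, q⟩ := hB
    obtain ⟨hA, f₁, f₂, ef⟩ := ihf hf
    obtain ⟨hC, g₁, g₂, eg⟩ := ihg hg
    have p' := (isUnit_eq f₁).trans (p.trans (isUnit_eq g₁).symm)
    have q' := (isUnit_eq f₂).trans (q.trans (isUnit_eq g₂).symm)
    exact ⟨⟨hA, hC, p', q'⟩, disj f₁ g₁, disj f₂ g₂, disj_orSplit ef eg p' q' p q⟩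
  | andM f g ihf ihg =>
    obtain ⟨hA, f₁, f₂, ef⟩ := ihf hB.1
    obtain ⟨hC, g₁, g₂, eg⟩ := ihg hB.2
    exact ⟨⟨hA, hC⟩, f₁ ⊗ₘ g₁, f₂ ⊗ₘ g₂, map_split ef eg⟩
  | bOrTo A B C =>
    obtain ⟨⟨hA, hB, p, q⟩, hC, p', q'⟩ := hB
    replace p' : (op orS _ _).isUnit = _ := p'
    replace q' : (op orS _ _).isUnit = _ := q'
    rw [isUnit_op, p, Bool.and_self] at p'
    rw [isUnit_op, q, Bool.and_self] at q'
    exact ⟨⟨hA, ⟨hB, hC, p', q'⟩, isUnit_or p p', isUnit_or q q'⟩, _, _,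
      opAssoc_inv_orSplit (separate Y A hA) (separate Y B hB) (separate Y C hC) p q p' q'⟩
  | bOrFrom A B C =>
    obtain ⟨hA, ⟨hB, hC, p', q'⟩, p, q⟩ := hB
    replace p : _ = (op orS _ _).isUnit := p
    replace q : _ = (op orS _ _).isUnit := q
    rw [isUnit_op, ← p', Bool.and_self] at p
    rw [isUnit_op, ← q', Bool.and_self] at q
    exact ⟨⟨⟨hA, hB, p, q⟩, hC, isUnit_or' p p', isUnit_or' q q'⟩, _, _,
      opAssoc_hom_orSplit (separate Y A hA) (separate Y B hB) (separate Y C hC) p q p' q'⟩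
  | bAndTo A B C =>
    obtain ⟨⟨hA, hB⟩, hC⟩ := hB
    exact ⟨⟨hA, hB, hC⟩, _, _,
      associator_inv_split (separate Y A hA) (separate Y B hB) (separate Y C hC)⟩
  | bAndFrom A B C =>
    obtain ⟨hA, hB, hC⟩ := hB
    exact ⟨⟨⟨hA, hB⟩, hC⟩, _, _,
      associator_hom_split (separate Y A hA) (separate Y B hB) (separate Y C hC)⟩
  | cOr A B =>
    obtain ⟨hB, hA, p, q⟩ := hB
    exact ⟨⟨hA, hB, p.symm, q.symm⟩, _, _,
      opSwap_orSplit (separate Y A hA) (separate Y B hB) p.symm q.symm⟩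
  | cAnd A B =>
    obtain ⟨hB, hA⟩ := hB
    exact ⟨⟨hA, hB⟩, _, _, braiding_split (separate Y A hA) (separate Y B hB)⟩
  | ck A B C D =>
    obtain ⟨⟨hA, hC, p, p'⟩, hB, hD, q, q'⟩ := hB
    exact ⟨⟨⟨hA, hB⟩, ⟨hC, hD⟩, isUnit_tensor p q, isUnit_tensor p' q'⟩, _, _,
      mix_split (separate Y A hA) (separate Y B hB) (separate Y C hC) (separate Y D hD)
        rfl rfl p p' q q'⟩

theorem isIso_disj {X Y X' Y' : Plus Frm2} (f : X ⟶ X') (g : Y ⟶ Y') [IsIso f] [IsIso g] :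
    IsIso (disj f g) :=
  ⟨disj (inv f) (inv g), by simp [disj_comp, disj_id], by simp [disj_comp, disj_id]⟩

theorem isIso_mix (A B C D : Plus Frm2) (p : A.isUnit = C.isUnit) (q : B.isUnit = D.isUnit)
    (h : A.isUnit ∨ B.isUnit) : IsIso (mix A B C D p q) := by
  unfold mix
  cases A <;> cases C <;> cases p <;> cases B <;> cases D <;> cases q <;> first
    | exact IsIso.id _
    | simp [isUnit] at h

/-- A formula without letters from `Y`, or without letters outside `Y`, is separated by an
isomorphism. -/
theorem exists_isIso_separate (Y : ℕ → Bool) (D : Frm2)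
    (h : (res Y D).isUnit ∨ (res (others Y) D).isUnit) :
    ∃ hD : Separable Y D, IsIso (separate Y D hD) := by
  induction D with
  | pl n => exact ⟨trivial, inferInstanceAs (IsIso (eqToHom (of_pl_eq Y n)))⟩
  | and A B ihA ihB =>
    simp only [res, isUnit_op, Bool.and_eq_true] at h
    obtain ⟨hA, iA⟩ := ihA (h.imp And.left And.left)
    obtain ⟨hB, iB⟩ := ihB (h.imp And.right And.right)
    exact ⟨⟨hA, hB⟩, inferInstanceAs (IsIso (split (separate Y A hA) (separate Y B hB)))⟩
  | or A B ihA ihB =>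
    simp only [res, isUnit_op, Bool.and_eq_true] at h
    obtain ⟨hA, iA⟩ := ihA (h.imp And.left And.left)
    obtain ⟨hB, iB⟩ := ihB (h.imp And.right And.right)
    have p : (res Y A).isUnit = (res Y B).isUnit ∧
        (res (others Y) A).isUnit = (res (others Y) B).isUnit := by
      rcases h with h | h
      · exact ⟨h.1.trans h.2.symm, (isUnit_res_others h.1).trans (isUnit_res_others h.2).symm⟩
      · exact ⟨(isUnit_res h.1).trans (isUnit_res h.2).symm, h.1.trans h.2.symm⟩
    have := isIso_disj (separate Y A hA) (separate Y B hB)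
    have := isIso_mix _ _ _ _ p.1 p.2 (h.imp And.left And.left)
    exact ⟨⟨hA, hB, p⟩, inferInstanceAs (IsIso (disj (separate Y A hA) (separate Y B hB) ≫
      mix _ _ _ _ p.1 p.2))⟩

end Conjunction

theorem isUnit_iff {C : Type} {X : Plus C} : X.isUnit = true ↔ X = .unit := by
  cases X <;> simp [isUnit]

theorem isUnit_res_of_forall {Y : ℕ → Bool} {D : Frm2} (h : ∀ n, Y n = true → cnt2 n D = 0) :
    (res Y D).isUnit = true := by
  induction D with
  | pl m =>
    have := h m
    cases e : Y m <;> simp_all [res, isUnit, cnt2]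
  | and A B ihA ihB =>
    simp only [cnt2, Nat.add_eq_zero_iff] at h
    simp [res, isUnit_op, ihA fun n hn => (h n hn).1, ihB fun n hn => (h n hn).2]
  | or A B ihA ihB =>
    simp only [cnt2, Nat.add_eq_zero_iff] at h
    simp [res, isUnit_op, ihA fun n hn => (h n hn).1, ihB fun n hn => (h n hn).2]

theorem isUnit_res_eq (Y : ℕ → Bool) {A B : Frm2} (f : Tm2 A B) :
    (res Y A).isUnit = (res Y B).isUnit := by
  induction f <;> simp_all [res, isUnit_op, Bool.and_assoc, Bool.and_comm, Bool.and_left_comm]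

section Disjunction

open MonoidalCategory BraidedCategory

/-- The monoidal structure given by disjunction. -/
@[reducible]
def orMonoidal : MonoidalCategory (Plus Frm2) := monoidal orS

attribute [local instance] orMonoidal

/-- The symmetry of disjunction. -/
@[reducible]
def orSymmetric : SymmetricCategory (Plus Frm2) := symmetric orS

attribute [local instance] orSymmetric

/-- Formulas that are disjunctions of a formula with letters in `Y` and one with letters
outside `Y`, up to associativity and symmetry. -/
def Decomposable (Y : ℕ → Bool) : Frm2 → Prop
  | .pl _ => True
  | .or A B => Decomposable Y A ∧ Decomposable Y B
  | .and A B => (res Y (A.and B)).isUnit ∨ (res (others Y) (A.and B)).isUnit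

theorem of_eq_tensor {Y : ℕ → Bool} {D : Frm2}
    (h : (res Y D).isUnit ∨ (res (others Y) D).isUnit) :
    Plus.of D = res Y D ⊗ res (others Y) D := by
  rcases h with h | h
  · rw [isUnit_iff.mp h, res_eq_of_isUnit (by rwa [others_others])]; rfl
  · rw [isUnit_iff.mp h, res_eq_of_isUnit h]; rfl

theorem isUnit_res_pl (Y : ℕ → Bool) (n : ℕ) :
    (res Y (.pl n)).isUnit ∨ (res (others Y) (.pl n)).isUnit := by
  cases e : Y n <;> simp [res, others, isUnit, e]

/-- The arrow decomposing a formula. -/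
def decompose (Y : ℕ → Bool) : ∀ D : Frm2, Decomposable Y D →
    (Plus.of D ⟶ res Y D ⊗ res (others Y) D)
  | .pl n, _ => eqToHom (of_eq_tensor (isUnit_res_pl Y n))
  | .or A B, h => split (decompose Y A h.1) (decompose Y B h.2)
  | .and _ _, h => eqToHom (of_eq_tensor h)

theorem isIso_decompose (Y : ℕ → Bool) (D : Frm2) (hD : Decomposable Y D) :
    IsIso (decompose Y D hD) := by
  induction D with
  | pl n => exact inferInstanceAs (IsIso (eqToHom (of_eq_tensor (isUnit_res_pl Y n))))
  | or A B ihA ihB =>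
    have := ihA hD.1
    have := ihB hD.2
    exact inferInstanceAs (IsIso (split (decompose Y A hD.1) (decompose Y B hD.2)))
  | and A B ihA ihB => exact inferInstanceAs (IsIso (eqToHom (of_eq_tensor hD)))

theorem decomposable_of_isUnit {Y : ℕ → Bool} {D : Frm2}
    (h : (res Y D).isUnit ∨ (res (others Y) D).isUnit) : Decomposable Y D := by
  induction D with
  | pl n => trivial
  | or A B ihA ihB =>
    simp only [res, isUnit_op, Bool.and_eq_true] at h
    exact ⟨ihA (h.imp And.left And.left), ihB (h.imp And.right And.right)⟩
  | and A B => exact h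

theorem exists_eq_tensorHom {X₁ X₂ Y₁ Y₂ : Plus Frm2} (p : X₁.isUnit = Y₁.isUnit)
    (q : X₂.isUnit = Y₂.isUnit) (h : Y₁.isUnit ∨ Y₂.isUnit) (g : X₁ ⊗ X₂ ⟶ Y₁ ⊗ Y₂) :
    ∃ (f₁ : X₁ ⟶ Y₁) (f₂ : X₂ ⟶ Y₂), g = f₁ ⊗ₘ f₂ := by
  cases X₁ <;> cases Y₁ <;> cases p
  · exact ⟨𝟙 _, g, rfl⟩
  · cases X₂ <;> cases Y₂ <;> cases q
    · obtain ⟨g, rfl⟩ := emb_surjective g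
      exact ⟨emb g, 𝟙 _, rfl⟩
    · simp [isUnit] at h

theorem decompose_natural_of_isUnit {Y : ℕ → Bool} {A B : Frm2} (f : Tm2 A B)
    (hB : Decomposable Y B) (h : (res Y B).isUnit ∨ (res (others Y) B).isUnit) :
    ∃ (hA : Decomposable Y A) (f₁ : res Y A ⟶ res Y B) (f₂ : res (others Y) A ⟶ res (others Y) B),
      emb (toHom f) ≫ decompose Y B hB = decompose Y A hA ≫ (f₁ ⊗ₘ f₂) := by
  have p := isUnit_res_eq Y f
  have q := isUnit_res_eq (others Y) f
  have hA : Decomposable Y A := decomposable_of_isUnit (by rwa [p, q])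
  have := isIso_decompose Y A hA
  obtain ⟨f₁, f₂, e⟩ :=
    exists_eq_tensorHom p q h (inv (decompose Y A hA) ≫ emb (toHom f) ≫ decompose Y B hB)
  exact ⟨hA, f₁, f₂, by rw [← e, IsIso.hom_inv_id_assoc]⟩

theorem decompose_natural (Y : ℕ → Bool) {A B : Frm2} (f : Tm2 A B) (hB : Decomposable Y B) :
    ∃ (hA : Decomposable Y A) (f₁ : res Y A ⟶ res Y B) (f₂ : res (others Y) A ⟶ res (others Y) B),
      emb (toHom f) ≫ decompose Y B hB = decompose Y A hA ≫ (f₁ ⊗ₘ f₂) := by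
  induction f with
  | id A => exact ⟨hB, 𝟙 _, 𝟙 _, by
      rw [id_tensorHom_id, Category.comp_id]; exact Category.id_comp _⟩
  | comp g f ihg ihf =>
    obtain ⟨hB', g₁, g₂, hg⟩ := ihg hB
    obtain ⟨hA, f₁, f₂, hf⟩ := ihf hB'
    refine ⟨hA, f₁ ≫ g₁, f₂ ≫ g₂, ?_⟩
    change (emb (toHom f) ≫ emb (toHom g)) ≫ _ = _
    rw [Category.assoc, hg, reassoc_of% hf, tensorHom_comp_tensorHom]
  | orM f g ihf ihg =>
    obtain ⟨hA, f₁, f₂, ef⟩ := ihf hB.1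
    obtain ⟨hC, g₁, g₂, eg⟩ := ihg hB.2
    exact ⟨⟨hA, hC⟩, f₁ ⊗ₘ g₁, f₂ ⊗ₘ g₂, map_split ef eg⟩
  | bOrTo A B C =>
    obtain ⟨⟨hA, hB⟩, hC⟩ := hB
    exact ⟨⟨hA, hB, hC⟩, _, _,
      associator_inv_split (decompose Y A hA) (decompose Y B hB) (decompose Y C hC)⟩
  | bOrFrom A B C =>
    obtain ⟨hA, hB, hC⟩ := hB
    exact ⟨⟨⟨hA, hB⟩, hC⟩, _, _,
      associator_hom_split (decompose Y A hA) (decompose Y B hB) (decompose Y C hC)⟩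
  | cOr A B =>
    obtain ⟨hB, hA⟩ := hB
    exact ⟨⟨hA, hB⟩, _, _, braiding_split (decompose Y A hA) (decompose Y B hB)⟩
  | andM f g => exact decompose_natural_of_isUnit (f.andM g) hB hB
  | bAndTo A B C => exact decompose_natural_of_isUnit (.bAndTo A B C) hB hB
  | bAndFrom A B C => exact decompose_natural_of_isUnit (.bAndFrom A B C) hB hB
  | cAnd A B => exact decompose_natural_of_isUnit (.cAnd A B) hB hB
  | ck A B C D => exact decompose_natural_of_isUnit (.ck A B C D) hB hB

end Disjunction

theorem hom_unique {B : Frm2} (h : ∀ {A : Frm2} (f g : A ⟶ B), f = g) {X Z : Plus Frm2}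
    (hZ : Z = Plus.of B) (f g : X ⟶ Z) : f = g := by
  subst hZ
  match X, f, g with
  | _, .of f, .of g => exact congrArg emb (h f g)

end Plus

open Plus

theorem eq_eqToHom_of_pl {A B : Frm2} (f : Tm2 A B) {n : ℕ} (hB : B = .pl n) :
    ∃ h : A = B, toHom f = eqToHom h := by
  induction f with
  | id A => exact ⟨rfl, rfl⟩
  | comp g f ihg ihf =>
    obtain ⟨rfl, hg⟩ := ihg hB
    obtain ⟨rfl, hf⟩ := ihf hB
    refine ⟨rfl, ?_⟩
    change toHom f ≫ toHom g = _
    rw [hf, hg]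
    exact Category.comp_id _
  | _ => cases hB

/-- The letters of a formula. -/
def letters (D : Frm2) : ℕ → Bool := fun n => decide (0 < cnt2 n D)

theorem isUnit_res_others_letters (D : Frm2) : (res (others (letters D)) D).isUnit = true :=
  isUnit_res_of_forall fun n hn => by simpa [others, letters] using hn

theorem isUnit_res_letters {B C : Frm2} (h : ∀ n, cnt2 n B + cnt2 n C ≤ 1) :
    (res (letters B) C).isUnit = true :=
  isUnit_res_of_forall fun n hn => by
    have := h n
    have : 0 < cnt2 n B := by simpa [letters] using hn
    omega

theorem hom_eq (B : Frm2) : Div2 B → ∀ {A : Frm2} (f g : A ⟶ B), f = g := by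
  induction B with
  | pl n =>
    rintro - A ⟨f⟩ ⟨g⟩
    obtain ⟨rfl, hf⟩ := eq_eqToHom_of_pl f rfl
    obtain ⟨_, hg⟩ := eq_eqToHom_of_pl g rfl
    exact hf.trans hg.symm
  | and B C ihB ihC =>
    rintro hD A ⟨f⟩ ⟨g⟩
    replace hD : ∀ n, cnt2 n B + cnt2 n C ≤ 1 := hD
    have uB := isUnit_res_others_letters B
    have uC := isUnit_res_letters hD
    obtain ⟨hB, iB⟩ := exists_isIso_separate (letters B) B (.inr uB)
    obtain ⟨hC, iC⟩ := exists_isIso_separate (letters B) C (.inl uC)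
    let _ := andMonoidal
    let _ := andSymmetric
    have i : IsIso (separate (letters B) (B.and C) ⟨hB, hC⟩) :=
      inferInstanceAs (IsIso (split (separate (letters B) B hB) (separate (letters B) C hC)))
    obtain ⟨hA, f₁, f₂, hf⟩ := separate_natural (letters B) f ⟨hB, hC⟩
    obtain ⟨_, g₁, g₂, hg⟩ := separate_natural (letters B) g ⟨hB, hC⟩
    have e₁ : f₁ = g₁ := hom_unique (ihB fun n => by have := hD n; omega)
      (by rw [res, res_eq_of_isUnit uB, isUnit_iff.mp uC]; rfl) _ _
    have e₂ : f₂ = g₂ := hom_unique (ihC fun n => by have := hD n; omega)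
      (by rw [res, res_eq_of_isUnit (D := C) (by rwa [others_others]), isUnit_iff.mp uB]; rfl) _ _
    subst e₁ e₂
    exact emb_injective ((cancel_mono _).mp (hf.trans hg.symm))
  | or B C ihB ihC =>
    rintro hD A ⟨f⟩ ⟨g⟩
    replace hD : ∀ n, cnt2 n B + cnt2 n C ≤ 1 := hD
    have uB := isUnit_res_others_letters B
    have uC := isUnit_res_letters hD
    have h : Decomposable (letters B) (B.or C) :=
      ⟨decomposable_of_isUnit (.inr uB), decomposable_of_isUnit (.inl uC)⟩
    have i := isIso_decompose _ _ h
    obtain ⟨hA, f₁, f₂, hf⟩ := decompose_natural (letters B) f h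
    obtain ⟨_, g₁, g₂, hg⟩ := decompose_natural (letters B) g h
    have e₁ : f₁ = g₁ := hom_unique (ihB fun n => by have := hD n; omega)
      (by rw [res, res_eq_of_isUnit uB, isUnit_iff.mp uC]; rfl) _ _
    have e₂ : f₂ = g₂ := hom_unique (ihC fun n => by have := hD n; omega)
      (by rw [res, res_eq_of_isUnit (D := C) (by rwa [others_others]), isUnit_iff.mp uB]; rfl) _ _
    subst e₁ e₂
    exact emb_injective ((cancel_mono _).mp (hf.trans hg.symm))

/-- Theorem 3.2 (Symmetric Biassociative Intermuting Coherence) : in the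
free SAI category 𝓐 , if `A` and `B` are diversified, then there is at most
one arrow `f : A → B`. -/
theorem SAI_coherence {A B : Frm2} (hA : Div2 A) (hB : Div2 B)
    (f g : Tm2 A B) : Eq2 f g :=
  Quotient.exact (hom_eq B hB (toHom f) (toHom g))

end SAI
end
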